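/- arXiv:2501.18906 — 2 statements merged into one kernel-verified Lean document; each statement's English description precedes it below -/
import Mathlib

section
/- Let F be a field of characteristic different from 2, let k be a field of characteristic 2 with more than two elements, and let n ≥ 3. Then there exist a field extension K of F and a continuous homomorphism ρ : Γ_K → GL_n(k) that does not lift to W₂(k): no continuous homomorphism ρ̃ : Γ_K → GL_n(W₂(k)) satisfies π ∘ ρ̃ = ρ. -/
open Matrix Topology

/-- The reduction ring homomorphism `π : W₂(k) → k` from the ring of `p`-typical length-`2`
Witt vectors of `k` to `k`, given by the zeroth Witt coefficient. -/
noncomputable def wittReduce (p : ℕ) [hp : Fact p.Prime] (k : Type*) [CommRing k] :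
    TruncatedWittVector p 2 k →+* k where
  toFun x := x.coeff 0
  map_one' := by
    show TruncatedWittVector.coeff 0 (1 : TruncatedWittVector p 2 k) = 1
    rw [show (1 : TruncatedWittVector p 2 k) = WittVector.truncate 2 (1 : WittVector p k) from
        (_root_.map_one _).symm, WittVector.coeff_truncate]
    simpa using WittVector.one_coeff_zero p k
  map_mul' x y := by
    show TruncatedWittVector.coeff 0 (x * y)
        = TruncatedWittVector.coeff 0 x * TruncatedWittVector.coeff 0 y
    obtain ⟨a, ha⟩ := WittVector.truncate_surjective (p := p) 2 k x
    obtain ⟨b, hb⟩ := WittVector.truncate_surjective (p := p) 2 k y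
    rw [← ha, ← hb, ← _root_.map_mul, WittVector.coeff_truncate, WittVector.coeff_truncate,
      WittVector.coeff_truncate]
    simpa using WittVector.mul_coeff_zero a b
  map_zero' := by
    show TruncatedWittVector.coeff 0 (0 : TruncatedWittVector p 2 k) = 0
    rw [show (0 : TruncatedWittVector p 2 k) = WittVector.truncate 2 (0 : WittVector p k) from
        (_root_.map_zero _).symm, WittVector.coeff_truncate]
    simpa using WittVector.zero_coeff p k 0
  map_add' x y := by
    show TruncatedWittVector.coeff 0 (x + y)
        = TruncatedWittVector.coeff 0 x + TruncatedWittVector.coeff 0 y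
    obtain ⟨a, ha⟩ := WittVector.truncate_surjective (p := p) 2 k x
    obtain ⟨b, hb⟩ := WittVector.truncate_surjective (p := p) 2 k y
    rw [← ha, ← hb, ← _root_.map_add, WittVector.coeff_truncate, WittVector.coeff_truncate,
      WittVector.coeff_truncate]
    simpa using WittVector.add_coeff_zero a b

theorem sum_eq_sum_filter_fixed {T A : Type*} [DecidableEq T] [AddCommMonoid A]
    (α β : T → T) (hα : ∀ D, α (α D) = D) (hβ : ∀ D, β (β D) = D)
    (hαβ : ∀ D, α (β D) = β (α D)) (f : T → A) (B : Finset T)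
    (hBα : ∀ D ∈ B, α D ∈ B) (hBβ : ∀ D ∈ B, β D ∈ B)
    (hfree : ∀ D ∈ B, α D ≠ D → β D ≠ D → α D ≠ β D →
      f D + f (α D) + f (β D) + f (α (β D)) = 0)
    (hfα : ∀ D ∈ B, α D = D → β D ≠ D → f D + f (β D) = 0)
    (hfβ : ∀ D ∈ B, β D = D → α D ≠ D → f D + f (α D) = 0)
    (hfαβ : ∀ D ∈ B, α D = β D → α D ≠ D → f D + f (α D) = 0) :
    ∑ D ∈ B, f D = ∑ D ∈ B with α D = D ∧ β D = D, f D := by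
  induction B using Finset.strongInduction with
  | H B ih =>
    by_cases hfix : ∀ D ∈ B, α D = D ∧ β D = D
    · rw [Finset.filter_true_of_mem hfix]
    push Not at hfix
    obtain ⟨D, hD, hne⟩ := hfix
    set O : Finset T := {D, α D, β D, α (β D)} with hO
    have hOα : ∀ E, α E ∈ O ↔ E ∈ O := by
      have h : ∀ E, E ∈ O → α E ∈ O := by
        intro E hE
        simp only [hO, Finset.mem_insert, Finset.mem_singleton] at hE ⊢
        rcases hE with rfl | rfl | rfl | rfl <;> simp [hα]
      exact fun E => ⟨fun hE => by simpa [hα] using h _ hE, h E⟩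
    have hOβ : ∀ E, β E ∈ O ↔ E ∈ O := by
      have h : ∀ E, E ∈ O → β E ∈ O := by
        intro E hE
        simp only [hO, Finset.mem_insert, Finset.mem_singleton] at hE ⊢
        rcases hE with rfl | rfl | rfl | rfl <;> simp [hβ, hαβ]
      exact fun E => ⟨fun hE => by simpa [hβ] using h _ hE, h E⟩
    have hOB : O ⊆ B := by
      intro E hE
      simp only [hO, Finset.mem_insert, Finset.mem_singleton] at hE
      rcases hE with rfl | rfl | rfl | rfl
      exacts [hD, hBα _ hD, hBβ _ hD, hBα _ (hBβ _ hD)]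
    have hsum : ∑ E ∈ O, f E = 0 := by
      by_cases h1 : α D = D
      · have h2 : β D ≠ D := hne h1
        have : O = {D, β D} := by ext E; simp [hO, h1, hαβ]
        rw [this, Finset.sum_pair h2.symm, hfα D hD h1 h2]
      by_cases h2 : β D = D
      · have : O = {D, α D} := by ext E; simp [hO, h2]
        rw [this, Finset.sum_pair (Ne.symm h1), hfβ D hD h2 h1]
      by_cases h3 : α D = β D
      · have : O = {D, α D} := by ext E; simp [hO, ← h3, hα]; tauto
        rw [this, Finset.sum_pair (Ne.symm h1), hfαβ D hD h3 h1]
      have h4 : D ≠ α (β D) := fun h => h3 (by rw [h, hα, ← h])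
      have h5 : α D ≠ α (β D) := fun h => h2 (by rw [← hα (β D), ← h, hα])
      have h6 : β D ≠ α (β D) := fun h => h1 (by
        rw [hαβ] at h; rw [← hβ (α D), ← h, hβ])
      rw [hO, Finset.sum_insert, Finset.sum_insert, Finset.sum_pair h6,
        ← hfree D hD h1 h2 h3]
      · abel
      · simp [h3, h5]
      · simp [Ne.symm h1, Ne.symm h2, h4]
    have hOf : ∀ E ∈ O, ¬ (α E = E ∧ β E = E) := by
      intro E hE h
      simp only [hO, Finset.mem_insert, Finset.mem_singleton] at hE
      rcases hE with rfl | rfl | rfl | rfl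
      · exact hne h.1 h.2
      · rw [hα, ← hαβ] at h
        exact hne h.1.symm (by rw [← hα (β D), h.2, hα])
      · rw [hβ, hαβ] at h
        exact hne (by rw [← hβ (α D), h.1, hβ]) h.2.symm
      · rw [hα, ← hαβ (β D), hβ] at h
        have h2 : β D = D := by rw [← hα (β D), ← h.2, hα]
        rw [h2] at h
        exact hne h.1.symm h2
    rw [← Finset.sum_sdiff hOB, hsum, add_zero, ih (B \ O)]
    · congr 1
      ext E
      simp only [Finset.mem_filter, Finset.mem_sdiff]
      exact ⟨fun h => ⟨h.1.1, h.2⟩, fun h => ⟨⟨h.1, fun hE => hOf E hE h.2⟩, h.2⟩⟩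
    · exact Finset.sdiff_ssubset hOB ⟨D, by simp [hO]⟩
    · intro E hE
      simp only [Finset.mem_sdiff] at hE ⊢
      exact ⟨hBα _ hE.1, by rw [hOα]; exact hE.2⟩
    · intro E hE
      simp only [Finset.mem_sdiff] at hE ⊢
      exact ⟨hBβ _ hE.1, by rw [hOβ]; exact hE.2⟩
    all_goals
      intro E hE
      first
      | exact hfree E (Finset.mem_sdiff.1 hE).1
      | exact hfα E (Finset.mem_sdiff.1 hE).1
      | exact hfβ E (Finset.mem_sdiff.1 hE).1
      | exact hfαβ E (Finset.mem_sdiff.1 hE).1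

/-- A group of order `128`: unitriangular `3 × 3` matrices with upper entries `p₁ + p₂ e`,
`q₁ + q₂ e` and `r₀ + r₁ e + r₂ e²`, where `e` is an indeterminate and all coefficients lie in
`ZMod 2`. -/
@[ext]
structure HeisBits where
  p₁ : ZMod 2
  p₂ : ZMod 2
  q₁ : ZMod 2
  q₂ : ZMod 2
  r₀ : ZMod 2
  r₁ : ZMod 2
  r₂ : ZMod 2

namespace HeisBits

instance : Mul HeisBits := ⟨fun g h =>
  ⟨g.p₁ + h.p₁, g.p₂ + h.p₂, g.q₁ + h.q₁, g.q₂ + h.q₂, g.r₀ + h.r₀ + g.p₁ * h.q₁,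
    g.r₁ + h.r₁ + g.p₁ * h.q₂ + g.p₂ * h.q₁, g.r₂ + h.r₂ + g.p₂ * h.q₂⟩⟩

instance : One HeisBits := ⟨⟨0, 0, 0, 0, 0, 0, 0⟩⟩

instance : Inv HeisBits := ⟨fun g =>
  ⟨-g.p₁, -g.p₂, -g.q₁, -g.q₂, -g.r₀ + g.p₁ * g.q₁, -g.r₁ + g.p₁ * g.q₂ + g.p₂ * g.q₁,
    -g.r₂ + g.p₂ * g.q₂⟩⟩

theorem mul_def (g h : HeisBits) : g * h =
  ⟨g.p₁ + h.p₁, g.p₂ + h.p₂, g.q₁ + h.q₁, g.q₂ + h.q₂, g.r₀ + h.r₀ + g.p₁ * h.q₁,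
    g.r₁ + h.r₁ + g.p₁ * h.q₂ + g.p₂ * h.q₁, g.r₂ + h.r₂ + g.p₂ * h.q₂⟩ := rfl

theorem one_def : (1 : HeisBits) = ⟨0, 0, 0, 0, 0, 0, 0⟩ := rfl

theorem inv_def (g : HeisBits) : g⁻¹ =
  ⟨-g.p₁, -g.p₂, -g.q₁, -g.q₂, -g.r₀ + g.p₁ * g.q₁, -g.r₁ + g.p₁ * g.q₂ + g.p₂ * g.q₁,
    -g.r₂ + g.p₂ * g.q₂⟩ := rfl

instance : Group HeisBits :=
  Group.ofLeftAxioms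
    (fun a b c => by simp only [mul_def]; ext <;> ring)
    (fun a => by simp only [mul_def, one_def]; ext <;> ring)
    (fun a => by simp only [mul_def, one_def, inv_def]; ext <;> ring)

instance : Finite HeisBits :=
  Finite.of_injective
    (fun g : HeisBits => (g.p₁, g.p₂, g.q₁, g.q₂, g.r₀, g.r₁, g.r₂)) fun g h hgh => by
      simp only [Prod.mk.injEq] at hgh
      ext1 <;> tauto

/-- The central element with upper entries `0`, `0`, `1`. -/
def d : HeisBits := ⟨0, 0, 0, 0, 1, 0, 0⟩

/-- The central element with upper entries `0`, `0`, `e`. -/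
def c : HeisBits := ⟨0, 0, 0, 0, 0, 1, 0⟩

/-- The central element with upper entries `0`, `0`, `e²`. -/
def γ : HeisBits := ⟨0, 0, 0, 0, 0, 0, 1⟩

/-- The element with upper entries `1`, `0`, `0`. -/
def x₁ : HeisBits := ⟨1, 0, 0, 0, 0, 0, 0⟩

/-- The element with upper entries `e`, `0`, `0`. -/
def x₂ : HeisBits := ⟨0, 1, 0, 0, 0, 0, 0⟩

/-- The element with upper entries `0`, `1`, `0`. -/
def y₁ : HeisBits := ⟨0, 0, 1, 0, 0, 0, 0⟩

/-- The element with upper entries `0`, `e`, `0`. -/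
def y₂ : HeisBits := ⟨0, 0, 0, 1, 0, 0, 0⟩

theorem d_mul_comm (g : HeisBits) : d * g = g * d := by
  simp only [mul_def, d]; ext <;> ring

theorem c_mul_comm (g : HeisBits) : c * g = g * c := by
  simp only [mul_def, c]; ext <;> ring

theorem γ_mul_comm (g : HeisBits) : γ * g = g * γ := by
  simp only [mul_def, γ]; ext <;> ring

theorem d_mul_d : d * d = 1 := by simp only [mul_def, d, one_def]; ext <;> decide
theorem c_mul_c : c * c = 1 := by simp only [mul_def, c, one_def]; ext <;> decide
theorem γ_mul_γ : γ * γ = 1 := by simp only [mul_def, γ, one_def]; ext <;> decide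
theorem x₁_mul_x₁ : x₁ * x₁ = 1 := by simp only [mul_def, x₁, one_def]; ext <;> decide
theorem x₂_mul_x₂ : x₂ * x₂ = 1 := by simp only [mul_def, x₂, one_def]; ext <;> decide
theorem y₁_mul_y₁ : y₁ * y₁ = 1 := by simp only [mul_def, y₁, one_def]; ext <;> decide
theorem y₂_mul_y₂ : y₂ * y₂ = 1 := by simp only [mul_def, y₂, one_def]; ext <;> decide
theorem x₁_mul_x₂ : x₁ * x₂ = x₂ * x₁ := by simp only [mul_def, x₁, x₂]; ext <;> decide
theorem y₁_mul_y₂ : y₁ * y₂ = y₂ * y₁ := by simp only [mul_def, y₁, y₂]; ext <;> decide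
theorem x₁_mul_y₁ : x₁ * y₁ = d * (y₁ * x₁) := by simp only [mul_def, x₁, y₁, d]; ext <;> decide
theorem x₁_mul_y₂ : x₁ * y₂ = c * (y₂ * x₁) := by simp only [mul_def, x₁, y₂, c]; ext <;> decide
theorem x₂_mul_y₁ : x₂ * y₁ = c * (y₁ * x₂) := by simp only [mul_def, x₂, y₁, c]; ext <;> decide
theorem x₂_mul_y₂ : x₂ * y₂ = γ * (y₂ * x₂) := by simp only [mul_def, x₂, y₂, γ]; ext <;> decide

/-- The generators generate. -/
theorem mem_of_generators (S : Subgroup HeisBits) (hd : d ∈ S) (hc : c ∈ S) (hγ : γ ∈ S)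
    (hx₁ : x₁ ∈ S) (hx₂ : x₂ ∈ S) (hy₁ : y₁ ∈ S) (hy₂ : y₂ ∈ S) (g : HeisBits) : g ∈ S := by
  have key : g = y₁ ^ g.q₁.val * y₂ ^ g.q₂.val * x₁ ^ g.p₁.val * x₂ ^ g.p₂.val *
      d ^ g.r₀.val * c ^ g.r₁.val * γ ^ g.r₂.val := by
    have h : ∀ x : ZMod 2, x = 0 ∨ x = 1 := by decide
    obtain ⟨p₁, p₂, q₁, q₂, r₀, r₁, r₂⟩ := g
    simp only
    rcases h p₁ with rfl | rfl <;> rcases h p₂ with rfl | rfl <;> rcases h q₁ with rfl | rfl <;>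
    rcases h q₂ with rfl | rfl <;> rcases h r₀ with rfl | rfl <;> rcases h r₁ with rfl | rfl <;>
    rcases h r₂ with rfl | rfl <;>
    simp [ZMod.val_one, mul_def, one_def, d, c, γ, x₁, x₂, y₁, y₂]
  rw [key]
  exact mul_mem (mul_mem (mul_mem (mul_mem (mul_mem (mul_mem (pow_mem hy₁ _) (pow_mem hy₂ _))
    (pow_mem hx₁ _)) (pow_mem hx₂ _)) (pow_mem hd _)) (pow_mem hc _)) (pow_mem hγ _)

section Matrix

variable {ι k : Type*} [Fintype ι] [DecidableEq ι] [CommRing k] [CharP k 2]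

/-- Specialising `e` to `t` in `HeisBits`, as a homomorphism to matrices supported on the indices
`i`, `j`, `l`. -/
def toMatrix (t : k) {i j l : ι} (hij : i ≠ j) (hil : i ≠ l) (hjl : j ≠ l) :
    HeisBits →* Matrix ι ι k where
  toFun g := 1 + single i j (ZMod.castHom (dvd_refl 2) k g.p₁ +
    ZMod.castHom (dvd_refl 2) k g.p₂ * t)
    + single j l (ZMod.castHom (dvd_refl 2) k g.q₁ + ZMod.castHom (dvd_refl 2) k g.q₂ * t)
    + single i l (ZMod.castHom (dvd_refl 2) k g.r₀ + ZMod.castHom (dvd_refl 2) k g.r₁ * t +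
      ZMod.castHom (dvd_refl 2) k g.r₂ * t ^ 2)
  map_one' := by simp [one_def]
  map_mul' g h := by
    simp only [mul_def, map_add, map_mul, mul_add, add_mul, mul_one, one_mul,
      single_mul_single_same, single_mul_single_of_ne _ _ _ _ hij.symm,
      single_mul_single_of_ne _ _ _ _ hil.symm, single_mul_single_of_ne _ _ _ _ hjl.symm,
      single_add, add_zero]
    have : ∀ x y : k, x * t * y = x * y * t := fun x y => by ring
    have h2 : ∀ x y : k, x * (y * t) = x * y * t := fun x y => by ring
    have h3 : ∀ x y : k, x * y * t * t = x * y * t ^ 2 := fun x y => by ring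
    simp only [this, h2, h3]
    abel

end Matrix

end HeisBits

theorem apply_of_mul_one_add_single {ι k : Type*} [Fintype ι] [DecidableEq ι] [CommRing k]
    {a a' : Matrix ι ι k} {x y : ι} {s : k}
    (h : a' * (1 + single x y s) = (1 + single x y s) * a) (u v : ι) :
    a' u v + (if v = y then a' u x * s else 0) = a u v + (if u = x then s * a y v else 0) := by
  have := congrFun (congrFun h u) v
  rw [mul_add, add_mul, mul_one, one_mul, Matrix.add_apply, Matrix.add_apply] at this
  convert this using 2
  · split_ifs with hv
    · subst hv; simp
    · rw [mul_single_apply_of_ne _ _ _ _ _ hv]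
  · split_ifs with hv
    · subst hv; simp
    · rw [single_mul_apply_of_ne _ _ _ _ _ hv]

open HeisBits in
theorem sum_weight_eq_zero {T k ι : Type*} [DecidableEq T] [Field k] [CharP k 2]
    [Fintype ι] [DecidableEq ι] {i j l : ι} (hij : i ≠ j) (hil : i ≠ l) (hjl : j ≠ l)
    [MulAction HeisBits T] {t : k} (ht : t ≠ 0) (ht' : 1 + t ≠ 0)
    (B : Finset T) (hB : ∀ g : HeisBits, ∀ D ∈ B, g • D ∈ B)
    (a : T → Matrix ι ι k)
    (ha : ∀ g : HeisBits, ∀ D ∈ B,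
      a (g • D) * toMatrix t hij hil hjl g = toMatrix t hij hil hjl g * a D)
    (ε₁ ε₂ ε₃ : T → k)
    (h₁ : ∀ D, ε₁ (d • D) = ε₁ D) (h₂ : ∀ D, ε₂ (c • D) = ε₂ D)
    (h₁₃ : ∀ D, ε₁ (c • D) + ε₁ D = ε₃ D + ε₃ (d • D))
    (h₂₃ : ∀ D, ε₂ (d • D) + ε₂ D = ε₃ D + ε₃ (c • D))
    (h₃ : ∀ D, d • D = D → c • D = D → ε₃ D = 0)
    (hinv₁ : ∀ (g : HeisBits) D, d • D = D → ε₁ (g • D) = ε₁ D)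
    (hinv₂ : ∀ (g : HeisBits) D, c • D = D → ε₂ (g • D) = ε₂ D)
    (hfix : ∀ D, (∀ g : HeisBits, g • D = D) → ε₁ D = 0 ∧ ε₂ D = 0) :
    ∑ D ∈ B, (t * (ε₃ D * (a D i l + (1 + t) * a D i i)) + t ^ 2 * (ε₁ D * a D i l)
      + ε₂ D * a D i l) = 0 := by
  have two : (2 : k) = 0 := CharP.cast_eq_zero k 2
  have hdd : ∀ D : T, d • d • D = D := fun D => by rw [smul_smul, d_mul_d, one_smul]
  have hcc : ∀ D : T, c • c • D = D := fun D => by rw [smul_smul, c_mul_c, one_smul]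
  have hdc : ∀ D : T, d • c • D = c • d • D := fun D => by
    rw [smul_smul, smul_smul, d_mul_comm]
  have Hd : toMatrix t hij hil hjl d = 1 + single i l 1 := by simp [toMatrix, d]
  have Hc : toMatrix t hij hil hjl c = 1 + single i l t := by simp [toMatrix, c]
  have Hγ : toMatrix t hij hil hjl γ = 1 + single i l (t ^ 2) := by simp [toMatrix, γ]
  have Hx₁ : toMatrix t hij hil hjl x₁ = 1 + single i j 1 := by simp [toMatrix, x₁]
  have Hx₂ : toMatrix t hij hil hjl x₂ = 1 + single i j t := by simp [toMatrix, x₂]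
  have Hy₁ : toMatrix t hij hil hjl y₁ = 1 + single j l 1 := by simp [toMatrix, y₁]
  have Hy₂ : toMatrix t hij hil hjl y₂ = 1 + single j l t := by simp [toMatrix, y₂]
  have central : ∀ (g : HeisBits) (s : k), toMatrix t hij hil hjl g = 1 + single i l s →
      ∀ D ∈ B, a (g • D) l i = a D l i ∧ a (g • D) i i = a D i i + s * a D l i ∧
        a (g • D) l l = a D l l - s * a D l i ∧
        a (g • D) i l = a D i l + s * a D l l - s * (a D i i + s * a D l i) := by
    intro g s hg D hD
    have h := ha g D hD
    rw [hg] at h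
    have e₁ := apply_of_mul_one_add_single h l i
    have e₂ := apply_of_mul_one_add_single h i i
    have e₃ := apply_of_mul_one_add_single h l l
    have e₄ := apply_of_mul_one_add_single h i l
    simp only [hil, hil.symm, if_true, if_false, add_zero] at e₁ e₂ e₃ e₄
    refine ⟨e₁, e₂, ?_, ?_⟩
    · rw [e₁] at e₃
      linear_combination e₃
    · rw [e₂] at e₄
      linear_combination e₄
  have cd := central d 1 Hd
  have cc := central c t Hc
  rw [sum_eq_sum_filter_fixed (fun D => d • D) (fun D => c • D) hdd hcc hdc _ B (hB d) (hB c)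
    ?_ ?_ ?_ ?_]
  rotate_left
  · intro D hD _ _ _
    obtain ⟨u₁, u₂, u₃, u₄⟩ := cd D hD
    obtain ⟨v₁, v₂, v₃, v₄⟩ := cc D hD
    obtain ⟨w₁, w₂, w₃, w₄⟩ := cd _ (hB c D hD)
    have r₂ := h₂ (d • D)
    have r₃ := h₁₃ D
    have r₄ := h₂₃ D
    have r₅ := h₁₃ (c • D)
    rw [hcc] at r₅
    rw [← hdc] at r₂
    have r₆ : ε₃ (d • D) = ε₁ (c • D) + ε₁ D - ε₃ D := by linear_combination -r₃
    have r₇ : ε₃ (c • D) = ε₂ (d • D) + ε₂ D - ε₃ D := by linear_combination -r₄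
    have r₈ : ε₃ (d • c • D) = ε₁ D + ε₁ (c • D) - ε₃ (c • D) := by linear_combination -r₅
    simp only [r₈, r₆, r₇, h₁, h₂, r₂, w₂, w₄, u₂, u₄, v₁, v₂, v₃, v₄]
    generalize a D l i = A₁, a D i i = A₂, a D l l = A₃, a D i l = A₄, ε₁ D = E₁,
      ε₁ (c • D) = E₁', ε₂ D = E₂, ε₂ (d • D) = E₂', ε₃ D = E₃
    grind
  · intro D hD e₁ e₂
    obtain ⟨v₁, v₂, v₃, v₄⟩ := cc D hD
    obtain ⟨u₁, u₂, u₃, u₄⟩ := cd D hD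
    rw [e₁] at u₂ u₄
    have z₁ : a D l i = 0 := by linear_combination -u₂
    have z₂ : a D l l = a D i i := by linear_combination -u₄ + z₁
    have r₃ := h₁₃ D
    have r₄ := h₂₃ D
    rw [e₁] at r₃ r₄
    have r₅ := h₁₃ D
    rw [e₁] at r₅
    have r₆ : ε₁ (c • D) = ε₁ D := by linear_combination r₅ + (ε₃ D - ε₁ D) * two
    have r₇ : ε₃ (c • D) = ε₃ D := by linear_combination -r₄ + (ε₂ D - ε₃ D) * two
    rw [r₆, r₇, h₂, v₂, v₄, z₁, z₂]
    generalize a D i i = A₂, a D i l = A₄, ε₁ D = E₁, ε₂ D = E₂, ε₃ D = E₃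
    grind
  · intro D hD e₁ e₂
    obtain ⟨v₁, v₂, v₃, v₄⟩ := cc D hD
    obtain ⟨u₁, u₂, u₃, u₄⟩ := cd D hD
    rw [e₁] at v₂ v₄
    have z₁ : a D l i = 0 := mul_left_cancel₀ ht (by linear_combination -v₂)
    have z₂ : a D l l = a D i i := mul_left_cancel₀ ht (by linear_combination -v₄ + t ^ 2 * z₁)
    have r₃ := h₁₃ D
    have r₄ := h₂₃ D
    rw [e₁] at r₃ r₄
    have r₆ : ε₂ (d • D) = ε₂ D := by linear_combination r₄ + (ε₃ D - ε₂ D) * two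
    have r₇ : ε₃ (d • D) = ε₃ D := by linear_combination -r₃ + (ε₁ D - ε₃ D) * two
    rw [r₆, r₇, h₁, u₂, u₄, z₁, z₂]
    generalize a D i i = A₂, a D i l = A₄, ε₁ D = E₁, ε₂ D = E₂, ε₃ D = E₃
    grind
  · intro D hD e₁ e₂
    obtain ⟨v₁, v₂, v₃, v₄⟩ := cc D hD
    obtain ⟨u₁, u₂, u₃, u₄⟩ := cd D hD
    have r₃ := h₁₃ D
    have r₄ := h₂₃ D
    have r₁ := h₁ D
    have r₂ := h₂ D
    rw [← e₁] at v₂ v₄ r₃ r₂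
    have z₁ : a D l i = 0 := mul_left_cancel₀ ht' (by grind)
    have z₂ : a D l l = a D i i := mul_left_cancel₀ ht' (by grind)
    have r₇ : ε₃ (d • D) = ε₃ D := by
      rw [r₁] at r₃; linear_combination -r₃ + (ε₁ D - ε₃ D) * two
    rw [r₇, r₁, r₂, u₂, u₄, z₁, z₂]
    generalize a D i i = A₂, a D i l = A₄, ε₁ D = E₁, ε₂ D = E₂, ε₃ D = E₃
    grind
  set B₁ := {D ∈ B | d • D = D ∧ c • D = D} with hB₁
  have hB₁B : ∀ D ∈ B₁, D ∈ B := fun D hD => (Finset.mem_filter.1 hD).1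
  have hB₁d : ∀ D ∈ B₁, d • D = D := fun D hD => (Finset.mem_filter.1 hD).2.1
  have hB₁c : ∀ D ∈ B₁, c • D = D := fun D hD => (Finset.mem_filter.1 hD).2.2
  have hB₁s : ∀ g : HeisBits, ∀ D ∈ B₁, g • D ∈ B₁ := fun g D hD => by
    refine Finset.mem_filter.2 ⟨hB g D (hB₁B D hD), ?_, ?_⟩
    · rw [smul_smul, d_mul_comm, ← smul_smul, hB₁d D hD]
    · rw [smul_smul, c_mul_comm, ← smul_smul, hB₁c D hD]
  set wt : T → k := fun D => (t ^ 2 * ε₁ D + ε₂ D) * a D i l with hwt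
  have hwg : ∀ (g : HeisBits), ∀ D ∈ B₁,
      wt (g • D) = (t ^ 2 * ε₁ D + ε₂ D) * a (g • D) i l := fun g D hD => by
    rw [hwt]
    simp only [hinv₁ g D (hB₁d D hD), hinv₂ g D (hB₁c D hD)]
  rw [Finset.sum_congr rfl (g := wt) fun D hD => by
    rw [h₃ D (hB₁d D hD) (hB₁c D hD), hwt]; ring]
  have hcent : ∀ D ∈ B₁, a (γ • D) i l = a D i l := fun D hD => by
    obtain ⟨-, v₂, -, v₄⟩ := cd D (hB₁B D hD)
    obtain ⟨-, -, -, u₄⟩ := central γ _ Hγ D (hB₁B D hD)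
    rw [hB₁d D hD] at v₂ v₄
    have z₁ : a D l i = 0 := by linear_combination -v₂
    have z₂ : a D l l = a D i i := by linear_combination -v₄ + z₁
    rw [u₄, z₁, z₂]
    ring
  have hx : ∀ (g : HeisBits) (s : k), toMatrix t hij hil hjl g = 1 + single i j s →
      ∀ D ∈ B, a (g • D) j l = a D j l ∧ a (g • D) i l = a D i l + s * a D j l := by
    intro g s hg D hD
    have h := ha g D hD
    rw [hg] at h
    have e₁ := apply_of_mul_one_add_single h j l
    have e₂ := apply_of_mul_one_add_single h i l
    simp only [hij.symm, hjl.symm, if_true, if_false, add_zero] at e₁ e₂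
    exact ⟨e₁, e₂⟩
  have hy : ∀ (g : HeisBits) (s : k), toMatrix t hij hil hjl g = 1 + single j l s →
      ∀ D ∈ B, a (g • D) i j = a D i j ∧ a (g • D) i l = a D i l - s * a D i j := by
    intro g s hg D hD
    have h := ha g D hD
    rw [hg] at h
    have e₁ := apply_of_mul_one_add_single h i j
    have e₂ := apply_of_mul_one_add_single h i l
    simp only [hij, hjl, if_true, if_false, add_zero] at e₁ e₂
    refine ⟨e₁, ?_⟩
    rw [e₁] at e₂
    linear_combination e₂
  have invol : ∀ g : HeisBits, g * g = 1 → ∀ D : T, g • g • D = D := fun g hg D => by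
    rw [smul_smul, hg, one_smul]
  have comm : ∀ g h : HeisBits, g * h = h * g → ∀ D : T, g • h • D = h • g • D :=
    fun g h hg D => by rw [smul_smul, hg, smul_smul]
  rw [sum_eq_sum_filter_fixed (fun D => γ • D) (fun D => D) (invol γ γ_mul_γ) (fun _ => rfl)
    (fun _ => rfl) wt B₁ (hB₁s γ) (fun _ h => h) (fun D hD _ h => absurd rfl h)
    (fun D hD _ h => absurd rfl h) (fun D hD _ _ => by
      rw [hwg γ D hD, hcent D hD, hwt, ← two_mul, two, zero_mul])
    (fun D hD h h' => absurd h h')]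
  simp only [and_true]
  set B₂ := {D ∈ B₁ | γ • D = D} with hB₂
  have hB₂B₁ : ∀ D ∈ B₂, D ∈ B₁ := fun D hD => (Finset.mem_filter.1 hD).1
  have hB₂γ : ∀ D ∈ B₂, γ • D = D := fun D hD => (Finset.mem_filter.1 hD).2
  have hB₂s : ∀ g : HeisBits, ∀ D ∈ B₂, g • D ∈ B₂ := fun g D hD => by
    refine Finset.mem_filter.2 ⟨hB₁s g D (hB₂B₁ D hD), ?_⟩
    rw [smul_smul, γ_mul_comm, ← smul_smul, hB₂γ D hD]
  rw [sum_eq_sum_filter_fixed (fun D => x₁ • D) (fun D => x₂ • D) (invol _ x₁_mul_x₁)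
    (invol _ x₂_mul_x₂) (comm _ _ x₁_mul_x₂) wt B₂ (hB₂s x₁) (hB₂s x₂) ?_ ?_ ?_ ?_]
  rotate_left
  · intro D hD _ _ _
    have hD₁ := hB₂B₁ D hD
    obtain ⟨u₁, u₂⟩ := hx _ _ Hx₁ D (hB₁B D hD₁)
    obtain ⟨v₁, v₂⟩ := hx _ _ Hx₂ D (hB₁B D hD₁)
    obtain ⟨w₁, w₂⟩ := hx _ _ Hx₁ _ (hB x₂ D (hB₁B D hD₁))
    rw [smul_smul, hwg _ D hD₁, hwg _ D hD₁, hwg _ D hD₁, ← smul_smul, w₂, u₂, v₂, v₁, hwt]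
    linear_combination (t ^ 2 * ε₁ D + ε₂ D) * (2 * a D i l + (1 + t) * a D j l) * two
  · intro D hD e₁ e₂
    have hD₁ := hB₂B₁ D hD
    obtain ⟨u₁, u₂⟩ := hx _ _ Hx₁ D (hB₁B D hD₁)
    obtain ⟨v₁, v₂⟩ := hx _ _ Hx₂ D (hB₁B D hD₁)
    rw [e₁] at u₂
    rw [hwg _ D hD₁, v₂, hwt]
    linear_combination (t ^ 2 * ε₁ D + ε₂ D) * (a D i l * two - t * u₂)
  · intro D hD e₁ e₂
    have hD₁ := hB₂B₁ D hD
    obtain ⟨u₁, u₂⟩ := hx _ _ Hx₁ D (hB₁B D hD₁)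
    obtain ⟨v₁, v₂⟩ := hx _ _ Hx₂ D (hB₁B D hD₁)
    rw [e₁] at v₂
    have z : a D j l = 0 := mul_left_cancel₀ ht (by linear_combination -v₂)
    rw [hwg _ D hD₁, u₂, hwt]
    linear_combination (t ^ 2 * ε₁ D + ε₂ D) * (a D i l * two + z)
  · intro D hD e₁ e₂
    have hD₁ := hB₂B₁ D hD
    obtain ⟨u₁, u₂⟩ := hx _ _ Hx₁ D (hB₁B D hD₁)
    obtain ⟨v₁, v₂⟩ := hx _ _ Hx₂ D (hB₁B D hD₁)
    rw [← e₁, u₂] at v₂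
    have z : a D j l = 0 := mul_left_cancel₀ ht' (by
      linear_combination v₂ + t * a D j l * two)
    rw [hwg _ D hD₁, u₂, hwt]
    linear_combination (t ^ 2 * ε₁ D + ε₂ D) * (a D i l * two + z)
  set B₃ := {D ∈ B₂ | x₁ • D = D ∧ x₂ • D = D} with hB₃
  have hB₃B₂ : ∀ D ∈ B₃, D ∈ B₂ := fun D hD => (Finset.mem_filter.1 hD).1
  have hB₃x₁ : ∀ D ∈ B₃, x₁ • D = D := fun D hD => (Finset.mem_filter.1 hD).2.1
  have hB₃x₂ : ∀ D ∈ B₃, x₂ • D = D := fun D hD => (Finset.mem_filter.1 hD).2.2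
  have hB₃y₁ : ∀ D ∈ B₃, y₁ • D ∈ B₃ := fun D hD => by
    have h₂ := hB₂s y₁ D (hB₃B₂ D hD)
    refine Finset.mem_filter.2 ⟨h₂, ?_, ?_⟩
    · rw [smul_smul, x₁_mul_y₁, ← smul_smul, ← smul_smul, hB₃x₁ D hD, hB₁d _ (hB₂B₁ _ h₂)]
    · rw [smul_smul, x₂_mul_y₁, ← smul_smul, ← smul_smul, hB₃x₂ D hD, hB₁c _ (hB₂B₁ _ h₂)]
  have hB₃y₂ : ∀ D ∈ B₃, y₂ • D ∈ B₃ := fun D hD => by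
    have h₂ := hB₂s y₂ D (hB₃B₂ D hD)
    refine Finset.mem_filter.2 ⟨h₂, ?_, ?_⟩
    · rw [smul_smul, x₁_mul_y₂, ← smul_smul, ← smul_smul, hB₃x₁ D hD, hB₁c _ (hB₂B₁ _ h₂)]
    · rw [smul_smul, x₂_mul_y₂, ← smul_smul, ← smul_smul, hB₃x₂ D hD, hB₂γ _ h₂]
  rw [sum_eq_sum_filter_fixed (fun D => y₁ • D) (fun D => y₂ • D) (invol _ y₁_mul_y₁)
    (invol _ y₂_mul_y₂) (comm _ _ y₁_mul_y₂) wt B₃ hB₃y₁ hB₃y₂ ?_ ?_ ?_ ?_]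
  rotate_left
  · intro D hD _ _ _
    have hD₁ := hB₂B₁ D (hB₃B₂ D hD)
    obtain ⟨u₁, u₂⟩ := hy _ _ Hy₁ D (hB₁B D hD₁)
    obtain ⟨v₁, v₂⟩ := hy _ _ Hy₂ D (hB₁B D hD₁)
    obtain ⟨w₁, w₂⟩ := hy _ _ Hy₁ _ (hB y₂ D (hB₁B D hD₁))
    rw [smul_smul, hwg _ D hD₁, hwg _ D hD₁, hwg _ D hD₁, ← smul_smul, w₂, u₂, v₂, v₁, hwt]
    linear_combination (t ^ 2 * ε₁ D + ε₂ D) * (2 * a D i l - (1 + t) * a D i j) * two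
  · intro D hD e₁ e₂
    have hD₁ := hB₂B₁ D (hB₃B₂ D hD)
    obtain ⟨u₁, u₂⟩ := hy _ _ Hy₁ D (hB₁B D hD₁)
    obtain ⟨v₁, v₂⟩ := hy _ _ Hy₂ D (hB₁B D hD₁)
    rw [e₁] at u₂
    rw [hwg _ D hD₁, v₂, hwt]
    linear_combination (t ^ 2 * ε₁ D + ε₂ D) * (a D i l * two - t * u₂)
  · intro D hD e₁ e₂
    have hD₁ := hB₂B₁ D (hB₃B₂ D hD)
    obtain ⟨u₁, u₂⟩ := hy _ _ Hy₁ D (hB₁B D hD₁)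
    obtain ⟨v₁, v₂⟩ := hy _ _ Hy₂ D (hB₁B D hD₁)
    rw [e₁] at v₂
    have z : a D i j = 0 := mul_left_cancel₀ ht (by linear_combination v₂)
    rw [hwg _ D hD₁, u₂, hwt]
    linear_combination (t ^ 2 * ε₁ D + ε₂ D) * (a D i l * two - z)
  · intro D hD e₁ e₂
    have hD₁ := hB₂B₁ D (hB₃B₂ D hD)
    obtain ⟨u₁, u₂⟩ := hy _ _ Hy₁ D (hB₁B D hD₁)
    obtain ⟨v₁, v₂⟩ := hy _ _ Hy₂ D (hB₁B D hD₁)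
    rw [← e₁, u₂] at v₂
    have z : a D i j = 0 := mul_left_cancel₀ ht' (by
      linear_combination -v₂ + t * a D i j * two)
    rw [hwg _ D hD₁, u₂, hwt]
    linear_combination (t ^ 2 * ε₁ D + ε₂ D) * (a D i l * two - z)
  refine Finset.sum_eq_zero fun D hD => ?_
  obtain ⟨hD₃, hy₁, hy₂⟩ := Finset.mem_filter.1 hD
  have hD₂ := hB₃B₂ D hD₃
  have hD₁ := hB₂B₁ D hD₂
  obtain ⟨e₁, e₂⟩ := hfix D fun g => mem_of_generators (MulAction.stabilizer HeisBits D)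
    (hB₁d D hD₁) (hB₁c D hD₁) (hB₂γ D hD₂) (hB₃x₁ D hD₃) (hB₃x₂ D hD₃) hy₁ hy₂ g
  rw [hwt]
  simp only [e₁, e₂]
  ring

theorem HeisBits.toMatrix_map_sq {ι k : Type*} [Fintype ι] [DecidableEq ι] [CommRing k] [CharP k 2]
    (t : k) {i j l : ι} (hij : i ≠ j) (hil : i ≠ l) (hjl : j ≠ l) (g : HeisBits) :
    (toMatrix t hij hil hjl g).map (· ^ 2) = toMatrix (t ^ 2) hij hil hjl g := by
  have h : ∀ x : ZMod 2, (ZMod.castHom (dvd_refl 2) k x) ^ 2 = ZMod.castHom (dvd_refl 2) k x := by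
    intro x
    rw [← map_pow, show x ^ 2 = x from ZMod.pow_card x]
  have hadd : ∀ x y : k, (x + y) ^ 2 = x ^ 2 + y ^ 2 := fun x y => CharTwo.add_sq x y
  ext u v
  simp only [toMatrix, MonoidHom.coe_mk, OneHom.coe_mk, map_apply, Matrix.add_apply, hadd,
    one_apply, single_apply, ite_pow, mul_pow, h]
  simp only [ne_eq, OfNat.ofNat_ne_zero, not_false_eq_true, zero_pow, one_pow]

section Verschiebung

variable {ι k W : Type*} [CommRing k] [CommRing W]
  {π : W →+* k} {V : k →+ W}

theorem mul_map_verschiebung [Fintype ι] (hVmul : ∀ x b, x * V b = V (π x ^ 2 * b))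
    (A : Matrix ι ι W)
    (X : Matrix ι ι k) : A * X.map V = (((A.map π).map (· ^ 2)) * X).map V := by
  ext u v
  simp [mul_apply, hVmul]

theorem map_verschiebung_mul [Fintype ι] (hVmul : ∀ x b, x * V b = V (π x ^ 2 * b))
    (A : Matrix ι ι W)
    (X : Matrix ι ι k) : X.map V * A = (X * (A.map π).map (· ^ 2)).map V := by
  ext u v
  simp only [mul_apply, map_apply, map_sum]
  exact Finset.sum_congr rfl fun w _ => by rw [mul_comm, hVmul, mul_comm]

theorem map_verschiebung_mul_map_verschiebung [Fintype ι] (hVmul : ∀ x b, x * V b = V (π x ^ 2 * b))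
    (hπV : ∀ b, π (V b) = 0) (X Y : Matrix ι ι k) : X.map V * Y.map V = 0 := by
  ext u v
  simp [mul_apply, hVmul, hπV]

theorem exists_eq_add_map_verschiebung (hker : ∀ x, π x = 0 → ∃ b, x = V b)
    {A A' : Matrix ι ι W} (h : A.map π = A'.map π) : ∃ X : Matrix ι ι k, A = A' + X.map V := by
  have : ∀ u v, ∃ b, A u v - A' u v = V b := fun u v => hker _ (by
    have := congrFun (congrFun h u) v
    simp only [map_apply] at this
    rw [map_sub, this, sub_self])
  choose X hX using this
  exact ⟨of X, by ext u v; simp [← hX]⟩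

end Verschiebung

open HeisBits in
theorem false_of_lift {Γ T M k ι W : Type*} [Group Γ] [DecidableEq T] [Field M] [Field k]
    [CharP k 2] [Fintype ι] [DecidableEq ι] [CommRing W] {i j l : ι} (hij : i ≠ j) (hil : i ≠ l)
    (hjl : j ≠ l) [MulAction HeisBits T] (e : k) (he₀ : e ≠ 0) (he₁ : e ≠ 1)
    (π : W →+* k) (hπ : Function.Surjective π) (V : k →+ W) (hV : Function.Injective V)
    (hVmul : ∀ x b, x * V b = V (π x ^ 2 * b)) (hπV : ∀ b, π (V b) = 0)
    (hker : ∀ x, π x = 0 → ∃ b, x = V b) (hV1 : V 1 = 2)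
    (q : Γ →* HeisBits) (hq : Function.Surjective q) (ρ : Γ →* Matrix ι ι W)
    (hρ : ∀ σ, (ρ σ).map π = toMatrix e hij hil hjl (q σ))
    (lam : T → Γ → M) (hne : ∀ D σ, lam D σ ≠ 0)
    (hmul : ∀ D σ τ, q σ • D = D → q τ • D = D → lam D (σ * τ) = lam D σ * lam D τ)
    (hpm : ∀ D n, q n = 1 → lam D n = 1 ∨ lam D n = -1)
    (hconj : ∀ D σ τ, q σ • D = D → lam (q τ • D) (τ * σ * τ⁻¹) = lam D σ)
    (hind : ∀ B : Finset T, ∀ D₀ ∈ B, ∃ n, q n = 1 ∧ lam D₀ n ≠ 1 ∧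
      ∀ D ∈ B, D ≠ D₀ → lam D n = 1)
    (B : Finset T) (hB : ∀ g : HeisBits, ∀ D ∈ B, g • D ∈ B)
    (hC : ∀ n, q n = 1 → (∀ D ∈ B, lam D n = 1) → ρ n = 1) : False := by
  classical
  have two : (2 : k) = 0 := CharP.cast_eq_zero k 2
  have hVmat : Function.Injective fun X : Matrix ι ι k => X.map V := fun X Y h =>
    Matrix.map_injective hV h
  have Vadd : ∀ X Y : Matrix ι ι k, (X + Y).map V = X.map V + Y.map V := fun X Y =>
    Matrix.map_add _ (map_add V) X Y
  set t := e ^ 2 with ht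
  have ht₀ : t ≠ 0 := pow_ne_zero 2 he₀
  have ht₁ : 1 + t ≠ 0 := by
    have : (1 + t) = (e - 1) ^ 2 := by rw [ht]; linear_combination e * two
    rw [this]
    exact pow_ne_zero 2 (sub_ne_zero.2 he₁)
  set H := toMatrix t hij hil hjl with hH
  have hsq : ∀ σ, ((ρ σ).map π).map (· ^ 2) = H (q σ) := fun σ => by
    rw [hρ, toMatrix_map_sq]
  have hφ : ∀ n, ∃ X : Matrix ι ι k, q n = 1 → ρ n = 1 + X.map V := by
    intro n
    by_cases hn : q n = 1
    · obtain ⟨X, hX⟩ := exists_eq_add_map_verschiebung (A := ρ n) (A' := 1) hker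
        (by rw [hρ, hn, map_one, Matrix.map_one _ (map_zero π) (map_one π)])
      exact ⟨X, fun _ => hX⟩
    · exact ⟨0, fun h => absurd h hn⟩
  choose φ hφ using hφ
  have φ_mul : ∀ n n', q n = 1 → q n' = 1 → φ (n * n') = φ n + φ n' := by
    intro n n' hn hn'
    apply hVmat
    have h := hφ (n * n') (by rw [map_mul, hn, hn', one_mul])
    rw [map_mul, hφ n hn, hφ n' hn', mul_add, add_mul, add_mul, one_mul, one_mul, mul_one,
      map_verschiebung_mul_map_verschiebung hVmul hπV, add_zero, add_assoc, ← Vadd] at h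
    have := add_left_cancel h
    simp only [← this]
  have φ_conj : ∀ n τ, q n = 1 → φ (τ * n * τ⁻¹) * H (q τ) = H (q τ) * φ n := by
    intro n τ hn
    have hn' : q (τ * n * τ⁻¹) = 1 := by simp [hn]
    apply hVmat
    have h : ρ (τ * n * τ⁻¹) * ρ τ = ρ τ * ρ n := by rw [← map_mul, ← map_mul]; simp
    rw [hφ n hn, hφ _ hn', add_mul, mul_add, one_mul, mul_one, mul_map_verschiebung hVmul,
      map_verschiebung_mul hVmul, hsq] at h
    exact add_left_cancel h
  have lam_one : ∀ D, lam D 1 = 1 := fun D => by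
    have h := hmul D 1 1 (by simp) (by simp)
    rw [mul_one] at h
    exact mul_left_cancel₀ (hne D 1) (by rw [← h, mul_one])
  set ε : T → Γ → k := fun D σ => if lam D σ = 1 then 0 else 1 with hε
  have ε_mul : ∀ D n n', q n = 1 → q n' = 1 → ε D (n * n') = ε D n + ε D n' := by
    intro D n n' hn hn'
    have h := hmul D n n' (by rw [hn, one_smul]) (by rw [hn', one_smul])
    simp only [hε, h]
    rcases hpm D n hn with h₁ | h₁ <;> rcases hpm D n' hn' with h₂ | h₂ <;> rw [h₁, h₂] <;>
      by_cases hM : (-1 : M) = 1 <;> simp [hM]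
    linear_combination -two
  have ε_conj : ∀ D n τ, q n = 1 → ε (q τ • D) (τ * n * τ⁻¹) = ε D n := by
    intro D n τ hn
    simp only [hε, hconj D n τ (by rw [hn, one_smul])]
  have ε_inv : ∀ D n, q n = 1 → ε D n⁻¹ = ε D n := by
    intro D n hn
    have h := ε_mul D n n⁻¹ hn (by simp [hn])
    have h1 : ε D 1 = 0 := by simp [hε, lam_one]
    rw [mul_inv_cancel, h1] at h
    linear_combination h + ε D n⁻¹ * two
  choose! ν hν hνne hν1 using hind B
  set a : T → Matrix ι ι k := fun D => φ (ν D) with ha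
  have φ_eq : ∀ n, q n = 1 → φ n = ∑ D ∈ B, ε D n • a D := by
    have key : ∀ S : Finset T, S ⊆ B → ∀ n, q n = 1 → (∀ D ∈ B, D ∉ S → lam D n = 1) →
        φ n = ∑ D ∈ S, ε D n • a D := by
      intro S
      induction S using Finset.induction_on with
      | empty =>
        intro _ n hn h
        have h1 := hC n hn fun D hD => h D hD (Finset.notMem_empty D)
        apply hVmat
        rw [hφ n hn] at h1
        simpa using h1
      | insert D₀ S hD₀ ih =>
        intro hS n hn h
        have hD₀B : D₀ ∈ B := hS (Finset.mem_insert_self _ _)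
        have hSB : S ⊆ B := fun D hD => hS (Finset.mem_insert_of_mem hD)
        rw [Finset.sum_insert hD₀]
        by_cases h1 : lam D₀ n = 1
        · rw [← ih hSB n hn fun D hD hDS => ?_]
          · simp [hε, h1]
          · by_cases hDD : D = D₀
            · rwa [hDD]
            · exact h D hD (by simp [hDD, hDS])
        have hν₀ := hν D₀ hD₀B
        have e₁ : ε D₀ n = 1 := by simp [hε, h1]
        have hmul' : ∀ D, lam D (n * ν D₀) = lam D n * lam D (ν D₀) := fun D =>
          hmul D _ _ (by rw [hn, one_smul]) (by rw [hν₀, one_smul])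
        have h2 := ih hSB (n * ν D₀) (by rw [map_mul, hn, hν₀, one_mul]) fun D hD hDS => by
          rw [hmul']
          by_cases hDD : D = D₀
          · subst hDD
            rw [(hpm D n hn).resolve_left h1, (hpm D _ hν₀).resolve_left (hνne D hD)]
            ring
          · rw [h D hD (by simp [hDD, hDS]), hν1 D₀ hD₀B D hD hDD, one_mul]
        rw [φ_mul n _ hn hν₀] at h2
        have h3 : ∑ D ∈ S, ε D (n * ν D₀) • a D = ∑ D ∈ S, ε D n • a D := by
          refine Finset.sum_congr rfl fun D hD => ?_
          simp only [hε]
          rw [hmul', hν1 D₀ hD₀B D (hSB hD) (fun h => hD₀ (h ▸ hD)), mul_one]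
        rw [← h3, ← h2, e₁, one_smul]
        have h4 : a D₀ + a D₀ = 0 := by rw [← two_smul k, two, zero_smul]
        rw [add_left_comm]
        simp only [ha] at h4 ⊢
        rw [h4, add_zero]
    exact fun n hn => key B (Finset.Subset.refl B) n hn fun D hD hD' => absurd hD hD'
  have a_smul : ∀ g : HeisBits, ∀ D ∈ B, a (g • D) * H g = H g * a D := by
    intro g D hD
    obtain ⟨τ, rfl⟩ := hq g
    rw [← φ_conj _ _ (hν D hD)]
    congr 1
    have hn' : q (τ * ν D * τ⁻¹) = 1 := by simp [hν D hD]
    rw [φ_eq _ hn', Finset.sum_eq_single (q τ • D)]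
    · rw [ε_conj _ _ _ (hν D hD)]
      simp [hε, hνne D hD]
    · intro D' hD' hne'
      obtain ⟨D'', rfl⟩ : ∃ D'', q τ • D'' = D' := ⟨(q τ)⁻¹ • D', smul_inv_smul _ _⟩
      have hD'' : D'' ∈ B := by simpa using hB (q τ)⁻¹ _ hD'
      rw [ε_conj _ _ _ (hν D hD)]
      have : lam D'' (ν D) = 1 := hν1 D hD D'' hD'' (fun h => hne' (by rw [h]))
      simp [hε, this]
    · exact fun h => absurd (hB _ _ hD) h
  obtain ⟨σd, hσd⟩ := hq d
  obtain ⟨σc, hσc⟩ := hq c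
  set j₁ := σd * σd with hj₁
  set j₂ := σc * σc with hj₂
  set j₃ := σc * σd * σc⁻¹ * σd⁻¹ with hj₃
  have q₁ : q j₁ = 1 := by rw [hj₁, map_mul, hσd, d_mul_d]
  have q₂ : q j₂ = 1 := by rw [hj₂, map_mul, hσc, c_mul_c]
  have q₃ : q j₃ = 1 := by
    rw [hj₃, map_mul, map_mul, map_mul, map_inv, map_inv, hσc, hσd, ← d_mul_comm]
    group
  have lam_sq : ∀ D n, q n = 1 → lam D n * lam D n = 1 := fun D n hn => by
    rcases hpm D n hn with h | h <;> rw [h] <;> ring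
  have lam_sq_smul : ∀ z : HeisBits, (∀ g, z * g = g * z) → ∀ σ, q σ = z → ∀ (g : HeisBits) D,
      z • D = D → lam (g • D) (σ * σ) = lam D (σ * σ) := by
    intro z hz σ hσ g D hD
    obtain ⟨τ, rfl⟩ := hq g
    obtain ⟨n, hn⟩ : ∃ n, τ⁻¹ * σ * τ = σ * n := ⟨σ⁻¹ * (τ⁻¹ * σ * τ), by group⟩
    have hqn : q n = 1 := by
      have h := congrArg q hn
      simp only [map_mul, map_inv, hσ] at h
      rw [mul_assoc, hz, inv_mul_cancel_left] at h
      exact (mul_eq_left.1 h.symm)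
    have hs : q (σ * n) • D = D := by rw [map_mul, hqn, mul_one, hσ, hD]
    have h1 : σ * σ = τ * (σ * n * (σ * n)) * τ⁻¹ := by rw [← hn]; group
    have hsD : q σ • D = D := by rw [hσ, hD]
    rw [h1, hconj D _ τ (by rw [map_mul, mul_smul, hs, hs]), ← h1, hmul D _ _ hs hs,
      hmul D σ n hsD (by rw [hqn, one_smul]), hmul D σ σ hsD hsD]
    linear_combination lam D σ * lam D σ * lam_sq D n hqn
  have lam_sq_eq_one : ∀ z x y : HeisBits, x * y = z * (y * x) → ∀ σ, q σ = z → ∀ D,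
      (∀ g : HeisBits, g • D = D) → lam D (σ * σ) = 1 := by
    intro z x y hxy σ hσ D hD
    obtain ⟨τ, rfl⟩ := hq x
    obtain ⟨τ', rfl⟩ := hq y
    obtain ⟨n, hn⟩ : ∃ n, τ * τ' = σ * (n * (τ' * τ)) := ⟨σ⁻¹ * (τ * τ') * (τ' * τ)⁻¹, by group⟩
    have hqn : q n = 1 := by
      have h := congrArg q hn
      simp only [map_mul, hσ] at h
      rw [hxy] at h
      exact mul_eq_right.1 (mul_left_cancel h).symm
    have h := congrArg (lam D) hn
    simp only [fun σ τ => hmul D σ τ (hD _) (hD _)] at h ⊢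
    have h1 : lam D σ * lam D n = 1 :=
      mul_right_cancel₀ (mul_ne_zero (hne D τ) (hne D τ')) (by linear_combination -h)
    linear_combination (lam D σ * lam D n + 1) * h1 - lam D σ * lam D σ * lam_sq D n hqn
  have hzero := sum_weight_eq_zero hij hil hjl ht₀ ht₁ B hB a a_smul (fun D => ε D j₁)
    (fun D => ε D j₂) (fun D => ε D j₃) ?_ ?_ ?_ ?_ ?_ ?_ ?_ ?_
  · have hE : ∀ (R : Type _) [CommRing R] (x y : R),
        (single i l x : Matrix ι ι R) * single i l y = 0 := fun R _ x y =>
      single_mul_single_of_ne x i l i hil.symm y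
    obtain ⟨w, hw⟩ := hπ e
    have Hd : H d = 1 + single i l 1 := by simp [hH, toMatrix, d]
    have Hc : H c = 1 + single i l t := by simp [hH, toMatrix, c]
    have hmap : ∀ x : W, ((1 : Matrix ι ι W) + single i l x).map π = 1 + single i l (π x) :=
      fun x => by
        rw [Matrix.map_add _ (map_add π), Matrix.map_one _ (map_zero π) (map_one π)]
        simp
    have h2w : ∀ x : W, x + x = V (π x ^ 2) := fun x => by
      rw [← two_mul, ← hV1, mul_comm, hVmul, mul_one]
    have hsq' : ∀ x : k, (((1 : Matrix ι ι k) + single i l x).map (· ^ 2)) =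
        1 + single i l (x ^ 2) := fun x => by
      ext u v
      simp only [map_apply, Matrix.add_apply, CharTwo.add_sq, one_apply, single_apply, ite_pow,
        one_pow]
      simp
    obtain ⟨X, hX⟩ := exists_eq_add_map_verschiebung (A := ρ σd) (A' := 1 + single i l 1) hker
      (by rw [hρ, hσd, hmap]; simp [toMatrix, d])
    obtain ⟨Y, hY⟩ := exists_eq_add_map_verschiebung (A := ρ σc) (A' := 1 + single i l w) hker
      (by rw [hρ, hσc, hmap, hw]; simp [toMatrix, c])
    have hprod : ∀ (x y : W) (X Y : Matrix ι ι k),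
        (1 + single i l x + X.map V) * (1 + single i l y + Y.map V) =
        1 + single i l (x + y) + ((1 + single i l (π x ^ 2)) * Y +
          X * (1 + single i l (π y ^ 2))).map V := by
      intro x y X Y
      rw [mul_add, add_mul _ (X.map V), add_mul _ (X.map V), mul_map_verschiebung hVmul,
        map_verschiebung_mul hVmul, map_verschiebung_mul_map_verschiebung hVmul hπV, Vadd,
        hmap, hmap, hsq', hsq', mul_add, add_mul, add_mul, hE, single_add]
      simp only [one_mul, mul_one]
      abel
    have hsingle : ∀ x : k, (single i l (V x) : Matrix ι ι W) = (single i l x).map V := fun x => by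
      simp
    have e₁ : φ j₁ = single i l 1 + ((1 + single i l 1) * X + X * (1 + single i l 1)) := by
      apply hVmat
      have h := hφ j₁ q₁
      rw [hj₁, map_mul, hX, hprod, ← hj₁, h2w, map_one, one_pow, hsingle, add_assoc, ← Vadd] at h
      exact (add_left_cancel h).symm
    have e₂ : φ j₂ = single i l t + ((1 + single i l t) * Y + Y * (1 + single i l t)) := by
      apply hVmat
      have h := hφ j₂ q₂
      rw [hj₂, map_mul, hY, hprod, ← hj₂, h2w, hw, hsingle, add_assoc, ← Vadd] at h
      exact (add_left_cancel h).symm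
    have e₃ : (1 + single i l t) * X + Y * (1 + single i l 1) =
        (1 + single i l 1) * Y + X * (1 + single i l t) + φ j₃ * (1 + single i l (1 + t)) := by
      apply hVmat
      have h : ρ σc * ρ σd = ρ j₃ * (ρ σd * ρ σc) := by
        rw [← map_mul, ← map_mul, ← map_mul]
        congr 1
        simp only [hj₃]; group
      rw [hφ j₃ q₃, add_mul, one_mul, map_verschiebung_mul hVmul, ← map_mul ρ σd σc, hsq, map_mul q,
          hσd,
        hσc, map_mul ρ, map_mul H, Hd, Hc, hX, hY, hprod, hprod, map_one, one_pow, hw,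
        add_comm w 1, add_assoc (1 + single i l (1 + w)), ← Vadd] at h
      have h' := add_left_cancel h
      have hEt : (1 + single i l 1) * (1 + single i l t) = 1 + single i l (1 + t) := by
        rw [mul_add, mul_one, add_mul, one_mul, single_mul_single_of_ne (h := hil.symm), add_zero,
          add_assoc, ← single_add]
      rwa [← hEt]
    have f₁ := congrFun (congrFun e₁ i) l
    have f₂ := congrFun (congrFun e₂ i) l
    have f₃ := congrFun (congrFun e₃ i) l
    simp only [mul_add, add_mul, one_mul, mul_one, Matrix.add_apply, single_apply_same,
      single_mul_apply_same, mul_single_apply_same] at f₁ f₂ f₃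
    have g : ∀ j, q j = 1 → ∀ u v, φ j u v = ∑ D ∈ B, ε D j * a D u v := fun j hj u v => by
      rw [φ_eq j hj, Matrix.sum_apply]
      simp
    have hsum : t * (φ j₃ i l + (1 + t) * φ j₃ i i) + t ^ 2 * φ j₁ i l + φ j₂ i l = 0 := by
      rw [← hzero, g _ q₁, g _ q₂, g _ q₃, g _ q₃]
      simp only [Finset.mul_sum, Finset.sum_add_distrib, mul_add]
      congr 3
      refine Finset.sum_congr rfl fun D _ => ?_
      ring
    apply mul_ne_zero ht₀ ht₁
    rw [← hsum]
    generalize φ j₃ i l = A, φ j₃ i i = A', φ j₁ i l = A₁, φ j₂ i l = A₂ at *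
    grind
  · intro D
    have h := ε_conj D j₁ σd q₁
    rw [hσd] at h
    rw [← h]
    congr 1
    simp only [hj₁]; group
  · intro D
    have h := ε_conj D j₂ σc q₂
    rw [hσc] at h
    rw [← h]
    congr 1
    simp only [hj₂]; group
  · intro D
    have q₃' : q (σd * j₃ * σd⁻¹) = 1 := by simp [q₃]
    have h := ε_conj (c • D) j₁ σc q₁
    rw [hσc, smul_smul, c_mul_c, one_smul, show σc * j₁ * σc⁻¹ = j₃ * (σd * j₃ * σd⁻¹) * j₁ by
      simp only [hj₁, hj₃]; group, ε_mul _ _ _ (by rw [map_mul, q₃', q₃, one_mul]) q₁,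
      ε_mul _ _ _ q₃ q₃'] at h
    have h' := ε_conj (d • D) j₃ σd q₃
    rw [hσd, smul_smul, d_mul_d, one_smul] at h'
    linear_combination -h + h' + ε D j₁ * two
  · intro D
    have q₃' : q (σc * j₃⁻¹ * σc⁻¹) = 1 := by simp [q₃]
    have q₃i : q j₃⁻¹ = 1 := by simp [q₃]
    have h := ε_conj (d • D) j₂ σd q₂
    rw [hσd, smul_smul, d_mul_d, one_smul, show σd * j₂ * σd⁻¹ = j₃⁻¹ * (σc * j₃⁻¹ * σc⁻¹) * j₂ by
      simp only [hj₂, hj₃]; group, ε_mul _ _ _ (by rw [map_mul, q₃i, q₃', one_mul]) q₂,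
      ε_mul _ _ _ q₃i q₃', ε_inv _ _ q₃] at h
    have h' := ε_conj (c • D) j₃⁻¹ σc q₃i
    rw [hσc, smul_smul, c_mul_c, one_smul, ε_inv _ _ q₃] at h'
    linear_combination -h + h' + ε D j₂ * two
  · intro D hd hc
    have h : lam D (j₃ * (σd * σc)) = lam D (σc * σd) := by
      congr 1; simp only [hj₃]; group
    rw [hmul D j₃ _ (by rw [q₃, one_smul]) (by rw [map_mul, hσd, hσc, mul_smul, hc, hd]),
      hmul D σd σc (by rw [hσd, hd]) (by rw [hσc, hc]),
      hmul D σc σd (by rw [hσc, hc]) (by rw [hσd, hd]), mul_comm (lam D σc)] at h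
    have : lam D j₃ = 1 := mul_right_cancel₀ (mul_ne_zero (hne D σd) (hne D σc)) (by
      rw [h, one_mul])
    simp [hε, this]
  · intro g D hd
    simp only [hε, hj₁, lam_sq_smul d d_mul_comm σd hσd g D hd]
  · intro g D hc
    simp only [hε, hj₂, lam_sq_smul c c_mul_comm σc hσc g D hc]
  · intro D hD
    simp only [hε, hj₁, hj₂, lam_sq_eq_one d x₁ y₁ x₁_mul_y₁ σd hσd D hD,
      lam_sq_eq_one c x₁ y₂ x₁_mul_y₂ σc hσc D hD, if_true, and_self]

section
variable (p : ℕ) [Fact p.Prime] (k : Type*) [CommRing k]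

theorem wittReduce_truncate (x : WittVector p k) :
    wittReduce p k (WittVector.truncate 2 x) = x.coeff 0 :=
  WittVector.coeff_truncate x 0

theorem wittReduce_surjective : Function.Surjective (wittReduce p k) := fun a =>
  ⟨WittVector.truncate 2 (WittVector.teichmuller p a), by
    rw [wittReduce_truncate, WittVector.teichmuller_coeff_zero]⟩

theorem truncate_two_eq_iff {x y : WittVector p k} :
    WittVector.truncate 2 x = WittVector.truncate 2 y ↔
      x.coeff 0 = y.coeff 0 ∧ x.coeff 1 = y.coeff 1 := by
  rw [TruncatedWittVector.ext_iff]
  simp only [WittVector.coeff_truncate, Fin.forall_fin_two, Fin.val_zero, Fin.val_one]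

theorem verschiebung_coeff_one (x : WittVector p k) :
    (WittVector.verschiebung x).coeff 1 = x.coeff 0 :=
  WittVector.verschiebung_coeff_succ x 0

/-- The additive map `b ↦ (0, b)` to Witt vectors of length two. -/
noncomputable def wittShift : k →+ TruncatedWittVector p 2 k where
  toFun b := WittVector.truncate 2 (WittVector.verschiebung (WittVector.teichmuller p b))
  map_zero' := by simp
  map_add' a b := by
    rw [← map_add, ← map_add, truncate_two_eq_iff]
    simp only [WittVector.verschiebung_coeff_zero, verschiebung_coeff_one,
      WittVector.add_coeff_zero, WittVector.teichmuller_coeff_zero, and_self]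

theorem wittReduce_wittShift (b : k) : wittReduce p k (wittShift p k b) = 0 :=
  (wittReduce_truncate p k _).trans (WittVector.verschiebung_coeff_zero _)

theorem wittShift_eq_iff {b : k} {x : WittVector p k} :
    wittShift p k b = WittVector.truncate 2 x ↔ 0 = x.coeff 0 ∧ b = x.coeff 1 := by
  change WittVector.truncate 2 (WittVector.verschiebung (WittVector.teichmuller p b)) = _ ↔ _
  rw [truncate_two_eq_iff, WittVector.verschiebung_coeff_zero, verschiebung_coeff_one,
    WittVector.teichmuller_coeff_zero]

theorem wittShift_injective : Function.Injective (wittShift p k) := fun a b h => by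
  have := ((wittShift_eq_iff p k).1 (h.trans rfl :
    wittShift p k a = WittVector.truncate 2
      (WittVector.verschiebung (WittVector.teichmuller p b)))).2
  rwa [verschiebung_coeff_one, WittVector.teichmuller_coeff_zero] at this

theorem exists_eq_wittShift (x : TruncatedWittVector p 2 k) (hx : wittReduce p k x = 0) :
    ∃ b, x = wittShift p k b := by
  obtain ⟨y, rfl⟩ := WittVector.truncate_surjective (p := p) 2 k x
  rw [wittReduce_truncate] at hx
  exact ⟨y.coeff 1, ((wittShift_eq_iff p k).2 ⟨hx.symm, rfl⟩).symm⟩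

variable [CharP k p]

theorem mul_wittShift (x : TruncatedWittVector p 2 k) (b : k) :
    x * wittShift p k b = wittShift p k (wittReduce p k x ^ p * b) := by
  obtain ⟨y, rfl⟩ := WittVector.truncate_surjective (p := p) 2 k x
  symm
  rw [wittReduce_truncate]
  change _ = _ * WittVector.truncate 2 (WittVector.verschiebung (WittVector.teichmuller p b))
  rw [← map_mul, wittShift_eq_iff, mul_comm y, ← WittVector.verschiebung_mul_frobenius,
    WittVector.verschiebung_coeff_zero, verschiebung_coeff_one, WittVector.mul_coeff_zero,
    WittVector.teichmuller_coeff_zero, WittVector.coeff_frobenius_charP]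
  exact ⟨rfl, mul_comm _ _⟩

theorem wittShift_one : wittShift p k 1 = p := by
  rw [← map_natCast (WittVector.truncate (p := p) 2), wittShift_eq_iff]
  exact ⟨(WittVector.coeff_p_zero p k).symm, (WittVector.coeff_p_one p k).symm⟩

end

/-- The principal prime ideals of a domain that are generated by a prime element. -/
def PrimeDivisor (R : Type*) [CommRing R] : Type _ :=
  {I : Ideal R // ∃ p, Prime p ∧ I = Ideal.span {p}}

namespace PrimeDivisor

open scoped Pointwise

variable {G R : Type*} [Group G] [CommRing R] [MulSemiringAction G R]

theorem smul_span_singleton (g : G) (p : R) : g • Ideal.span {p} = Ideal.span {g • p} := by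
  rw [Ideal.pointwise_smul_def, Ideal.map_span, Set.image_singleton]
  rfl

instance : MulAction G (PrimeDivisor R) where
  smul g D := ⟨g • D.1, by
    obtain ⟨p, hp, h⟩ := D.2
    refine ⟨g • p, ?_, by rw [h, smul_span_singleton]⟩
    exact (MulEquiv.prime_iff (MulSemiringAction.toRingEquiv G R g)).2 hp⟩
  one_smul D := Subtype.ext (one_smul G D.1)
  mul_smul g h D := Subtype.ext (mul_smul g h D.1)

/-- A chosen prime generator. -/
noncomputable def gen (D : PrimeDivisor R) : R := D.2.choose

theorem prime_gen (D : PrimeDivisor R) : Prime D.gen := D.2.choose_spec.1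

theorem span_gen (D : PrimeDivisor R) : Ideal.span {D.gen} = D.1 := D.2.choose_spec.2.symm

theorem exists_associated_gen {p : R} (hp : Prime p) [IsDomain R] :
    ∃ D : PrimeDivisor R, Associated p D.gen :=
  ⟨⟨_, p, hp, rfl⟩, Ideal.span_singleton_eq_span_singleton.1
    (span_gen ⟨_, p, hp, rfl⟩).symm⟩

theorem eq_of_gen_dvd_gen [IsDomain R] {D E : PrimeDivisor R} (h : D.gen ∣ E.gen) : D = E := by
  apply Subtype.ext
  rw [← span_gen, ← span_gen, Ideal.span_singleton_eq_span_singleton]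
  exact D.prime_gen.associated_of_dvd E.prime_gen h

theorem smul_gen_associated [IsDomain R] (g : G) (D : PrimeDivisor R) :
    Associated (g • D).gen (g • D.gen) := by
  rw [← Ideal.span_singleton_eq_span_singleton, span_gen, ← smul_span_singleton, span_gen]
  rfl

theorem exists_eq_unit_mul_sq_mul_prod [IsDomain R] [UniqueFactorizationMonoid R]
    (c : R) (hc : c ≠ 0) : ∃ (u s : R) (B : Finset (PrimeDivisor R)),
      IsUnit u ∧ c = u * s ^ 2 * ∏ D ∈ B, D.gen := by
  classical
  induction c using UniqueFactorizationMonoid.induction_on_prime with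
  | h₁ => exact absurd rfl hc
  | h₂ x hx => exact ⟨x, 1, ∅, hx, by simp⟩
  | h₃ a p ha hp ih =>
    obtain ⟨u, s, B, hu, rfl⟩ := ih ha
    obtain ⟨D, w, hD⟩ := exists_associated_gen hp
    have hpD : p = D.gen * ↑w⁻¹ := by rw [← hD, mul_assoc, Units.mul_inv, mul_one]
    by_cases h : D ∈ B
    · refine ⟨u * ↑w⁻¹, s * D.gen, B.erase D, hu.mul (Units.isUnit _), ?_⟩
      rw [← Finset.mul_prod_erase _ _ h, hpD]
      ring
    · refine ⟨u * ↑w⁻¹, s, insert D B, hu.mul (Units.isUnit _), ?_⟩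
      rw [Finset.prod_insert h, hpD]
      ring

end PrimeDivisor

theorem sq_mul_pow_mul_ne_sq {R : Type*} [CommRing R] [IsDomain R] [UniqueFactorizationMonoid R]
    {p a b c : R} {m : ℕ} (hp : Prime p) (hm : Odd m) (hb : b ≠ 0) (hc : ¬ p ∣ c) :
    b ^ 2 * (p ^ m * c) ≠ a ^ 2 := by
  intro h
  have hc0 : c ≠ 0 := fun h0 => hc (h0 ▸ dvd_zero p)
  have ha : a ≠ 0 := by
    rintro rfl
    have : b ^ 2 * (p ^ m * c) ≠ 0 :=
      mul_ne_zero (pow_ne_zero _ hb) (mul_ne_zero (pow_ne_zero _ hp.ne_zero) hc0)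
    exact this (by simpa using h)
  have fin : ∀ x : R, x ≠ 0 → FiniteMultiplicity p x := fun x hx =>
    FiniteMultiplicity.of_not_isUnit hp.not_isUnit hx
  have h' := congrArg (emultiplicity p) h
  rw [emultiplicity_mul hp, emultiplicity_mul hp, emultiplicity_pow hp, emultiplicity_pow hp,
    emultiplicity_pow hp, emultiplicity_eq_zero.2 hc, (fin a ha).emultiplicity_eq_multiplicity,
    (fin b hb).emultiplicity_eq_multiplicity, (fin p hp.ne_zero).emultiplicity_eq_multiplicity,
    multiplicity_self] at h'
  norm_cast at h'
  obtain ⟨l, rfl⟩ := hm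
  omega

theorem exists_eq_prod_of_forall_eq_one {A M ι : Type*} [Group A] [Field M] [DecidableEq ι]
    (χ : ι → A →* M) (hχ : ∀ i a, χ i a = 1 ∨ χ i a = -1) (s : Finset ι) :
    ∀ ψ : A →* M, (∀ a, ψ a = 1 ∨ ψ a = -1) → (∀ a, (∀ i ∈ s, χ i a = 1) → ψ a = 1) →
      ∃ t ⊆ s, ∀ a, ψ a * ∏ i ∈ t, χ i a = 1 := by
  induction s using Finset.induction_on with
  | empty => exact fun ψ _ h => ⟨∅, subset_rfl, fun a => by simp [h a]⟩
  | insert j s hj ih =>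
    intro ψ hψ h
    by_cases h' : ∀ a, (∀ i ∈ s, χ i a = 1) → ψ a = 1
    · obtain ⟨t, ht, h⟩ := ih ψ hψ h'
      exact ⟨t, ht.trans (Finset.subset_insert _ _), h⟩
    push Not at h'
    obtain ⟨b, hb, hψb⟩ := h'
    obtain ⟨t, ht, ht'⟩ := ih (ψ * χ j) (fun a => by
        rcases hψ a with h | h <;> rcases hχ j a with h' | h' <;> simp [h, h']) fun a ha => by
      have hb' : ψ b = -1 := (hψ b).resolve_left hψb
      have hjb : χ j b = -1 := (hχ j b).resolve_left fun h1 => hψb <|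
        h b (Finset.forall_mem_insert _ _ _ |>.2 ⟨h1, hb⟩)
      rcases hχ j a with h1 | h1
      · simp [h1, h a (Finset.forall_mem_insert _ _ _ |>.2 ⟨h1, ha⟩)]
      · have := h (a * b) (Finset.forall_mem_insert _ _ _ |>.2
          ⟨by simp [h1, hjb], fun i hi => by simp [ha i hi, hb i hi]⟩)
        simpa [hb', h1] using this
    refine ⟨insert j t, Finset.insert_subset_insert j ht, fun a => ?_⟩
    rw [Finset.prod_insert fun h => hj (ht h), ← mul_assoc]
    exact ht' a

/-- A group `Γ` acts on a field `Ω` compatibly with the action of its image `q Γ` on a subring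
`j R` that is a unique factorization domain, such that every unit of `R` is the square of an
invariant unit, and the field of invariants of `ker q` is, up to odd powers, the field of fractions
of `R`. -/
structure KummerSetting (Γ G R Ω : Type*) [Group Γ] [Group G] [CommRing R] [Field Ω]
    [MulSemiringAction Γ Ω] [MulSemiringAction G R] where
  q : Γ →* G
  j : R →+* Ω
  j_injective : Function.Injective j
  smul_j : ∀ σ r, σ • j r = j (q σ • r)
  exists_unit_sqrt : ∀ u : R, IsUnit u → ∃ v, v ^ 2 = u ∧ ∀ g : G, g • v = v
  exists_sqrt : ∀ x : Ω, ∃ y, y ^ 2 = x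
  two_ne_zero : (2 : Ω) ≠ 0
  exists_pow_eq : ∀ x : Ω, (∀ n, q n = 1 → n • x = x) →
    ∃ (m : ℕ) (a b : R), Odd m ∧ b ≠ 0 ∧ j b * x ^ m = j a

namespace KummerSetting

open PrimeDivisor

variable {Γ G R Ω : Type*} [Group Γ] [Group G] [CommRing R] [Field Ω]
    [MulSemiringAction Γ Ω] [MulSemiringAction G R] (S : KummerSetting Γ G R Ω)

/-- A square root of the chosen generator of a prime divisor. -/
noncomputable def root (D : PrimeDivisor R) : Ω := (S.exists_sqrt (S.j D.gen)).choose

theorem root_sq (D : PrimeDivisor R) : S.root D ^ 2 = S.j D.gen :=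
  (S.exists_sqrt (S.j D.gen)).choose_spec

theorem root_ne_zero (D : PrimeDivisor R) : S.root D ≠ 0 := fun h => by
  have := S.root_sq D
  rw [h, zero_pow _root_.two_ne_zero, eq_comm, map_eq_zero_iff _ S.j_injective] at this
  exact D.prime_gen.ne_zero this

/-- The factor by which `σ` scales the chosen square root. -/
noncomputable def lam (D : PrimeDivisor R) (σ : Γ) : Ω := σ • S.root D / S.root D

theorem smul_root (D : PrimeDivisor R) (σ : Γ) : σ • S.root D = S.lam D σ * S.root D :=
  (div_mul_cancel₀ _ (S.root_ne_zero D)).symm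

theorem lam_eq {D : PrimeDivisor R} {σ : Γ} {x : Ω} (h : σ • S.root D = x * S.root D) :
    S.lam D σ = x := by
  rw [lam, h, mul_div_cancel_right₀ _ (S.root_ne_zero D)]

theorem lam_ne_zero (D : PrimeDivisor R) (σ : Γ) : S.lam D σ ≠ 0 :=
  div_ne_zero ((smul_ne_zero_iff_ne σ).2 (S.root_ne_zero D)) (S.root_ne_zero D)

theorem exists_smul_root [IsDomain R] (D : PrimeDivisor R) (σ : Γ) :
    ∃ x : Ω, (∀ τ : Γ, τ • x = x) ∧ σ • S.root D = x * S.root (S.q σ • D) := by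
  obtain ⟨u, hu⟩ := smul_gen_associated (S.q σ) D
  obtain ⟨v, hv, hv'⟩ := S.exists_unit_sqrt u u.isUnit
  have hfix : ∀ τ : Γ, τ • S.j v = S.j v := fun τ => by rw [S.smul_j, hv']
  have : (σ • S.root D) ^ 2 = (S.j v * S.root (S.q σ • D)) ^ 2 := by
    rw [← smul_pow', S.root_sq, S.smul_j, ← hu, mul_pow, S.root_sq, ← map_pow, hv, map_mul,
      mul_comm]
  rcases sq_eq_sq_iff_eq_or_eq_neg.1 this with h | h
  · exact ⟨_, hfix, h⟩
  · exact ⟨-S.j v, fun τ => by rw [smul_neg, hfix], by rw [h, neg_mul]⟩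

theorem smul_lam [IsDomain R] {D : PrimeDivisor R} {σ : Γ} (hD : S.q σ • D = D) (τ : Γ) :
    τ • S.lam D σ = S.lam D σ := by
  obtain ⟨x, hx, h⟩ := S.exists_smul_root D σ
  rw [hD] at h
  rw [S.lam_eq h, hx]

theorem lam_mul [IsDomain R] (D : PrimeDivisor R) (σ τ : Γ) (hτ : S.q τ • D = D) :
    S.lam D (σ * τ) = S.lam D σ * S.lam D τ := by
  apply S.lam_eq
  rw [mul_smul, S.smul_root D τ, smul_mul', S.smul_lam hτ, S.smul_root]
  ring

theorem lam_eq_one_or_neg_one (D : PrimeDivisor R) (n : Γ) (hn : S.q n = 1) :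
    S.lam D n = 1 ∨ S.lam D n = -1 := by
  have : (n • S.root D) ^ 2 = S.root D ^ 2 := by
    rw [← smul_pow', S.root_sq, S.smul_j, hn, one_smul]
  rcases sq_eq_sq_iff_eq_or_eq_neg.1 this with h | h
  · exact Or.inl (S.lam_eq (by rw [h, one_mul]))
  · exact Or.inr (S.lam_eq (by rw [h, neg_mul, one_mul]))

theorem lam_conj [IsDomain R] (D : PrimeDivisor R) (σ τ : Γ) (hσ : S.q σ • D = D) :
    S.lam (S.q τ • D) (τ * σ * τ⁻¹) = S.lam D σ := by
  obtain ⟨x, hx, h⟩ := S.exists_smul_root D τ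
  have hx0 : x ≠ 0 := by
    rintro rfl
    rw [zero_mul, smul_eq_zero_iff_eq] at h
    exact S.root_ne_zero D h
  have h' : S.root (S.q τ • D) = x⁻¹ * τ • S.root D := by rw [h, inv_mul_cancel_left₀ hx0]
  apply S.lam_eq
  rw [h', smul_mul', smul_inv'', hx, smul_smul, inv_mul_cancel_right, mul_smul, S.smul_root D σ,
    smul_mul', S.smul_lam hσ]
  ring

theorem exists_lam_ne_one [IsDomain R] [UniqueFactorizationMonoid R] (B : Finset (PrimeDivisor R))
    (D₀ : PrimeDivisor R) : ∃ n, S.q n = 1 ∧ S.lam D₀ n ≠ 1 ∧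
      ∀ D ∈ B, D ≠ D₀ → S.lam D n = 1 := by
  classical
  by_contra! hcon
  let χ : PrimeDivisor R → S.q.ker →* Ω := fun D =>
    { toFun := fun n => S.lam D n
      map_one' := S.lam_eq (by simp)
      map_mul' := fun a b => S.lam_mul D a b (by rw [S.q.mem_ker.1 b.2, one_smul]) }
  have hχ : ∀ D a, χ D a = 1 ∨ χ D a = -1 := fun D a => S.lam_eq_one_or_neg_one D a a.2
  obtain ⟨t, ht, h⟩ := exists_eq_prod_of_forall_eq_one χ hχ (B.erase D₀) (χ D₀) (hχ D₀)
    fun a ha => by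
      by_contra hne
      obtain ⟨D, hD, hDD, h1⟩ := hcon a a.2 hne
      exact h1 (ha D (Finset.mem_erase.2 ⟨hDD, hD⟩))
  obtain ⟨m, a, b, hm, hb, hab⟩ := S.exists_pow_eq (S.root D₀ * ∏ D ∈ t, S.root D) fun n hn => by
    have := h ⟨n, hn⟩
    change S.lam D₀ n * ∏ D ∈ t, S.lam D n = 1 at this
    rw [smul_mul', S.smul_root, Finset.smul_prod']
    simp only [S.smul_root _ n, Finset.prod_mul_distrib]
    linear_combination (S.root D₀ * ∏ D ∈ t, S.root D) * this
  refine sq_mul_pow_mul_ne_sq (a := a) (c := (∏ D ∈ t, D.gen) ^ m) D₀.prime_gen hm hb ?_ ?_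
  · intro hd
    obtain ⟨D, hD, hdvd⟩ := (D₀.prime_gen.dvd_finsetProd_iff _).1 (D₀.prime_gen.dvd_of_dvd_pow hd)
    exact (Finset.mem_erase.1 (ht hD)).1 (eq_of_gen_dvd_gen hdvd).symm
  · apply S.j_injective
    simp only [map_mul, map_pow, map_prod, ← hab, ← S.root_sq, Finset.prod_pow]
    ring

theorem exists_finset_of_smul_eq [IsDomain R] [UniqueFactorizationMonoid R] (y : Ω) (hy : y ≠ 0)
    (hpm : ∀ n, S.q n = 1 → n • y = y ∨ n • y = -y) :
    ∃ B : Finset (PrimeDivisor R), ∀ n, S.q n = 1 → (∀ D ∈ B, S.lam D n = 1) → n • y = y := by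
  obtain ⟨m, a, b, hm, hb, hab⟩ := S.exists_pow_eq (y ^ 2) fun n hn => by
    rw [smul_pow']
    rcases hpm n hn with h | h <;> simp [h]
  have hjb : S.j b ≠ 0 := by rwa [Ne, map_eq_zero_iff _ S.j_injective]
  have ha : a ≠ 0 := by
    rintro rfl
    rw [map_zero] at hab
    exact mul_ne_zero hjb (pow_ne_zero _ (pow_ne_zero _ hy)) hab
  obtain ⟨u, s, B, hu, hB⟩ := exists_eq_unit_mul_sq_mul_prod (a * b) (mul_ne_zero ha hb)
  obtain ⟨v, rfl, -⟩ := S.exists_unit_sqrt u hu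
  refine ⟨B, fun n hn hnB => (hpm n hn).resolve_right fun hny => ?_⟩
  have hfix : ∀ r, n • S.j r = S.j r := fun r => by rw [S.smul_j, hn, one_smul]
  have hsq : (y ^ m * S.j b) ^ 2 = (S.j (v * s) * ∏ D ∈ B, S.root D) ^ 2 := by
    have := congrArg S.j hB
    simp only [map_mul, map_pow, map_prod, ← hab, ← S.root_sq, Finset.prod_pow] at this ⊢
    linear_combination this
  have hz : n • (y ^ m * S.j b) = y ^ m * S.j b := by
    have h1 : n • (S.j (v * s) * ∏ D ∈ B, S.root D) = S.j (v * s) * ∏ D ∈ B, S.root D := by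
      rw [smul_mul', hfix, Finset.smul_prod']
      congr 1
      exact Finset.prod_congr rfl fun D hD => by rw [S.smul_root, hnB D hD, one_mul]
    rcases sq_eq_sq_iff_eq_or_eq_neg.1 hsq with h | h
    · rw [h, h1]
    · rw [h, smul_neg, h1]
  rw [smul_mul', hfix, smul_pow', hny, hm.neg_pow] at hz
  have h0 : y ^ m * S.j b ≠ 0 := mul_ne_zero (pow_ne_zero _ hy) hjb
  exact mul_ne_zero S.two_ne_zero h0 (by linear_combination -hz)

end KummerSetting

theorem exists_monoidHom_units_apply_ne_one {A M : Type*} [Group A] [Finite A] [Field M]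
    [IsAlgClosed M] (h2 : (2 : M) ≠ 0) (hA : ∀ a : A, a ^ 2 = 1) {a : A} (ha : a ≠ 1) :
    ∃ χ : A →* Mˣ, χ a ≠ 1 := by
  let : CommGroup A :=
    { (inferInstance : Group A) with
      mul_comm := Commute.of_orderOf_dvd_two fun x => orderOf_dvd_of_pow_eq_one (hA x) }
  have : NeZero ((Monoid.exponent A : ℕ) : M) := by
    have := Monoid.exponent_dvd_of_forall_pow_eq_one hA
    rcases (Nat.dvd_prime Nat.prime_two).1 this with h | h
    · exact ⟨by rw [h]; simp⟩
    · exact ⟨by rw [h]; exact_mod_cast h2⟩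
  exact CommGroup.exists_apply_ne_one_of_hasEnoughRootsOfUnity A M ha

section

variable {K Ω : Type*} [Field K] [Field Ω] [Algebra K Ω]

theorem exists_pow_mem_range_of_forall_algEquiv [IsAlgClosed Ω] [Normal K Ω] (p : ℕ) [ExpChar K p]
    (x : Ω) (hx : ∀ σ : Gal(Ω/K), σ x = x) : ∃ m : ℕ, x ^ p ^ m ∈ (algebraMap K Ω).range := by
  classical
  have hint : IsIntegral K x := Normal.isIntegral inferInstance x
  rw [← minpoly.natSepDegree_eq_one_iff_pow_mem p, Polynomial.natSepDegree_eq_of_isAlgClosed Ω,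
    Finset.card_eq_one]
  refine ⟨x, Finset.eq_singleton_iff_unique_mem.2 ⟨?_, fun y hy => ?_⟩⟩
  · simp [minpoly.ne_zero hint]
  · rw [Multiset.mem_toFinset, ← isConjRoot_iff_mem_minpoly_aroots hint,
      isConjRoot_iff_exists_algEquiv] at hy
    obtain ⟨σ, hσ⟩ := hy
    exact σ.injective (hσ.trans (hx σ).symm)

theorem exists_forall_eq_or_eq_neg [Normal K Ω] (E : IntermediateField K Ω) [FiniteDimensional K E]
    [Normal K E] {N H : Subgroup Gal(Ω/K)} (hEH : E.fixingSubgroup ≤ H)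
    (hmul : ∀ a ∈ N, ∀ b ∈ N, a ∉ H → b ∉ H → a * b ∈ H) {n₁ : Gal(Ω/K)} (hn₁ : n₁ ∈ N)
    (hn₁H : n₁ ∉ H) :
    ∃ y : Ω, y ≠ 0 ∧ ∀ n ∈ N, (n ∈ H → n y = y) ∧ (n ∉ H → n y = -y) := by
  obtain ⟨x, hxH, hx⟩ : ∃ x : Ω, (∀ σ ∈ H, σ x = x) ∧ n₁ x ≠ x := by
    by_contra! hcon
    let r := AlgEquiv.restrictNormalHom (F := K) (K₁ := Ω) E
    have hr : r n₁ ∈ H.map r := by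
      rw [← IntermediateField.fixingSubgroup_fixedField (H.map r),
        IntermediateField.mem_fixingSubgroup_iff]
      intro x hx
      rw [IntermediateField.mem_fixedField_iff] at hx
      apply Subtype.ext
      have hcomm := fun σ : Gal(Ω/K) => AlgEquiv.restrictNormal_commutes σ E x
      refine (hcomm n₁).trans (hcon _ fun σ hσ => ?_)
      rw [← hcomm]
      exact congrArg _ (hx (r σ) (Subgroup.mem_map_of_mem r hσ))
    obtain ⟨σ, hσ, h⟩ := hr
    apply hn₁H
    have hker : σ⁻¹ * n₁ ∈ E.fixingSubgroup := by
      rw [← IntermediateField.restrictNormalHom_ker, MonoidHom.mem_ker, map_mul, map_inv]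
      change (r σ)⁻¹ * r n₁ = 1
      rw [h, inv_mul_cancel]
    simpa using H.mul_mem hσ (hEH hker)
  have hinv : n₁⁻¹ ∉ H := fun h => hn₁H (by simpa using h)
  refine ⟨x - n₁ x, fun h => hx (sub_eq_zero.1 h).symm, fun n hn => ⟨fun hnH => ?_, fun hnH => ?_⟩⟩
  · have h1 : n₁⁻¹ * (n * n₁) ∈ H := hmul _ (N.inv_mem hn₁) _ (N.mul_mem hn hn₁) hinv
      fun h => hn₁H ((H.mul_mem_cancel_left hnH).1 h)
    have h2 : n (n₁ x) = n₁ x := by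
      conv_rhs => rw [← hxH _ h1]
      simp 
    rw [map_sub, hxH n hnH, h2]
  · have h1 : n x = n₁ x := by
      conv_rhs => rw [← hxH _ (hmul _ (N.inv_mem hn₁) _ hn hinv hnH)]
      simp 
    have h2 : n (n₁ x) = x := hxH _ (hmul _ hn _ hn₁ hnH hn₁H)
    rw [map_sub, h1, h2, neg_sub]

theorem finite_range_of_mem_nhds_one [Normal K Ω] {X : Type*} [Group X] (P : Gal(Ω/K) →* X)
    (E : IntermediateField K Ω) [FiniteDimensional K E] [Normal K E]
    (hE : E.fixingSubgroup ≤ P.ker) : (Set.range P).Finite := by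
  let r := AlgEquiv.restrictNormalHom (F := K) (K₁ := Ω) E
  refine (Set.finite_range fun τ : Gal(E/K) => P (Function.surjInv
    (AlgEquiv.restrictNormalHom_surjective (F := K) (K₁ := E) Ω) τ)).subset ?_
  rintro _ ⟨σ, rfl⟩
  refine ⟨r σ, ?_⟩
  have h := Function.surjInv_eq (AlgEquiv.restrictNormalHom_surjective (F := K) (K₁ := E) Ω) (r σ)
  set τ := Function.surjInv (AlgEquiv.restrictNormalHom_surjective (F := K) (K₁ := E) Ω) (r σ)
  have : τ⁻¹ * σ ∈ P.ker := by
    apply hE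
    rw [← IntermediateField.restrictNormalHom_ker, MonoidHom.mem_ker, map_mul, map_inv]
    change _ * r σ = 1
    rw [h, inv_mul_cancel]
  rw [MonoidHom.mem_ker, map_mul, map_inv, inv_mul_eq_one] at this
  exact this

theorem KummerSetting.exists_finset_forall_lam_eq_one [Normal K Ω] [IsAlgClosed Ω]
    {G R X : Type*} [Group G] [CommRing R] [IsDomain R] [UniqueFactorizationMonoid R]
    [MulSemiringAction G R] (S : KummerSetting Gal(Ω/K) G R Ω) [Group X] (P : Gal(Ω/K) →* X)
    (hq : (S.q.ker : Set Gal(Ω/K)) ∈ 𝓝 1) (hP : (P.ker : Set Gal(Ω/K)) ∈ 𝓝 1)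
    (hP2 : ∀ n, S.q n = 1 → P n ^ 2 = 1) :
    ∃ B : Finset (PrimeDivisor R), ∀ n, S.q n = 1 → (∀ D ∈ B, S.lam D n = 1) → P n = 1 := by
  classical
  obtain ⟨E, _, _, hE⟩ := (krullTopology_mem_nhds_one_iff_of_normal K Ω _).1
    (Filter.inter_mem hq hP)
  have hEq : E.fixingSubgroup ≤ S.q.ker := fun σ hσ => (hE hσ).1
  have hEP : E.fixingSubgroup ≤ P.ker := fun σ hσ => (hE hσ).2
  have hfin := finite_range_of_mem_nhds_one P E hEP
  have key : ∀ a : X, ∃ B : Finset (PrimeDivisor R), ∀ n, S.q n = 1 →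
      (∀ D ∈ B, S.lam D n = 1) → P n = a → P n = 1 := by
    intro a
    by_cases ha : ∃ n₁, S.q n₁ = 1 ∧ P n₁ = a ∧ a ≠ 1
    swap
    · refine ⟨∅, fun n hn _ hna => ?_⟩
      by_contra h
      exact ha ⟨n, hn, hna, hna ▸ h⟩
    obtain ⟨n₁, hn₁, rfl, hPn₁⟩ := ha
    let f := P.subgroupMap S.q.ker
    have : Finite (S.q.ker.map P) := hfin.subset (by
      rintro _ ⟨σ, -, rfl⟩
      exact ⟨σ, rfl⟩)
    have hf : ∀ n (hn : S.q n = 1), (f ⟨n, hn⟩ : X) = P n := fun _ _ => rfl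
    obtain ⟨χ, hχ⟩ := exists_monoidHom_units_apply_ne_one (M := Ω) S.two_ne_zero
      (A := S.q.ker.map P) (by
        rintro ⟨_, σ, hσ, rfl⟩
        exact Subtype.ext (hP2 σ hσ)) (a := f ⟨n₁, hn₁⟩)
      (fun h => hPn₁ (by rw [← hf n₁ hn₁, h]; rfl))
    have hχ2 : ∀ n : S.q.ker, χ (f n) = 1 ∨ χ (f n) = -1 := fun n => by
      have : χ (f n) ^ 2 = 1 := by
        rw [← map_pow, ← map_one χ]
        exact congrArg _ (Subtype.ext (hP2 n n.2))
      rw [← Units.val_inj, ← Units.val_inj, Units.val_neg, Units.val_one]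
      exact sq_eq_one_iff.1 (by rw [← Units.val_pow_eq_pow_val, this, Units.val_one])
    let H := (χ.comp f).ker.map S.q.ker.subtype
    have hH : ∀ n (hn : S.q n = 1), n ∈ H ↔ χ (f ⟨n, hn⟩) = 1 := fun n hn => by
      simp [H, Subgroup.mem_map, hn]
    have hEH : E.fixingSubgroup ≤ H := fun σ hσ => by
      rw [hH σ (hEq hσ), ← map_one χ]
      exact congrArg _ (Subtype.ext (hEP hσ))
    have hmul : ∀ a ∈ S.q.ker, ∀ b ∈ S.q.ker, a ∉ H → b ∉ H → a * b ∈ H := by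
      intro a ha b hb haH hbH
      rw [hH _ ha] at haH
      rw [hH _ hb] at hbH
      rw [hH _ (S.q.ker.mul_mem ha hb)]
      have h3 : (⟨a * b, S.q.ker.mul_mem ha hb⟩ : S.q.ker) = ⟨a, ha⟩ * ⟨b, hb⟩ := rfl
      rw [h3, map_mul, map_mul, (hχ2 _).resolve_left haH, (hχ2 _).resolve_left hbH, neg_mul_neg,
        one_mul]
    obtain ⟨y, hy, hyn⟩ := exists_forall_eq_or_eq_neg E hEH hmul hn₁ (by rwa [hH _ hn₁])
    obtain ⟨B, hB⟩ := S.exists_finset_of_smul_eq y hy fun n hn => by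
      by_cases h : n ∈ H
      · exact Or.inl ((hyn n hn).1 h)
      · exact Or.inr ((hyn n hn).2 h)
    refine ⟨B, fun n hn hnB hnn₁ => ?_⟩
    have hny : n y = y := hB n hn hnB
    have hnH : n ∈ H := by
      by_contra h
      rw [(hyn n hn).2 h] at hny
      exact mul_ne_zero S.two_ne_zero hy (by linear_combination -hny)
    rw [hH n hn] at hnH
    refine absurd ?_ hχ
    rw [← hnH]
    exact congrArg _ (Subtype.ext hnn₁.symm)
  choose B hB using key
  refine ⟨hfin.toFinset.biUnion B, fun n hn h => hB (P n) n hn (fun D hD => h D ?_) rfl⟩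
  exact Finset.mem_biUnion.2 ⟨P n, by simp, hD⟩

end

/-- The permutation action of a group on the polynomial ring in variables indexed by it. -/
noncomputable abbrev MvPolynomial.regularAction (G k : Type*) [Group G] [CommRing k] :
    MulSemiringAction G (MvPolynomial G k) where
  smul g := rename (g * ·)
  one_smul f := by
    change rename (1 * ·) f = f
    simp only [one_mul]
    exact rename_id_apply f
  mul_smul g h f := by
    change rename (g * h * ·) f = rename (g * ·) (rename (h * ·) f)
    simp [rename_rename, Function.comp_def, mul_assoc]
  smul_zero g := map_zero (rename (g * ·))
  smul_add g := map_add (rename (g * ·))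
  smul_one g := map_one (rename (g * ·))
  smul_mul g := map_mul (rename (g * ·))

theorem odd_of_expChar_of_two_ne_zero {K : Type*} [Field K] (h2 : (2 : K) ≠ 0) (p : ℕ)
    [hp : ExpChar K p] : Odd p := by
  cases hp with
  | zero => exact odd_one
  | prime hq =>
    refine hq.odd_of_ne_two ?_
    rintro rfl
    exact h2 (by exact_mod_cast CharP.cast_eq_zero K 2)

section

variable {G R L : Type*} [Group G] [CommRing R] [IsDomain R] [MulSemiringAction G R] [Field L]
  [Algebra R L] [IsFractionRing R L] [MulSemiringAction G L]
  [FaithfulSMul G L] [SMulDistribClass G R L]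

theorem exists_kummerSetting_of_mulEquiv {K : Type*} [Field K] [Algebra K L]
    [FiniteDimensional K L] [Normal K L] (e : G ≃* Gal(L/K)) (he : ∀ g x, e g x = g • x)
    (Ω : Type*) [Field Ω] [Algebra K Ω] [IsAlgClosure K Ω]
    (h2 : (2 : Ω) ≠ 0)
    (hunit : ∀ u : R, IsUnit u → ∃ v, v ^ 2 = u ∧ ∀ g : G, g • v = v) :
    ∃ S : KummerSetting Gal(Ω/K) G R Ω,
      Function.Surjective S.q ∧ (S.q.ker : Set Gal(Ω/K)) ∈ 𝓝 1 := by
  have : IsAlgClosed Ω := IsAlgClosure.isAlgClosed K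
  have : Algebra.IsAlgebraic K Ω := IsAlgClosure.isAlgebraic
  have : Normal K Ω := IsAlgClosure.normal K Ω
  let φ : L →ₐ[K] Ω := IsAlgClosed.lift
  let : Algebra L Ω := φ.toRingHom.toAlgebra
  have : IsScalarTower K L Ω := IsScalarTower.of_algebraMap_eq fun x => (φ.commutes x).symm
  have : Normal L Ω := Normal.tower_top_of_normal K L Ω
  let r := AlgEquiv.restrictNormalHom (F := K) (K₁ := Ω) L
  let q := e.symm.toMonoidHom.comp r
  have hq : ∀ σ, e (q σ) = r σ := fun σ => e.apply_symm_apply _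
  have hsmul : ∀ σ x, σ (algebraMap L Ω x) = algebraMap L Ω (q σ • x) := fun σ x => by
    have : q σ • x = e (q σ) x := (he _ _).symm
    rw [this, hq]
    exact (AlgEquiv.restrictNormal_commutes σ L x).symm
  have hqone : ∀ σ, q σ = 1 ↔ ∀ x, σ (algebraMap L Ω x) = algebraMap L Ω x := fun σ => by
    refine ⟨fun h x => by rw [hsmul, h, one_smul], fun h => ?_⟩
    refine eq_of_smul_eq_smul (α := L) fun x => (algebraMap L Ω).injective ?_
    rw [← hsmul, h, one_smul]
  refine ⟨{ q := q
            j := (algebraMap L Ω).comp (algebraMap R L)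
            j_injective := (algebraMap L Ω).injective.comp (IsFractionRing.injective R L)
            smul_j := fun σ x => ?_
            exists_unit_sqrt := hunit
            exists_sqrt := fun x => ?_
            two_ne_zero := h2
            exists_pow_eq := fun x hx => ?_ }, ?_, ?_⟩
  · rw [RingHom.comp_apply, RingHom.comp_apply, algebraMap.smul', ← hsmul]
    rfl
  · exact IsAlgClosed.exists_pow_nat_eq x two_pos
  · obtain ⟨m, l, hl⟩ := exists_pow_mem_range_of_forall_algEquiv (K := L) (ringExpChar L) x
      fun σ => hx (σ.restrictScalars K) ((hqone _).2 fun y => σ.commutes y)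
    obtain ⟨a, b, hb, rfl⟩ := IsFractionRing.div_surjective (A := R) l
    have hb0 : b ≠ 0 := nonZeroDivisors.ne_zero hb
    have hb' : algebraMap R L b ≠ 0 := by
      rwa [Ne, map_eq_zero_iff _ (IsFractionRing.injective R L)]
    refine ⟨ringExpChar L ^ m, a, b, (odd_of_expChar_of_two_ne_zero (K := L) ?_ _).pow, hb0, ?_⟩
    · intro h
      apply h2
      rw [← map_ofNat (algebraMap L Ω), h, map_zero]
    · rw [← hl, RingHom.comp_apply, RingHom.comp_apply, ← map_mul, mul_div_cancel₀ _ hb']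
  · exact e.symm.surjective.comp (AlgEquiv.restrictNormalHom_surjective Ω)
  · rw [krullTopology_mem_nhds_one_iff]
    refine ⟨φ.fieldRange, φ.toLinearMap.finiteDimensional_range, fun σ hσ => ?_⟩
    refine (hqone σ).2 fun x => ?_
    exact (IntermediateField.mem_fixingSubgroup_iff _ _).1 hσ _ ⟨x, rfl⟩

end

theorem exists_kummerSetting (k G : Type) [Field k] [IsAlgClosed k] (h2 : (2 : k) ≠ 0) [Group G]
    [Finite G] : ∃ (K : Type) (_ : Field K) (_ : Algebra k K) (R : Type) (_ : CommRing R)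
      (_ : IsDomain R) (_ : UniqueFactorizationMonoid R) (_ : MulSemiringAction G R)
      (S : KummerSetting Gal(AlgebraicClosure K/K) G R (AlgebraicClosure K)),
      Function.Surjective S.q ∧ (S.q.ker : Set Gal(AlgebraicClosure K/K)) ∈ 𝓝 1 := by
  let := MvPolynomial.regularAction G k
  have hC : ∀ (g : G) (c : k), g • (MvPolynomial.C c : MvPolynomial G k) = MvPolynomial.C c :=
    fun g c => MvPolynomial.rename_C _ _
  have : FaithfulSMul G (MvPolynomial G k) := ⟨fun {g h} hgh => by
    have := hgh (MvPolynomial.X 1)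
    change MvPolynomial.rename (g * ·) _ = MvPolynomial.rename (h * ·) _ at this
    simpa using this⟩
  let L := FractionRing (MvPolynomial G k)
  let := IsFractionRing.mulSemiringAction G (MvPolynomial G k) L
  have : SMulDistribClass G (MvPolynomial G k) L := IsFractionRing.smulDistribClass _ _ _
  have : FaithfulSMul G L := IsFractionRing.faithfulSMul G (MvPolynomial G k) L
  let f : k →+* FixedPoints.subfield G L :=
    ((algebraMap (MvPolynomial G k) L).comp MvPolynomial.C).codRestrict _ fun c g => by
      rw [RingHom.comp_apply, ← algebraMap.smul', hC]
  refine ⟨FixedPoints.subfield G L, inferInstance, f.toAlgebra, MvPolynomial G k, inferInstance,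
    inferInstance, inferInstance, inferInstance, 
    exists_kummerSetting_of_mulEquiv (FixedPoints.toAlgAutMulEquiv G L) (fun _ _ => rfl) _ ?_ ?_⟩
  · intro h
    apply h2
    apply f.injective
    apply (algebraMap (FixedPoints.subfield G L)
      (AlgebraicClosure (FixedPoints.subfield G L))).injective
    rwa [map_ofNat, map_ofNat, map_zero, map_zero]
  · intro u hu
    obtain ⟨c, -, rfl⟩ := MvPolynomial.isUnit_iff_eq_C_of_isReduced.1 hu
    obtain ⟨z, rfl⟩ := IsAlgClosed.exists_pow_nat_eq c two_pos
    exact ⟨MvPolynomial.C z, (map_pow _ _ _).symm, fun g => hC g z⟩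

theorem continuous_bot_of_ker_mem_nhds_one {Γ X : Type*} [Group Γ] [TopologicalSpace Γ]
    [IsTopologicalGroup Γ] [Group X] (f : Γ →* X) (hf : (f.ker : Set Γ) ∈ 𝓝 1) :
    Continuous[_, ⊥] f := by
  let : TopologicalSpace X := ⊥
  have : DiscreteTopology X := ⟨rfl⟩
  refine continuous_of_continuousAt_one f ?_
  rw [ContinuousAt, nhds_discrete X, Filter.tendsto_pure, map_one]
  exact hf

theorem ker_mem_nhds_one_of_continuous_bot {Γ X : Type*} [Group Γ] [TopologicalSpace Γ]
    [Group X] (f : Γ →* X) (hf : Continuous[_, ⊥] f) : (f.ker : Set Γ) ∈ 𝓝 1 := by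
  let : TopologicalSpace X := ⊥
  have : DiscreteTopology X := ⟨rfl⟩
  have := hf.continuousAt (x := 1)
  rw [ContinuousAt, nhds_discrete X, Filter.tendsto_pure, map_one] at this
  exact this

theorem KummerSetting.false_of_map_comp_eq {K Ω R k ι : Type*} [Field K] [Field Ω] [Algebra K Ω]
    [Normal K Ω] [IsAlgClosed Ω] [CommRing R] [IsDomain R] [UniqueFactorizationMonoid R]
    [MulSemiringAction HeisBits R] (S : KummerSetting Gal(Ω/K) HeisBits R Ω)
    (hS : Function.Surjective S.q) (hSq : (S.q.ker : Set Gal(Ω/K)) ∈ 𝓝 1) [Field k] [CharP k 2]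
    [Fintype ι] [DecidableEq ι] {i j l : ι} (hij : i ≠ j) (hil : i ≠ l) (hjl : j ≠ l)
    (e : k) (he₀ : e ≠ 0) (he₁ : e ≠ 1) (ρ : Gal(Ω/K) →* GL ι (TruncatedWittVector 2 2 k))
    (hρ : (ρ.ker : Set Gal(Ω/K)) ∈ 𝓝 1)
    (h : ∀ σ, (ρ σ).1.map (wittReduce 2 k) = HeisBits.toMatrix e hij hil hjl (S.q σ)) : False := by
  classical
  have hker : ∀ x : TruncatedWittVector 2 2 k, wittReduce 2 k x = 0 → ∃ b, x = wittShift 2 k b :=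
    exists_eq_wittShift 2 k
  have hV1 : wittShift 2 k 1 = 2 := by exact_mod_cast wittShift_one 2 k
  obtain ⟨B, hB⟩ := S.exists_finset_forall_lam_eq_one ρ hSq hρ fun n hn => by
    have h1 := h n
    rw [hn, map_one] at h1
    obtain ⟨X, hX⟩ := exists_eq_add_map_verschiebung hker (A := (ρ n).1) (A' := 1)
      (by rw [h1, Matrix.map_one _ (map_zero _) (map_one _)])
    apply Units.ext
    have h2 : ∀ b, wittShift 2 k b + wittShift 2 k b = 0 := fun b => by
      rw [← map_add, CharTwo.add_self_eq_zero, map_zero]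
    rw [Units.val_pow_eq_pow_val, hX, pow_two, mul_add, mul_one, add_mul, one_mul,
      map_verschiebung_mul_map_verschiebung (mul_wittShift 2 k) (wittReduce_wittShift 2 k),
      add_zero, add_assoc, Units.val_one, add_eq_left]
    ext u v : 1
    exact h2 _
  let U := (Set.range fun x : HeisBits × B => x.1 • (x.2 : PrimeDivisor R)).toFinite.toFinset
  refine false_of_lift hij hil hjl e he₀ he₁ (wittReduce 2 k) (wittReduce_surjective 2 k)
    (wittShift 2 k) (wittShift_injective 2 k) (mul_wittShift 2 k) (wittReduce_wittShift 2 k) hker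
    hV1 S.q hS ((Units.coeHom _).comp ρ) h S.lam S.lam_ne_zero (fun D σ τ _ => S.lam_mul D σ τ)
    S.lam_eq_one_or_neg_one S.lam_conj (fun B D₀ _ => S.exists_lam_ne_one B D₀) U ?_ ?_
  · intro g D hD
    obtain ⟨⟨x, D, hDB⟩, rfl⟩ := (Set.Finite.mem_toFinset _).1 hD
    exact (Set.Finite.mem_toFinset _).2 ⟨⟨g * x, D, hDB⟩, mul_smul _ _ _⟩
  · intro n hn hnB
    rw [MonoidHom.comp_apply, hB n hn fun D hD => hnB D ?_, map_one]
    exact (Set.Finite.mem_toFinset _).2 ⟨⟨1, D, hD⟩, one_smul _ _⟩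

/-- If `char F ≠ 2`, `k` has characteristic `2` and more than two
elements, and `n ≥ 3`, then there exist a field extension `K/F` and a continuous
homomorphism `Γ_K → GL_n(k)` admitting no continuous lift to `GL_n(W₂(k))`. -/
theorem exists_nonliftable_char_two (F : Type) [Field F] (hF : ringChar F ≠ 2)
    (k : Type) [Field k] [CharP k 2] (hk : 2 < Cardinal.mk k) (n : ℕ) (hn : 3 ≤ n) :
    ∃ (K : Type) (instK : Field K),
      letI := instK
      ∃ (_ : Algebra F K) (ρ : Field.absoluteGaloisGroup K →* GL (Fin n) k),
        Continuous[_, ⊥] ⇑ρ ∧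
          ¬ ∃ ρ' : Field.absoluteGaloisGroup K →* GL (Fin n) (TruncatedWittVector 2 2 k),
              Continuous[_, ⊥] ⇑ρ' ∧
                (Matrix.GeneralLinearGroup.map (wittReduce 2 k)).comp ρ' = ρ := by
  obtain ⟨e, he₀, he₁⟩ : ∃ e : k, e ≠ 0 ∧ e ≠ 1 := by
    by_contra! hcon
    refine hk.not_ge ?_
    have hsurj : Function.Surjective ![(0 : k), 1] := fun x => by
      by_cases hx : x = 0
      · exact ⟨0, hx.symm⟩
      · exact ⟨1, (hcon x hx).symm⟩
    simpa using Cardinal.mk_le_of_surjective hsurj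
  have h2 : (2 : AlgebraicClosure F) ≠ 0 := fun h => by
    have : (2 : F) = 0 := (algebraMap F (AlgebraicClosure F)).injective (by
      rwa [map_ofNat, map_zero])
    have := CharP.ringChar_of_prime_eq_zero Nat.prime_two (R := F) (by exact_mod_cast this)
    exact hF this
  obtain ⟨K, _, _, R, _, _, _, _, S, hS, hSq⟩ :=
    exists_kummerSetting (AlgebraicClosure F) HeisBits h2
  have hij : (⟨0, by omega⟩ : Fin n) ≠ ⟨1, by omega⟩ := by simp
  have hil : (⟨0, by omega⟩ : Fin n) ≠ ⟨2, by omega⟩ := by simp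
  have hjl : (⟨1, by omega⟩ : Fin n) ≠ ⟨2, by omega⟩ := by simp
  let ρ : Gal(AlgebraicClosure K/K) →* GL (Fin n) k :=
    (HeisBits.toMatrix e hij hil hjl).toHomUnits.comp S.q
  refine ⟨K, inferInstance,
    ((algebraMap (AlgebraicClosure F) K).comp (algebraMap F _)).toAlgebra, ρ, ?_, ?_⟩
  · refine continuous_bot_of_ker_mem_nhds_one ρ (Filter.mem_of_superset hSq fun σ hσ => ?_)
    change _ = _ at hσ
    rw [SetLike.mem_coe, MonoidHom.mem_ker, MonoidHom.comp_apply, hσ, map_one]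
  · rintro ⟨ρ', hρ', h⟩
    refine S.false_of_map_comp_eq hS hSq hij hil hjl e he₀ he₁ ρ'
      (ker_mem_nhds_one_of_continuous_bot (Γ := Gal(AlgebraicClosure K/K)) ρ' hρ') fun σ => ?_
    exact congrArg Units.val (DFunLike.congr_fun h σ)
end

section
/- Let F be a field of characteristic different from 2 and let n ≥ 5. Then there exist a field extension K of F and a continuous homomorphism ρ : Γ_K → GL_n(𝔽₂) that does not lift to ℤ/4ℤ: no continuous homomorphism ρ̃ : Γ_K → GL_n(ℤ/4ℤ) satisfies that its composite with the entrywise reduction map GL_n(ℤ/4ℤ) → GL_n(𝔽₂) equals ρ. -/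
open Matrix Topology

namespace Nonliftable

/-- Two commuting involutions: the sum of `f` over the points not fixed by both vanishes as soon
as it vanishes on each orbit. -/
theorem sum_eq_sum_fixed_of_orbits {P : Type*} [Fintype P] [DecidableEq P] (b c : P → P)
    (hb : ∀ p, b (b p) = p) (hc : ∀ p, c (c p) = p)
    (hbc : ∀ p, b (c p) = c (b p)) (f : P → ZMod 2)
    (h₁ : ∀ p, b p = p → c p ≠ p → f p + f (c p) = 0)
    (h₂ : ∀ p, c p = p → b p ≠ p → f p + f (b p) = 0)
    (h₃ : ∀ p, b p = c p → b p ≠ p → f p + f (b p) = 0)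
    (h₄ : ∀ p, b p ≠ p → c p ≠ p → b p ≠ c p → f p + f (b p) + f (c p) + f (b (c p)) = 0) :
    ∑ p, f p = ∑ p with b p = p ∧ c p = p, f p := by
  rw [← Finset.sum_filter_add_sum_filter_not Finset.univ (fun p => b p = p ∧ c p = p) f,
    add_eq_left]
  let o : P → Finset P := fun p => {p, b p, c p, b (c p)}
  have hmem : ∀ p q, q ∈ o p → o q = o p := by
    intro p q hq
    simp only [o, Finset.mem_insert, Finset.mem_singleton] at hq ⊢
    rcases hq with rfl | rfl | rfl | rfl <;> ext x <;>
      simp only [Finset.mem_insert, Finset.mem_singleton, hb, hc, ← hbc] <;> tauto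
  have hself : ∀ p, p ∈ o p := by simp [o]
  rw [← Finset.sum_fiberwise_of_maps_to (g := o) (t := Finset.univ.image o) (by simp)]
  refine Finset.sum_eq_zero fun O hO => ?_
  obtain ⟨p, -, rfl⟩ := Finset.mem_image.1 hO
  have hfix : ∀ q ∈ o p, (b q = q ∧ c q = q) ↔ (b p = p ∧ c p = p) := by
    intro q hq
    simp only [o, Finset.mem_insert, Finset.mem_singleton] at hq
    have hbi : Function.Injective b := Function.LeftInverse.injective hb
    have hci : Function.Injective c := Function.LeftInverse.injective hc
    rcases hq with rfl | rfl | rfl | rfl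
    · rfl
    · rw [← hbc, hbi.eq_iff, hbi.eq_iff]
    · rw [hbc, hci.eq_iff, hci.eq_iff]
    · rw [← hbc, hbi.eq_iff, hbi.eq_iff, hbc, hci.eq_iff, hci.eq_iff]
  by_cases hp : b p = p ∧ c p = p
  · refine Finset.sum_eq_zero fun q hq =>
      absurd ?_ (Finset.mem_filter.1 (Finset.mem_filter.1 hq).1).2
    have : q ∈ o p := (Finset.mem_filter.1 hq).2 ▸ hself q
    exact (hfix q this).2 hp
  have hfib : ((Finset.univ.filter fun q => ¬ (b q = q ∧ c q = q)).filter fun q => o q = o p)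
      = o p := by
    ext q
    simp only [Finset.mem_filter, Finset.mem_univ, true_and]
    refine ⟨fun h => h.2 ▸ hself q, fun h => ⟨fun h' => hp ((hfix q h).1 h'), hmem p q h⟩⟩
  rw [hfib]
  by_cases hbp : b p = p
  · have hcp : c p ≠ p := fun h => hp ⟨hbp, h⟩
    have : o p = {p, c p} := by
      ext x; simp only [o, hbc, hbp, Finset.mem_insert, Finset.mem_singleton]; tauto
    rw [this, Finset.sum_pair hcp.symm, h₁ p hbp hcp]
  by_cases hcp : c p = p
  · have : o p = {p, b p} := by
      ext x; simp only [o, hcp, Finset.mem_insert, Finset.mem_singleton]; tauto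
    rw [this, Finset.sum_pair (Ne.symm hbp), h₂ p hcp hbp]
  by_cases hbcp : b p = c p
  · have : o p = {p, b p} := by
      ext x; simp only [o, ← hbcp, hb, Finset.mem_insert, Finset.mem_singleton]; tauto
    rw [this, Finset.sum_pair (Ne.symm hbp), h₃ p hbcp hbp]
  · have e₁ : b p ≠ b (c p) := fun h => hcp (Function.LeftInverse.injective hb h).symm
    have e₂ : c p ≠ b (c p) := fun h => hbp (Function.LeftInverse.injective hc (by rw [← hbc, ← h]))
    have e₃ : p ≠ b (c p) := fun h => hbcp (by conv_lhs => rw [h, hb])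
    rw [Finset.sum_insert, Finset.sum_insert, Finset.sum_insert, Finset.sum_singleton,
      ← h₄ p hbp hcp hbcp]
    · ring
    · simpa using e₂
    · simpa using ⟨hbcp, e₁⟩
    · simpa using ⟨Ne.symm hbp, Ne.symm hcp, e₃⟩

/-- Two commuting involutions of `X` changing `f` by invariant quantities: only common fixed points
contribute to the sum of `f`, provided that the action is free where `f` is not invariant. -/
theorem sum_eq_sum_fixed_of_affine {P : Type*} [DecidableEq P] (X : Finset P)
    (a b : P → P) (haX : ∀ p ∈ X, a p ∈ X) (hbX : ∀ p ∈ X, b p ∈ X)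
    (ha : ∀ p, a (a p) = p) (hb : ∀ p, b (b p) = p)
    (hab : ∀ p, a (b p) = b (a p)) (f l m : P → ZMod 2)
    (hfa : ∀ p ∈ X, f (a p) = f p + l p) (hfb : ∀ p ∈ X, f (b p) = f p + m p)
    (hla : ∀ p ∈ X, l (a p) = l p) (hlb : ∀ p ∈ X, l (b p) = l p)
    (hma : ∀ p ∈ X, m (a p) = m p) (hmb : ∀ p ∈ X, m (b p) = m p)
    (hfree : ∀ p ∈ X, ¬ (l p = 0 ∧ m p = 0) → a p ≠ p ∧ b p ≠ p ∧ a (b p) ≠ p) :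
    ∑ p ∈ X, f p = ∑ p ∈ X with a p = p ∧ b p = p, f p := by
  rw [← Finset.sum_filter_add_sum_filter_not X (fun p => a p = p ∧ b p = p) f, add_eq_left]
  have h2 : ∀ x : ZMod 2, x + x = 0 := CharTwo.add_self_eq_zero
  have hone : ∀ x : ZMod 2, x ≠ 0 → x = 1 := by decide
  have hai : Function.Injective a := Function.LeftInverse.injective ha
  have hbi : Function.Injective b := Function.LeftInverse.injective hb
  let g : P → P := fun p => if l p = 0 ∧ m p = 0 then (if a p = p then b p else a p)
    else if l p = 0 then a p else if m p = 0 then b p else a (b p)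
  have hgc : ∀ p ∈ X, ¬ (a p = p ∧ b p = p) → (g p = a p ∧ l p = 0 ∧ g (a p) = p) ∨
      (g p = b p ∧ m p = 0 ∧ g (b p) = p) ∨ (g p = a (b p) ∧ l p = m p ∧ g (a (b p)) = p) := by
    intro p hp hn
    have hlab : l (a (b p)) = l p := by rw [hla _ (hbX p hp), hlb p hp]
    have hmab : m (a (b p)) = m p := by rw [hma _ (hbX p hp), hmb p hp]
    by_cases h0 : l p = 0 ∧ m p = 0
    · by_cases hap : a p = p
      · exact Or.inr (Or.inl ⟨by simp [g, h0, hap], h0.2, by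
          simp [g, hlb p hp, hmb p hp, h0, hab, hap, hb]⟩)
      · refine Or.inl ⟨by simp [g, h0, hap], h0.1, ?_⟩
        simp [g, hla p hp, hma p hp, h0, ha, Ne.symm hap]
    · by_cases hl : l p = 0
      · have : m p ≠ 0 := fun h => h0 ⟨hl, h⟩
        refine Or.inl ⟨by simp [g, hl, this], hl, ?_⟩
        simp [g, hla p hp, hma p hp, hl, this, ha]
      · by_cases hm : m p = 0
        · refine Or.inr (Or.inl ⟨by simp [g, hl, hm], hm, ?_⟩)
          simp [g, hlb p hp, hmb p hp, hl, hm, hb]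
        · refine Or.inr (Or.inr ⟨by simp [g, hl, hm], by rw [hone _ hl, hone _ hm], ?_⟩)
          simp only [g, hlab, hmab, hl, hm, false_and, if_false]
          rw [← hab, ha, hb]
  have hgne : ∀ p ∈ X, ¬ (a p = p ∧ b p = p) → g p ≠ p := by
    intro p hp hn
    by_cases h0 : l p = 0 ∧ m p = 0
    · by_cases hap : a p = p
      · simp only [g, h0, hap, and_self, if_true]
        exact fun h => hn ⟨hap, h⟩
      · simp [g, h0, hap]
    · obtain ⟨h1, h2, h3⟩ := hfree p hp h0
      simp only [g, h0, if_false]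
      split_ifs <;> assumption
  refine Finset.sum_involution (fun p _ => g p) ?_ ?_ ?_ ?_
  · intro p hp
    obtain ⟨hp, hn⟩ := Finset.mem_filter.1 hp
    rcases hgc p hp hn with ⟨h, h', -⟩ | ⟨h, h', -⟩ | ⟨h, h', -⟩
    · rw [h, hfa p hp, h', add_zero, h2]
    · rw [h, hfb p hp, h', add_zero, h2]
    · rw [h, hfa _ (hbX p hp), hfb p hp, hlb p hp, h', add_assoc, h2, add_zero, h2]
  · intro p hp _
    obtain ⟨hp, hn⟩ := Finset.mem_filter.1 hp
    exact hgne p hp hn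
  · intro p hp
    obtain ⟨hp, hn⟩ := Finset.mem_filter.1 hp
    refine Finset.mem_filter.2 ?_
    rcases hgc p hp hn with ⟨h, -⟩ | ⟨h, -⟩ | ⟨h, -⟩ <;> rw [h]
    · exact ⟨haX p hp, by rwa [hai.eq_iff, ← hab, hai.eq_iff]⟩
    · exact ⟨hbX p hp, by rwa [hab, hbi.eq_iff, hbi.eq_iff]⟩
    · exact ⟨haX _ (hbX p hp), by
        rwa [hai.eq_iff, ← hab, hai.eq_iff, hab, hbi.eq_iff, hbi.eq_iff]⟩
  · intro p hp
    obtain ⟨hp, hn⟩ := Finset.mem_filter.1 hp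
    rcases hgc p hp hn with ⟨h, -, h'⟩ | ⟨h, -, h'⟩ | ⟨h, -, h'⟩ <;> rw [h, h']

theorem sum_eq_sum_fixed_of_cocycle {P : Type*} [Fintype P] [DecidableEq P] (b c : P → P)
    (hb : ∀ p, b (b p) = p) (hc : ∀ p, c (c p) = p)
    (hbc : ∀ p, b (c p) = c (b p)) (a₁ a₂ a₃ ε₁ ε₂ ε₃ : P → ZMod 2)
    (ha₁ : ∀ p, a₁ (b p) + a₁ p = a₃ p + a₃ (c p)) (ha₂ : ∀ p, a₂ (c p) + a₂ p = a₃ p + a₃ (b p))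
    (ha₁' : ∀ p, b p = p → a₁ (c p) = a₁ p) (ha₂' : ∀ p, c p = p → a₂ (b p) = a₂ p)
    (ha₃' : ∀ p, b p = c p → a₃ (b p) = a₃ p)
    (hε₁ : ∀ p, ε₁ (b p) = ε₁ p) (hε₂ : ∀ p, ε₂ (c p) = ε₂ p)
    (hε₃b : ∀ p, ε₃ p + ε₃ (b p) = ε₁ p + ε₁ (c p))
    (hε₃c : ∀ p, ε₃ p + ε₃ (c p) = ε₂ p + ε₂ (b p))
    (hε₃ : ∀ p, b p = p → c p = p → ε₃ p = 0) :
    ∑ p, (a₁ p * ε₁ p + a₂ p * ε₂ p + a₃ p * ε₃ p) =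
      ∑ p with b p = p ∧ c p = p, (a₁ p * ε₁ p + a₂ p * ε₂ p) := by
  rw [sum_eq_sum_fixed_of_orbits b c hb hc hbc]
  · refine Finset.sum_congr rfl fun p hp => ?_
    obtain ⟨h, h'⟩ := (Finset.mem_filter.1 hp).2
    rw [hε₃ p h h', mul_zero, add_zero]
  · intro p h _
    have h1 := ha₁ p; have h2 := ha₂ p; have h3 := ha₁' p h
    have h4 := hε₂ p; have h5 := hε₃b p; have h6 := hε₃c p
    rw [h] at h1 h2 h5 h6
    rw [h3, h4]
    grind
  · intro p h _
    have h1 := ha₁ p; have h2 := ha₂ p; have h3 := ha₂' p h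
    have h4 := hε₁ p; have h5 := hε₃b p; have h6 := hε₃c p
    rw [h] at h1 h2 h5 h6
    rw [h3, h4]
    grind
  · intro p h _
    have h1 := ha₁ p; have h2 := ha₂ p; have h3 := ha₃' p h
    have h4 := hε₁ p; have h5 := hε₃b p; have h6 := hε₃c p; have h7 := hε₂ p
    rw [← h] at h1 h2 h5 h6 h7
    rw [h3] at h1 h2
    grind
  · intro p _ _ _
    have h1 := ha₁ p; have h2 := ha₂ p; have h3 := ha₁ (c p); have h4 := ha₂ (b p)
    rw [hc] at h3; rw [hb, ← hbc] at h4
    have e1 := hε₁ p; have e2 := hε₁ (c p); have e3 := hε₂ p; have e4 := hε₂ (b p)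
    rw [← hbc] at e4
    have e5 := hε₃b p; have e6 := hε₃c p; have e7 := hε₃b (c p); have e8 := hε₃c (b p)
    rw [hc] at e7; rw [hb, ← hbc] at e8
    rw [e1, e2, e3, e4]
    grind

abbrev M5 := Matrix (Fin 5) (Fin 5) (ZMod 2)

/-- The nilpotent part of the involution `b`. -/
def nb : M5 := !![0,0,0,0,0; 0,0,0,1,0; 0,0,0,0,1; 0,0,0,0,0; 0,0,0,0,0]
/-- The nilpotent part of the involution `c`. -/
def nc : M5 := !![0,0,0,0,0; 0,0,0,1,1; 0,0,0,1,0; 0,0,0,0,0; 0,0,0,0,0]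
def nv₁ : M5 := !![0,0,0,1,0; 0,0,0,0,0; 0,0,0,0,0; 0,0,0,0,0; 0,0,0,0,0]
def nv₂ : M5 := !![0,0,0,0,1; 0,0,0,0,0; 0,0,0,0,0; 0,0,0,0,0; 0,0,0,0,0]
def nu₁ : M5 := !![0,1,0,0,0; 0,0,0,0,0; 0,0,0,0,0; 0,0,0,0,0; 0,0,0,0,0]
def nu₂ : M5 := !![0,0,1,0,0; 0,0,0,0,0; 0,0,0,0,0; 0,0,0,0,0; 0,0,0,0,0]

theorem one_add_mul_self_of_sq_eq_zero {R : Type*} [Ring R] [CharP R 2] {N : R} (hN : N * N = 0) :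
    (1 + N) * (1 + N) = 1 := by
  rw [mul_add, mul_one, add_mul, one_mul, hN, add_zero, add_assoc, CharTwo.add_self_eq_zero,
    add_zero]

/-- The unipotent involution `1 + N`. -/
def invol (N : M5) (hN : N * N = 0) : GL (Fin 5) (ZMod 2) :=
  ⟨1 + N, 1 + N, one_add_mul_self_of_sq_eq_zero hN, one_add_mul_self_of_sq_eq_zero hN⟩

theorem nb_sq : nb * nb = 0 := by decide
theorem nc_sq : nc * nc = 0 := by decide

def b : GL (Fin 5) (ZMod 2) := invol nb nb_sq
def c : GL (Fin 5) (ZMod 2) := invol nc nc_sq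
def v₁ : GL (Fin 5) (ZMod 2) := invol nv₁ (by decide)
def v₂ : GL (Fin 5) (ZMod 2) := invol nv₂ (by decide)
def u₁ : GL (Fin 5) (ZMod 2) := invol nu₁ (by decide)
def u₂ : GL (Fin 5) (ZMod 2) := invol nu₂ (by decide)

theorem invol_mul_self (N : M5) (hN : N * N = 0) : invol N hN * invol N hN = 1 :=
  Units.ext (one_add_mul_self_of_sq_eq_zero hN)

theorem b_mul_c : b * c = c * b := by decide
theorem b_mul_v₁ : b * v₁ = v₁ * b := by decide
theorem b_mul_v₂ : b * v₂ = v₂ * b := by decide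
theorem c_mul_v₁ : c * v₁ = v₁ * c := by decide
theorem c_mul_v₂ : c * v₂ = v₂ * c := by decide
theorem v₁_mul_v₂ : v₁ * v₂ = v₂ * v₁ := by decide
theorem u₁_mul_u₂ : u₁ * u₂ = u₂ * u₁ := by decide
theorem v₁_mul_u₁ : v₁ * u₁ = u₁ * v₁ := by decide
theorem v₁_mul_u₂ : v₁ * u₂ = u₂ * v₁ := by decide
theorem v₂_mul_u₁ : v₂ * u₁ = u₁ * v₂ := by decide
theorem v₂_mul_u₂ : v₂ * u₂ = u₂ * v₂ := by decide
theorem b_mul_u₁ : b * u₁ = u₁ * (b * v₁) := by decide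
theorem b_mul_u₂ : b * u₂ = u₂ * (b * v₂) := by decide
theorem c_mul_u₁ : c * u₁ = u₁ * (c * (v₁ * v₂)) := by decide
theorem c_mul_u₂ : c * u₂ = u₂ * (c * v₁) := by decide

def z₁ (m : M5) : ZMod 2 := m 1 3 + m 2 3 + m 1 4
def z₂ (m : M5) : ZMod 2 := m 2 3 + m 1 4 + m 2 4
def z₃ (m : M5) : ZMod 2 := m 1 3 + m 2 4 + m 4 3 + m 3 4 + m 4 4

/-- Conjugation by `1 + N`. -/
def conj (N m : M5) : M5 := (1 + N) * m * (1 + N)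

theorem z₁_conj_nb (m : M5) : z₁ (conj nb m) + z₁ m = z₃ m + z₃ (conj nc m) := by
  simp [z₁, z₃, conj, nb, nc, Matrix.mul_apply, Fin.sum_univ_succ, Matrix.one_apply]
  grind

theorem z₂_conj_nc (m : M5) : z₂ (conj nc m) + z₂ m = z₃ m + z₃ (conj nb m) := by
  simp [z₂, z₃, conj, nb, nc, Matrix.mul_apply, Fin.sum_univ_succ, Matrix.one_apply]
  grind

theorem z₁_conj_nc (m : M5) (h : conj nb m = m) : z₁ (conj nc m) = z₁ m := by
  have h1 := congrFun₂ h 1 3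
  have h2 := congrFun₂ h 1 4
  have h3 := congrFun₂ h 2 3
  have h4 := congrFun₂ h 2 4
  have h5 := congrFun₂ h 1 1
  have h6 := congrFun₂ h 1 2
  have h7 := congrFun₂ h 2 1
  have h8 := congrFun₂ h 2 2
  simp [z₁, conj, nb, nc, Matrix.mul_apply, Fin.sum_univ_succ, Matrix.one_apply] at *
  grind

theorem z₂_conj_nb (m : M5) (h : conj nc m = m) : z₂ (conj nb m) = z₂ m := by
  have h1 := congrFun₂ h 1 3
  have h2 := congrFun₂ h 1 4
  have h3 := congrFun₂ h 2 3
  have h4 := congrFun₂ h 2 4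
  have h5 := congrFun₂ h 1 1
  have h6 := congrFun₂ h 1 2
  have h7 := congrFun₂ h 2 1
  have h8 := congrFun₂ h 2 2
  simp [z₂, conj, nb, nc, Matrix.mul_apply, Fin.sum_univ_succ, Matrix.one_apply] at *
  grind

theorem z₃_conj_nb (m : M5) (h : conj nb m = conj nc m) : z₃ (conj nb m) = z₃ m := by
  have h1 := congrFun₂ h 1 3
  have h2 := congrFun₂ h 1 4
  have h3 := congrFun₂ h 2 3
  have h4 := congrFun₂ h 2 4
  have h5 := congrFun₂ h 3 3
  have h6 := congrFun₂ h 3 4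
  have h7 := congrFun₂ h 4 3
  have h8 := congrFun₂ h 4 4
  simp [z₃, conj, nb, nc, Matrix.mul_apply, Fin.sum_univ_succ, Matrix.one_apply] at *
  grind

theorem z₁_conj_nv₁ (m : M5) : z₁ (conj nv₁ m) = z₁ m + (m 1 0 + m 2 0) := by
  simp [z₁, conj, nv₁, Matrix.mul_apply, Fin.sum_univ_succ, Matrix.one_apply]
  grind
theorem z₂_conj_nv₁ (m : M5) : z₂ (conj nv₁ m) = z₂ m + m 2 0 := by
  simp [z₂, conj, nv₁, Matrix.mul_apply, Fin.sum_univ_succ, Matrix.one_apply]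
  grind
theorem z₁_conj_nv₂ (m : M5) : z₁ (conj nv₂ m) = z₁ m + m 1 0 := by
  simp [z₁, conj, nv₂, Matrix.mul_apply, Fin.sum_univ_succ, Matrix.one_apply]
  grind
theorem z₂_conj_nv₂ (m : M5) : z₂ (conj nv₂ m) = z₂ m + (m 1 0 + m 2 0) := by
  simp [z₂, conj, nv₂, Matrix.mul_apply, Fin.sum_univ_succ, Matrix.one_apply]
  grind
theorem conj_nv₁_apply_zero (m : M5) : conj nv₁ m 1 0 = m 1 0 ∧ conj nv₁ m 2 0 = m 2 0 := by
  simp [conj, nv₁, Matrix.mul_apply, Fin.sum_univ_succ, Matrix.one_apply]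
theorem conj_nv₂_apply_zero (m : M5) : conj nv₂ m 1 0 = m 1 0 ∧ conj nv₂ m 2 0 = m 2 0 := by
  simp [conj, nv₂, Matrix.mul_apply, Fin.sum_univ_succ, Matrix.one_apply]
theorem apply_zero_of_conj_nv₁ (m : M5) (h : conj nv₁ m = m) : m 1 0 = 0 ∧ m 2 0 = 0 := by
  have h1 := congrFun₂ h 1 3
  have h2 := congrFun₂ h 2 3
  simp [conj, nv₁, Matrix.mul_apply, Fin.sum_univ_succ, Matrix.one_apply] at *
  grind
theorem apply_zero_of_conj_nv₂ (m : M5) (h : conj nv₂ m = m) : m 1 0 = 0 ∧ m 2 0 = 0 := by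
  have h1 := congrFun₂ h 1 4
  have h2 := congrFun₂ h 2 4
  simp [conj, nv₂, Matrix.mul_apply, Fin.sum_univ_succ, Matrix.one_apply] at *
  grind
theorem apply_zero_of_conj_nv₁_nv₂ (m : M5) (h : conj nv₁ (conj nv₂ m) = m) :
    m 1 0 = 0 ∧ m 2 0 = 0 := by
  have h1 := congrFun₂ h 1 4
  have h2 := congrFun₂ h 2 4
  simp [conj, nv₁, nv₂, Matrix.mul_apply, Fin.sum_univ_succ, Matrix.one_apply] at *
  grind
theorem z₁_conj_nu₁ (m : M5) : z₁ (conj nu₁ m) = z₁ m := by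
  simp [z₁, conj, nu₁, Matrix.mul_apply, Fin.sum_univ_succ, Matrix.one_apply]
theorem z₂_conj_nu₁ (m : M5) : z₂ (conj nu₁ m) = z₂ m := by
  simp [z₂, conj, nu₁, Matrix.mul_apply, Fin.sum_univ_succ, Matrix.one_apply]
theorem z₁_conj_nu₂ (m : M5) : z₁ (conj nu₂ m) = z₁ m := by
  simp [z₁, conj, nu₂, Matrix.mul_apply, Fin.sum_univ_succ, Matrix.one_apply]
theorem z₂_conj_nu₂ (m : M5) : z₂ (conj nu₂ m) = z₂ m := by
  simp [z₂, conj, nu₂, Matrix.mul_apply, Fin.sum_univ_succ, Matrix.one_apply]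
theorem z_eq_zero (m : M5) (h : conj nu₁ m = m) (h' : conj nu₂ m = m) : z₁ m = 0 ∧ z₂ m = 0 := by
  have h1 := congrFun₂ h 0 3
  have h2 := congrFun₂ h 0 4
  have h3 := congrFun₂ h' 0 3
  have h4 := congrFun₂ h' 0 4
  simp [z₁, z₂, conj, nu₁, nu₂, Matrix.mul_apply, Fin.sum_univ_succ, Matrix.one_apply] at *
  grind

theorem invol_inv (N : M5) (hN : N * N = 0) : (invol N hN)⁻¹ = invol N hN :=
  inv_eq_of_mul_eq_one_left (invol_mul_self N hN)

theorem invol_conj (N : M5) (hN : N * N = 0) (m : M5) :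
    (invol N hN : M5) * m * ((invol N hN)⁻¹ : GL (Fin 5) (ZMod 2)) = conj N m := by
  rw [invol_inv]; rfl

open Classical in
/-- The exponent of a sign `±1`. -/
noncomputable def sgn {k : Type*} [Monoid k] (x : k) : ZMod 2 := if x = 1 then 0 else 1

theorem sgn_one {k : Type*} [Monoid k] : sgn (1 : k) = 0 := if_pos rfl

theorem sgn_mul {k : Type*} [Field k] {x y : kˣ} (hx : x ^ 2 = 1) (hy : y ^ 2 = 1) :
    sgn (x * y) = sgn x + sgn y := by
  have h : ∀ z : kˣ, z ^ 2 = 1 → z = 1 ∨ z = -1 := fun z hz => by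
    rw [sq] at hz
    have := mul_self_eq_one_iff.1 (by rw [← Units.val_mul, hz, Units.val_one] : (z : k) * z = 1)
    rcases this with h | h
    · exact Or.inl (Units.ext h)
    · exact Or.inr (Units.ext (by simpa using h))
  by_cases h1 : (-1 : kˣ) = 1
  · rcases h x hx with rfl | rfl <;> rcases h y hy with rfl | rfl <;> simp [sgn, h1]
  · rcases h x hx with rfl | rfl <;> rcases h y hy with rfl | rfl <;> simp [sgn, h1]
    decide

theorem sgn_div {k : Type*} [Field k] {x y : kˣ} (hx : x ^ 2 = 1) (hy : y ^ 2 = 1) :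
    sgn (x / y) = sgn x + sgn y := by
  have : x / y = x * y := by rw [div_eq_iff_eq_mul, mul_assoc, ← sq, hy, mul_one]
  rw [this, sgn_mul hx hy]

local notation "H" => GL (Fin 5) (ZMod 2)

section Core
variable {k P : Type*} [Field k] [MulAction H P] {u : H → P → kˣ}

theorem cocycle_one (hu : ∀ g h p, u (g * h) p = u g (h • p) * u h p) (p : P) : u 1 p = 1 := by
  have := hu 1 1 p
  rwa [mul_one, one_smul, right_eq_mul] at this

/-- Invariance of `u s` under `h` at a point fixed by `s`, when `s * h = h * (s * v)`. -/
theorem cocycle_apply_smul (hu : ∀ g h p, u (g * h) p = u g (h • p) * u h p) {s h v : H} {p : P}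
    (hsh : s * h = h * (s * v)) (hs : s • p = p) (hv : v • p = p) :
    u s (h • p) = u s p * u v p := by
  have h1 := hu s h p
  rw [hsh, hu h (s * v) p, hu s v p, mul_smul, hv, hs, mul_comm] at h1
  exact (mul_right_cancel h1).symm

theorem cocycle_apply_smul_of_comm (hu : ∀ g h p, u (g * h) p = u g (h • p) * u h p) {s h : H}
    {p : P} (hsh : s * h = h * s) (hs : s • p = p) : u s (h • p) = u s p := by
  have := cocycle_apply_smul (s := s) (h := h) (v := 1) hu (by rw [mul_one, hsh]) hs (one_smul _ p)
  rw [this, cocycle_one hu, mul_one]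

theorem cocycle_sq (hu : ∀ g h p, u (g * h) p = u g (h • p) * u h p) {s : H} (hs : s * s = 1)
    {p : P} (hp : s • p = p) : u s p ^ 2 = 1 := by
  have := hu s s p
  rw [hs, hp, cocycle_one hu] at this
  rw [sq, ← this]

theorem smul_smul_comm {s h : H} (hsh : s * h = h * s) (p : P) : s • h • p = h • s • p := by
  rw [← mul_smul, hsh, mul_smul]

theorem invol_smul_smul (N : M5) (hN : N * N = 0) (p : P) :
    invol N hN • invol N hN • p = p := by
  rw [← mul_smul, invol_mul_self, one_smul]

variable [Fintype P] {m : P → M5}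

theorem sum_fixed_eq_zero (hu : ∀ g h p, u (g * h) p = u g (h • p) * u h p)
    (hm : ∀ (g : H) p, m (g • p) = (g : M5) * m p * (g⁻¹ : H)) [DecidableEq P] :
    ∑ p with b • p = p ∧ c • p = p, (z₁ (m p) * sgn (u b p) + z₂ (m p) * sgn (u c p)) = 0 := by
  have hv₁ : ∀ p, m (v₁ • p) = conj nv₁ (m p) := fun p => by rw [hm]; exact invol_conj _ _ _
  have hv₂ : ∀ p, m (v₂ • p) = conj nv₂ (m p) := fun p => by rw [hm]; exact invol_conj _ _ _
  have hu₁ : ∀ p, m (u₁ • p) = conj nu₁ (m p) := fun p => by rw [hm]; exact invol_conj _ _ _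
  have hu₂ : ∀ p, m (u₂ • p) = conj nu₂ (m p) := fun p => by rw [hm]; exact invol_conj _ _ _
  have hsq : ∀ p, b • p = p → c • p = p → v₁ • p = p → v₂ • p = p → u b p ^ 2 = 1 ∧
      u c p ^ 2 = 1 ∧ u v₁ p ^ 2 = 1 ∧ u v₂ p ^ 2 = 1 ∧ (v₁ * v₂) • p = p ∧
      u (v₁ * v₂) p = u v₁ p * u v₂ p := fun p hb hc hv hv' =>
    ⟨cocycle_sq hu (invol_mul_self _ _) hb, cocycle_sq hu (invol_mul_self _ _) hc,
      cocycle_sq hu (invol_mul_self _ _) hv, cocycle_sq hu (invol_mul_self _ _) hv',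
      by rw [mul_smul, hv', hv], by rw [hu, hv']⟩
  rw [sum_eq_sum_fixed_of_affine _ (v₁ • ·) (v₂ • ·)
    (l := fun p => (m p 1 0 + m p 2 0) * sgn (u b p) + m p 2 0 * sgn (u c p))
    (m := fun p => m p 1 0 * sgn (u b p) + (m p 1 0 + m p 2 0) * sgn (u c p))]
  · rw [sum_eq_sum_fixed_of_affine _ (u₁ • ·) (u₂ • ·)
      (l := fun p => z₁ (m p) * sgn (u v₁ p) + z₂ (m p) * (sgn (u v₁ p) + sgn (u v₂ p)))
      (m := fun p => z₁ (m p) * sgn (u v₂ p) + z₂ (m p) * sgn (u v₁ p))]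
    · refine Finset.sum_eq_zero fun p hp => ?_
      simp only [Finset.mem_filter] at hp
      obtain ⟨h1, h2⟩ := z_eq_zero (m p) (by rw [← hu₁, hp.2.1]) (by rw [← hu₂, hp.2.2])
      rw [h1, h2, zero_mul, zero_mul, zero_add]
    all_goals try simp only [Finset.mem_filter, Finset.mem_univ, true_and]
    · rintro p ⟨⟨hb, hc⟩, hv, hv'⟩
      refine ⟨⟨?_, ?_⟩, ?_, ?_⟩
      · rw [← mul_smul, b_mul_u₁, mul_smul, mul_smul, hv, hb]
      · rw [← mul_smul, c_mul_u₁, mul_smul, mul_smul, mul_smul, hv', hv, hc]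
      · rw [smul_smul_comm v₁_mul_u₁, hv]
      · rw [smul_smul_comm v₂_mul_u₁, hv']
    · rintro p ⟨⟨hb, hc⟩, hv, hv'⟩
      refine ⟨⟨?_, ?_⟩, ?_, ?_⟩
      · rw [← mul_smul, b_mul_u₂, mul_smul, mul_smul, hv', hb]
      · rw [← mul_smul, c_mul_u₂, mul_smul, mul_smul, hv, hc]
      · rw [smul_smul_comm v₁_mul_u₂, hv]
      · rw [smul_smul_comm v₂_mul_u₂, hv']
    · exact fun p => invol_smul_smul _ _ p
    · exact fun p => invol_smul_smul _ _ p
    · exact fun p => smul_smul_comm u₁_mul_u₂ p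
    · rintro p ⟨⟨hb, hc⟩, hv, hv'⟩
      obtain ⟨hsb, hsc, hs₁, hs₂, hvv, hsv⟩ := hsq p hb hc hv hv'
      rw [hu₁, z₁_conj_nu₁, z₂_conj_nu₁, cocycle_apply_smul hu b_mul_u₁ hb hv,
        cocycle_apply_smul hu c_mul_u₁ hc hvv, hsv, sgn_mul hsb hs₁,
        sgn_mul hsc (by rw [mul_pow, hs₁, hs₂, mul_one]), sgn_mul hs₁ hs₂]
      ring
    · rintro p ⟨⟨hb, hc⟩, hv, hv'⟩
      obtain ⟨hsb, hsc, hs₁, hs₂, hvv, hsv⟩ := hsq p hb hc hv hv'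
      rw [hu₂, z₁_conj_nu₂, z₂_conj_nu₂, cocycle_apply_smul hu b_mul_u₂ hb hv',
        cocycle_apply_smul hu c_mul_u₂ hc hv, sgn_mul hsb hs₂, sgn_mul hsc hs₁]
      ring
    · rintro p ⟨⟨hb, hc⟩, hv, hv'⟩
      rw [hu₁, z₁_conj_nu₁, z₂_conj_nu₁, cocycle_apply_smul_of_comm hu v₁_mul_u₁ hv,
        cocycle_apply_smul_of_comm hu v₂_mul_u₁ hv']
    · rintro p ⟨⟨hb, hc⟩, hv, hv'⟩
      rw [hu₂, z₁_conj_nu₂, z₂_conj_nu₂, cocycle_apply_smul_of_comm hu v₁_mul_u₂ hv,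
        cocycle_apply_smul_of_comm hu v₂_mul_u₂ hv']
    · rintro p ⟨⟨hb, hc⟩, hv, hv'⟩
      rw [hu₁, z₁_conj_nu₁, z₂_conj_nu₁, cocycle_apply_smul_of_comm hu v₁_mul_u₁ hv,
        cocycle_apply_smul_of_comm hu v₂_mul_u₁ hv']
    · rintro p ⟨⟨hb, hc⟩, hv, hv'⟩
      rw [hu₂, z₁_conj_nu₂, z₂_conj_nu₂, cocycle_apply_smul_of_comm hu v₁_mul_u₂ hv,
        cocycle_apply_smul_of_comm hu v₂_mul_u₂ hv']
    · rintro p ⟨⟨hb, hc⟩, hv, hv'⟩ h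
      obtain ⟨hsb, hsc, hs₁, hs₂, hvv, hsv⟩ := hsq p hb hc hv hv'
      have key : ¬ (u v₁ p = 1 ∧ u v₂ p = 1) := fun h' => h (by simp [h'.1, h'.2, sgn_one])
      have e₁ := cocycle_apply_smul hu b_mul_u₁ hb hv
      have e₂ := cocycle_apply_smul hu c_mul_u₁ hc hvv
      have e₃ := cocycle_apply_smul hu b_mul_u₂ hb hv'
      have e₄ := cocycle_apply_smul hu c_mul_u₂ hc hv
      rw [hsv] at e₂
      refine ⟨fun h' => key ?_, fun h' => key ?_, fun h' => key ?_⟩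
      · rw [h', left_eq_mul] at e₁ e₂
        rw [e₁, one_mul] at e₂
        exact ⟨e₁, e₂⟩
      · rw [h', left_eq_mul] at e₃ e₄
        exact ⟨e₄, e₃⟩
      · have hb₁ : b • u₂ • p = u₂ • p := by
          rw [← mul_smul, b_mul_u₂, mul_smul, mul_smul, hv', hb]
        have hc₁ : c • u₂ • p = u₂ • p := by
          rw [← mul_smul, c_mul_u₂, mul_smul, mul_smul, hv, hc]
        have hv₃ : v₁ • u₂ • p = u₂ • p := by rw [smul_smul_comm v₁_mul_u₂, hv]
        have hv₄ : v₂ • u₂ • p = u₂ • p := by rw [smul_smul_comm v₂_mul_u₂, hv']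
        have f₁ := cocycle_apply_smul hu b_mul_u₁ hb₁ hv₃
        have f₂ := cocycle_apply_smul hu c_mul_u₁ hc₁ (by rw [mul_smul, hv₄, hv₃])
        have g₁ := cocycle_apply_smul_of_comm hu v₁_mul_u₂ hv
        have g₂ := cocycle_apply_smul_of_comm hu v₂_mul_u₂ hv'
        rw [h', e₃, g₁, mul_assoc, left_eq_mul] at f₁
        rw [h', e₄, hu, hv₄, g₁, g₂, mul_assoc, left_eq_mul, ← mul_assoc, ← sq, hs₁, one_mul] at f₂
        rw [f₂, one_mul] at f₁
        exact ⟨f₁, f₂⟩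
  all_goals try simp only [Finset.mem_filter, Finset.mem_univ, true_and]
  · exact fun p hp => ⟨by rw [smul_smul_comm b_mul_v₁, hp.1], by rw [smul_smul_comm c_mul_v₁, hp.2]⟩
  · exact fun p hp => ⟨by rw [smul_smul_comm b_mul_v₂, hp.1], by rw [smul_smul_comm c_mul_v₂, hp.2]⟩
  · exact fun p => invol_smul_smul _ _ p
  · exact fun p => invol_smul_smul _ _ p
  · exact fun p => smul_smul_comm v₁_mul_v₂ p
  · intro p hp
    rw [hv₁, z₁_conj_nv₁, z₂_conj_nv₁, cocycle_apply_smul_of_comm hu b_mul_v₁ hp.1,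
      cocycle_apply_smul_of_comm hu c_mul_v₁ hp.2]
    ring
  · intro p hp
    rw [hv₂, z₁_conj_nv₂, z₂_conj_nv₂, cocycle_apply_smul_of_comm hu b_mul_v₂ hp.1,
      cocycle_apply_smul_of_comm hu c_mul_v₂ hp.2]
    ring
  · intro p hp
    rw [hv₁, (conj_nv₁_apply_zero _).1, (conj_nv₁_apply_zero _).2,
      cocycle_apply_smul_of_comm hu b_mul_v₁ hp.1, cocycle_apply_smul_of_comm hu c_mul_v₁ hp.2]
  · intro p hp
    rw [hv₂, (conj_nv₂_apply_zero _).1, (conj_nv₂_apply_zero _).2,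
      cocycle_apply_smul_of_comm hu b_mul_v₂ hp.1, cocycle_apply_smul_of_comm hu c_mul_v₂ hp.2]
  · intro p hp
    rw [hv₁, (conj_nv₁_apply_zero _).1, (conj_nv₁_apply_zero _).2,
      cocycle_apply_smul_of_comm hu b_mul_v₁ hp.1, cocycle_apply_smul_of_comm hu c_mul_v₁ hp.2]
  · intro p hp
    rw [hv₂, (conj_nv₂_apply_zero _).1, (conj_nv₂_apply_zero _).2,
      cocycle_apply_smul_of_comm hu b_mul_v₂ hp.1, cocycle_apply_smul_of_comm hu c_mul_v₂ hp.2]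
  · intro p hp h
    have key : ¬ (m p 1 0 = 0 ∧ m p 2 0 = 0) := fun h' => h (by rw [h'.1, h'.2]; simp)
    refine ⟨fun h' => key ?_, fun h' => key ?_, fun h' => key ?_⟩
    · exact apply_zero_of_conj_nv₁ _ (by rw [← hv₁, h'])
    · exact apply_zero_of_conj_nv₂ _ (by rw [← hv₂, h'])
    · exact apply_zero_of_conj_nv₁_nv₂ _ (by rw [← hv₂, ← hv₁, h'])

theorem sum_eq_zero (hu : ∀ g h p, u (g * h) p = u g (h • p) * u h p)
    (hm : ∀ (g : H) p, m (g • p) = (g : M5) * m p * (g⁻¹ : H)) {ζb ζc : P → kˣ}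
    (hζb : ∀ p, ζb p ^ 2 = u b p) (hζc : ∀ p, ζc p ^ 2 = u c p) :
    ∑ p, (z₁ (m p) * sgn (ζb p * ζb (b • p)) + z₂ (m p) * sgn (ζc p * ζc (c • p)) +
      z₃ (m p) * sgn (ζc p * ζb (c • p) / (ζb p * ζc (b • p)))) = 0 := by
  classical
  have hmb : ∀ p, m (b • p) = conj nb (m p) := fun p => by rw [hm]; exact invol_conj _ _ _
  have hmc : ∀ p, m (c • p) = conj nc (m p) := fun p => by rw [hm]; exact invol_conj _ _ _
  have hbb : ∀ p : P, b • b • p = p := fun p => invol_smul_smul _ _ p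
  have hcc : ∀ p : P, c • c • p = p := fun p => invol_smul_smul _ _ p
  have hbc : ∀ p : P, b • c • p = c • b • p := fun p => smul_smul_comm b_mul_c p
  have hs₁ : ∀ p, (ζb p * ζb (b • p)) ^ 2 = 1 := fun p => by
    rw [mul_pow, hζb, hζb, mul_comm, ← hu, b, invol_mul_self, cocycle_one hu]
  have hs₂ : ∀ p, (ζc p * ζc (c • p)) ^ 2 = 1 := fun p => by
    rw [mul_pow, hζc, hζc, mul_comm, ← hu, c, invol_mul_self, cocycle_one hu]
  have hs₃ : ∀ p, (ζc p * ζb (c • p) / (ζb p * ζc (b • p))) ^ 2 = 1 := fun p => by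
    rw [div_pow, mul_pow, mul_pow, hζc, hζc, hζb, hζb, mul_comm, ← hu, mul_comm, ← hu, b_mul_c,
      div_self']
  rw [sum_eq_sum_fixed_of_cocycle (b • ·) (c • ·) hbb hcc hbc, ← sum_fixed_eq_zero hu hm]
  · refine Finset.sum_congr rfl fun p hp => ?_
    obtain ⟨hb, hc⟩ := (Finset.mem_filter.1 hp).2
    rw [hb, hc, ← sq, ← sq, hζb, hζc]
  · exact fun p => by rw [hmb, hmc, z₁_conj_nb]
  · exact fun p => by rw [hmb, hmc, z₂_conj_nc]
  · exact fun p h => by rw [hmc, z₁_conj_nc _ (by rw [← hmb, h])]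
  · exact fun p h => by rw [hmb, z₂_conj_nb _ (by rw [← hmc, h])]
  · exact fun p h => by rw [hmb, z₃_conj_nb _ (by rw [← hmb, ← hmc, h])]
  · exact fun p => by rw [hbb, mul_comm]
  · exact fun p => by rw [hcc, mul_comm]
  · intro p
    rw [← sgn_mul (hs₃ _) (hs₃ _), add_comm (sgn (ζb p * _)), ← sgn_div (hs₁ _) (hs₁ _), hbb, hbc]
    congr 1
    rw [div_mul_div_comm, div_eq_div_iff_mul_eq_mul]
    ac_rfl
  · intro p
    rw [← sgn_mul (hs₃ _) (hs₃ _), ← sgn_div (hs₂ _) (hs₂ _), hcc, ← hbc]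
    congr 1
    rw [div_mul_div_comm, div_eq_div_iff_mul_eq_mul]
    ac_rfl
  · exact fun p hb hc => by rw [hb, hc, mul_comm, div_self', sgn_one]

end Core
/-- Reduction modulo `2`. -/
abbrev red : ZMod 4 →+* ZMod 2 := ZMod.castHom (show (2 : ℕ) ∣ 4 by norm_num) (ZMod 2)

/-- The additive embedding `x ↦ 2 x`. -/
def dbl : ZMod 2 →+ ZMod 4 where
  toFun x := 2 * x.val
  map_zero' := by decide
  map_add' := by decide

/-- A left inverse of `dbl`. -/
def half (x : ZMod 4) : ZMod 2 := (x.val / 2 : ℕ)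

theorem half_dbl (x : ZMod 2) : half (dbl x) = x := by revert x; decide

/-- The lift of `nb` with entries `0` and `1`. -/
def nb4 : Matrix (Fin 5) (Fin 5) (ZMod 4) :=
  !![0,0,0,0,0; 0,0,0,1,0; 0,0,0,0,1; 0,0,0,0,0; 0,0,0,0,0]
/-- The lift of `nc` with entries `0` and `1`. -/
def nc4 : Matrix (Fin 5) (Fin 5) (ZMod 4) :=
  !![0,0,0,0,0; 0,0,0,1,1; 0,0,0,1,0; 0,0,0,0,0; 0,0,0,0,0]

section Matrices
variable {l m n : Type*}

theorem mul_map_dbl [Fintype m] (A : Matrix l m (ZMod 4)) (X : Matrix m n (ZMod 2)) :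
    A * X.map dbl = (A.map red * X).map dbl := by
  have h : ∀ a x, a * dbl x = dbl (red a * x) := by decide
  ext i j
  simp only [Matrix.mul_apply, Matrix.map_apply, h, map_sum]

theorem map_dbl_mul [Fintype m] (X : Matrix l m (ZMod 2)) (A : Matrix m n (ZMod 4)) :
    X.map dbl * A = (X * A.map red).map dbl := by
  have h : ∀ a x, dbl x * a = dbl (x * red a) := by decide
  ext i j
  simp only [Matrix.mul_apply, Matrix.map_apply, h, map_sum]

theorem map_red_map_dbl (X : Matrix n n (ZMod 2)) : (X.map dbl).map red = 0 := by
  have h : ∀ x, red (dbl x) = 0 := by decide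
  ext i j
  simp only [Matrix.map_apply, h, Matrix.zero_apply]

theorem exists_eq_add_map_dbl {A B : Matrix n n (ZMod 4)} (h : A.map red = B.map red) :
    ∃ X : Matrix n n (ZMod 2), A = B + X.map dbl := by
  have h' : ∀ a b, red a = red b → a = b + dbl (half (a - b)) := by decide
  exact ⟨(A - B).map half, Matrix.ext fun i j => h' _ _ (congrFun₂ h i j)⟩

theorem map_dbl_injective {X Y : Matrix n n (ZMod 2)} (h : X.map dbl = Y.map dbl) : X = Y :=
  Matrix.map_injective (Function.LeftInverse.injective half_dbl) h

theorem map_add_dbl (X Y : Matrix n n (ZMod 2)) : (X + Y).map dbl = X.map dbl + Y.map dbl :=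
  Matrix.map_add _ (map_add dbl) X Y

variable [DecidableEq n]

theorem exists_eq_one_add {M : Matrix n n (ZMod 4)} (hM : M.map red = 1) :
    ∃ X : Matrix n n (ZMod 2), M = 1 + X.map dbl := by
  apply exists_eq_add_map_dbl
  rw [hM, Matrix.map_one _ (map_zero _) (map_one _)]

variable (f : Fin 5 ↪ n) {R : Type*} [CommRing R]

/-- The matrix of the coordinate inclusion `f`. -/
def incl (R : Type*) [CommRing R] : Matrix n (Fin 5) R := (1 : Matrix n n R).submatrix id f

theorem incl_map_red : (incl f (ZMod 4)).map red = incl f (ZMod 2) := by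
  ext i j
  simp only [incl, Matrix.map_apply, Matrix.submatrix_apply, Matrix.one_apply]
  split_ifs <;> simp

/-- Extension of a matrix by the identity. -/
def ext1 (h : Matrix (Fin 5) (Fin 5) R) : Matrix n n R := 1 + incl f R * (h - 1) * (incl f R)ᵀ

theorem ext1_one : ext1 f (1 : Matrix (Fin 5) (Fin 5) R) = 1 := by simp [ext1]

theorem ext1_one_add_map_dbl (h : M5) : ext1 f (1 + h.map dbl) =
    1 + (incl f (ZMod 2) * h * (incl f (ZMod 2))ᵀ).map dbl := by
  rw [ext1, add_sub_cancel_left, mul_map_dbl, map_dbl_mul, incl_map_red, Matrix.transpose_map,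
    incl_map_red]

variable [Fintype n]

theorem incl_transpose_mul : (incl f R)ᵀ * incl f R = 1 := by
  ext i j
  simp [incl, Matrix.mul_apply, Matrix.one_apply]

/-- The `5 × 5` corner of a matrix. -/
def corner (X : Matrix n n R) : Matrix (Fin 5) (Fin 5) R := (incl f R)ᵀ * X * incl f R

theorem corner_add (X Y : Matrix n n R) : corner f (X + Y) = corner f X + corner f Y := by
  simp [corner, Matrix.mul_add, Matrix.add_mul]

theorem ext1_mul_incl (h : Matrix (Fin 5) (Fin 5) R) : ext1 f h * incl f R = incl f R * h := by
  rw [ext1, Matrix.add_mul, Matrix.one_mul, Matrix.mul_assoc _ _ (incl f R), incl_transpose_mul,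
    Matrix.mul_one, Matrix.mul_sub, Matrix.mul_one, add_sub_cancel]

theorem incl_transpose_mul_ext1 (h : Matrix (Fin 5) (Fin 5) R) :
    (incl f R)ᵀ * ext1 f h = h * (incl f R)ᵀ := by
  rw [ext1, Matrix.mul_add, Matrix.mul_one, ← Matrix.mul_assoc, ← Matrix.mul_assoc,
    incl_transpose_mul, Matrix.one_mul, Matrix.sub_mul, Matrix.one_mul, add_sub_cancel]

theorem corner_ext1_mul (h : Matrix (Fin 5) (Fin 5) R) (X : Matrix n n R) :
    corner f (ext1 f h * X) = h * corner f X := by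
  rw [corner, corner, ← Matrix.mul_assoc, incl_transpose_mul_ext1, Matrix.mul_assoc,
    Matrix.mul_assoc, Matrix.mul_assoc]

theorem corner_mul_ext1 (h : Matrix (Fin 5) (Fin 5) R) (X : Matrix n n R) :
    corner f (X * ext1 f h) = corner f X * h := by
  rw [corner, corner, ← Matrix.mul_assoc, Matrix.mul_assoc _ _ (incl f R), ext1_mul_incl,
    ← Matrix.mul_assoc]

theorem ext1_mul (g h : Matrix (Fin 5) (Fin 5) R) : ext1 f (g * h) = ext1 f g * ext1 f h := by
  conv_rhs => rw [ext1, add_mul, one_mul, Matrix.mul_assoc, incl_transpose_mul_ext1,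
    ← Matrix.mul_assoc, Matrix.mul_assoc _ _ h]
  rw [ext1, ext1, add_assoc, ← Matrix.add_mul, ← Matrix.mul_add, Matrix.sub_mul, Matrix.one_mul,
    sub_add_sub_comm, add_comm h, ← sub_add_sub_comm, sub_self, add_zero]

theorem ext1_map_red (h : Matrix (Fin 5) (Fin 5) (ZMod 4)) :
    (ext1 f h).map red = ext1 f (h.map red) := by
  rw [ext1, ext1, ← RingHom.mapMatrix_apply, map_add, map_one, RingHom.mapMatrix_apply,
    Matrix.map_mul, Matrix.map_mul, Matrix.transpose_map, incl_map_red,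
    Matrix.map_sub _ (map_sub _), Matrix.map_one _ (map_zero _) (map_one _)]

theorem corner_incl_mul (h : M5) :
    corner f (incl f (ZMod 2) * h * (incl f (ZMod 2))ᵀ) = h := by
  rw [corner, Matrix.mul_assoc, Matrix.mul_assoc _ _ (incl f _), incl_transpose_mul, Matrix.mul_one,
    ← Matrix.mul_assoc, incl_transpose_mul, Matrix.one_mul]

/-- Extension by the identity as a homomorphism `GL₅ → GLₙ`. -/
def ext1Hom : GL (Fin 5) (ZMod 2) →* GL n (ZMod 2) :=
  Units.map { toFun := ext1 f, map_one' := ext1_one f, map_mul' := ext1_mul f }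

theorem ext1Hom_val (g : GL (Fin 5) (ZMod 2)) : (ext1Hom f g : Matrix n n (ZMod 2)) = ext1 f g :=
  rfl

/-- The corner of the matrix `X` such that `M = 1 + 2 X`. -/
def tau (M : Matrix n n (ZMod 4)) : M5 := corner f ((M - 1).map half)

theorem tau_one_add (X : Matrix n n (ZMod 2)) : tau f (1 + X.map dbl) = corner f X := by
  rw [tau, add_sub_cancel_left, Matrix.map_map]
  congr 1
  ext i j
  exact half_dbl _

theorem tau_mul {M M' : Matrix n n (ZMod 4)} (hM : M.map red = 1) (hM' : M'.map red = 1) :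
    tau f (M * M') = tau f M + tau f M' := by
  obtain ⟨X, rfl⟩ := exists_eq_one_add hM
  obtain ⟨Y, rfl⟩ := exists_eq_one_add hM'
  rw [add_mul, one_mul, map_dbl_mul, hM', mul_one, add_assoc, add_comm (Y.map _), ← map_add_dbl,
    tau_one_add, tau_one_add, tau_one_add, corner_add]

theorem tau_one : tau f (1 : Matrix n n (ZMod 4)) = 0 := by
  have h1 : (1 : Matrix n n (ZMod 4)).map red = 1 := Matrix.map_one _ (map_zero _) (map_one _)
  have h := tau_mul f h1 h1
  rwa [mul_one, left_eq_add] at h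

theorem tau_conj {A : GL n (ZMod 4)} {g : GL (Fin 5) (ZMod 2)} {M : Matrix n n (ZMod 4)}
    (hA : GeneralLinearGroup.map red A = ext1Hom f g) (hM : M.map red = 1) :
    tau f (A * M * (A⁻¹ : GL n (ZMod 4))) = (g : M5) * tau f M * (g⁻¹ : GL (Fin 5) (ZMod 2)) := by
  have h1 : (A : Matrix n n (ZMod 4)).map red = ext1 f g := congrArg Units.val hA
  have h2 : ((A⁻¹ : GL n (ZMod 4)) : Matrix n n (ZMod 4)).map red
      = ext1 f (g⁻¹ : GL (Fin 5) (ZMod 2)) := by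
    rw [← ext1Hom_val, map_inv, ← hA, ← map_inv]
    rfl
  obtain ⟨X, rfl⟩ := exists_eq_one_add hM
  rw [mul_add, mul_one, add_mul, Units.mul_inv, mul_map_dbl, map_dbl_mul, tau_one_add, tau_one_add,
    h1, h2, corner_mul_ext1, corner_ext1_mul]

theorem z_identity (x y : M5) :
    z₁ (nb + ((1 + nb) * x + x * (1 + nb))) + z₂ (nc + ((1 + nc) * y + y * (1 + nc))) +
      z₃ ((1 + nb) * ((1 + nc) *
        ((1 + nb) * y + x * (1 + nc) + ((1 + nc) * x + y * (1 + nb))))) = 1 := by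
  simp [z₁, z₂, z₃, nb, nc, Matrix.mul_apply, Fin.sum_univ_succ, Matrix.one_apply]
  grind

theorem tau_relation {A B : GL n (ZMod 4)} (hA : GeneralLinearGroup.map red A = ext1Hom f b)
    (hB : GeneralLinearGroup.map red B = ext1Hom f c) :
    z₁ (tau f (A * A : GL n (ZMod 4))) + z₂ (tau f (B * B : GL n (ZMod 4))) +
      z₃ (tau f ((B * A)⁻¹ * (A * B) : GL n (ZMod 4))) = 1 := by
  have rb : (1 + nb4).map red = 1 + nb := by decide
  have rc : (1 + nc4).map red = 1 + nc := by decide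
  have hb2 : (1 + nb4) * (1 + nb4) = 1 + nb.map dbl := by decide
  have hc2 : (1 + nc4) * (1 + nc4) = 1 + nc.map dbl := by decide
  have hbc : (1 + nb4) * (1 + nc4) = (1 + nc4) * (1 + nb4) := by decide
  have hrA : (A : Matrix n n (ZMod 4)).map red = ext1 f (1 + nb) := congrArg Units.val hA
  have hrB : (B : Matrix n n (ZMod 4)).map red = ext1 f (1 + nc) := congrArg Units.val hB
  obtain ⟨X, hX⟩ := exists_eq_add_map_dbl (hrA.trans (by rw [ext1_map_red, rb]) :
    (A : Matrix n n (ZMod 4)).map red = (ext1 f (1 + nb4)).map red)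
  obtain ⟨Y, hY⟩ := exists_eq_add_map_dbl (hrB.trans (by rw [ext1_map_red, rc]) :
    (B : Matrix n n (ZMod 4)).map red = (ext1 f (1 + nc4)).map red)
  have hmul : ∀ (N N' : Matrix (Fin 5) (Fin 5) (ZMod 4)) (S S' : Matrix n n (ZMod 2)),
      (ext1 f N + S.map dbl) * (ext1 f N' + S'.map dbl) =
        ext1 f (N * N') + (ext1 f (N.map red) * S' + S * ext1 f (N'.map red)).map dbl := by
    intro N N' S S'
    rw [add_mul, mul_add, mul_add, mul_map_dbl, map_dbl_mul, map_dbl_mul, map_red_map_dbl, mul_zero,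
      ext1_mul, ext1_map_red, ext1_map_red, map_add_dbl]
    simp [add_assoc]
  have hA2 : tau f (A * A : GL n (ZMod 4)) =
      nb + ((1 + nb) * corner f X + corner f X * (1 + nb)) := by
    rw [Units.val_mul, hX, hmul, hb2, ext1_one_add_map_dbl, add_assoc, ← map_add_dbl, tau_one_add,
      corner_add, corner_add, corner_incl_mul, corner_ext1_mul, corner_mul_ext1, rb]
  have hB2 : tau f (B * B : GL n (ZMod 4)) =
      nc + ((1 + nc) * corner f Y + corner f Y * (1 + nc)) := by
    rw [Units.val_mul, hY, hmul, hc2, ext1_one_add_map_dbl, add_assoc, ← map_add_dbl, tau_one_add,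
      corner_add, corner_add, corner_incl_mul, corner_ext1_mul, corner_mul_ext1, rc]
  have hC : (((B * A)⁻¹ * (A * B) : GL n (ZMod 4)) : Matrix n n (ZMod 4)).map red = 1 := by
    have : GeneralLinearGroup.map red ((B * A)⁻¹ * (A * B)) = (1 : GL n (ZMod 2)) := by
      rw [map_mul, map_inv, map_mul, map_mul, hA, hB, ← map_mul, ← map_mul, b_mul_c, inv_mul_cancel]
    exact congrArg Units.val this
  obtain ⟨T, hT⟩ := exists_eq_one_add hC
  have hAB : (B : Matrix n n (ZMod 4)) * A * (1 + T.map dbl) = A * B := by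
    rw [← hT, ← Units.val_mul, ← Units.val_mul, ← Units.val_mul, mul_inv_cancel_left]
  have hBA : ((B : Matrix n n (ZMod 4)) * A).map red = ext1 f (1 + nc) * ext1 f (1 + nb) := by
    rw [Matrix.map_mul, hrA, hrB]
  rw [mul_add, mul_one, mul_map_dbl, hBA, hX, hY, hmul, hmul, hbc, add_assoc, add_right_inj,
    ← map_add_dbl, rb, rc] at hAB
  have hT' : (1 + nc) * ((1 + nb) * corner f T) = (1 + nb) * corner f Y + corner f X * (1 + nc) +
      ((1 + nc) * corner f X + corner f Y * (1 + nb)) := by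
    have := congrArg (corner f) (map_dbl_injective hAB)
    simp only [corner_add, corner_ext1_mul, corner_mul_ext1, Matrix.mul_assoc] at this
    rw [← this, add_right_comm, CharTwo.add_self_eq_zero, zero_add]
  rw [hA2, hB2, hT, tau_one_add]
  rw [← z_identity (corner f X) (corner f Y), ← hT', ← mul_assoc (1 + nc),
    one_add_mul_self_of_sq_eq_zero nc_sq, one_mul, ← mul_assoc,
    one_add_mul_self_of_sq_eq_zero nb_sq, one_mul]

end Matrices

section Primes
variable {G R : Type*} [Group G] [CommRing R] [MulSemiringAction G R]

theorem prime_smul (g : G) {r : R} (hr : Prime r) : Prime (g • r) :=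
  (MulEquiv.prime_iff (MulSemiringAction.toRingEquiv G R g)).2 hr

theorem associated_smul (g : G) {r s : R} (h : Associated r s) : Associated (g • r) (g • s) :=
  h.map (MulSemiringAction.toRingHom G R g)

theorem multiplicity_smul (g : G) (r s : R) :
    multiplicity (g • r) (g • s) = multiplicity r s :=
  multiplicity_map_eq (MulSemiringAction.toRingEquiv G R g)

/-- The primes dividing a `G`-invariant element, up to units, when all units are constants. -/
theorem exists_prime_system.{w} {k : Type*} [Field k] {R : Type w} [CommRing R] [IsDomain R]
    [UniqueFactorizationMonoid R] [Algebra k R] [MulSemiringAction G R] [SMulCommClass G k R]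
    (hunit : ∀ r : R, IsUnit r → ∃ x : k, algebraMap k R x = r) {Δ : R} (hΔ : Δ ≠ 0)
    (hG : ∀ g : G, g • Δ = Δ) :
    ∃ (P : Type w) (_ : Fintype P) (_ : MulAction G P) (π : P → R) (u : G → P → kˣ),
      (∀ p, Prime (π p)) ∧ (∀ g p, g • π p = algebraMap k R (u g p) * π (g • p)) ∧
      (∀ g h p, u (g * h) p = u g (h • p) * u h p) ∧ (∀ p q, π p ∣ π q → p = q) ∧
      ∀ r, Prime r → r ∣ Δ → ∃ p, Associated r (π p) := by
  classical
  let D := {a : Associates R // a ∣ Associates.mk Δ}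
  let P := {a : D // Irreducible a.1}
  have hfin : Fintype D :=
    UniqueFactorizationMonoid.fintypeSubtypeDvd _ (Associates.mk_ne_zero.2 hΔ)
  let π : P → R := fun p => Quot.out p.1.1
  have hπ : ∀ p : P, Associates.mk (π p) = p.1.1 := fun p => Quot.out_eq _
  have hprime : ∀ p, Prime (π p) := fun p =>
    UniqueFactorizationMonoid.irreducible_iff_prime.1
      (Associates.irreducible_mk.1 (by rw [hπ]; exact p.2))
  have hdvd : ∀ p, π p ∣ Δ := fun p => Associates.mk_dvd_mk.1 (by rw [hπ]; exact p.1.2)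
  have hex : ∀ r, Prime r → r ∣ Δ → ∃ p, Associated r (π p) := fun r hr hrΔ => by
    let p : P := ⟨⟨Associates.mk r, Associates.mk_dvd_mk.2 hrΔ⟩,
      Associates.irreducible_mk.2 hr.irreducible⟩
    exact ⟨p, Associates.mk_eq_mk_iff_associated.1 (hπ p).symm⟩
  have hinj : ∀ p q, Associated (π p) (π q) → p = q := fun p q h =>
    Subtype.ext (Subtype.ext (by rw [← hπ, ← hπ]; exact Associates.mk_eq_mk_iff_associated.2 h))
  choose a ha using fun (g : G) (p : P) => hex (g • π p) (prime_smul g (hprime p))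
    (by rw [← hG g]; exact map_dvd (MulSemiringAction.toRingHom G R g) (hdvd p))
  let _ : MulAction G P :=
    { smul := a
      one_smul := fun p => hinj _ _ ((ha 1 p).symm.trans (by rw [one_smul]))
      mul_smul := fun g h p => hinj _ _ ((ha (g * h) p).symm.trans
        (by rw [mul_smul]; exact (associated_smul g (ha h p)).trans (ha g (a h p)))) }
  have hu : ∀ (g : G) (p : P), ∃ u : kˣ, g • π p = algebraMap k R u * π (g • p) := by
    intro g p
    obtain ⟨v, hv⟩ := (ha g p).symm
    obtain ⟨x, hx⟩ := hunit v v.isUnit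
    have hx0 : x ≠ 0 := by
      rintro rfl
      exact v.ne_zero (by rw [← hx, map_zero])
    exact ⟨Units.mk0 x hx0, by rw [Units.val_mk0, hx, mul_comm]; exact hv.symm⟩
  choose u hu using hu
  refine ⟨P, inferInstance, inferInstance, π, u, hprime, hu, fun g h p => ?_,
    fun p q h => hinj _ _ ((hprime p).associated_of_dvd (hprime q) h), hex⟩
  have h1 := hu (g * h) p
  rw [mul_smul, hu h p, smul_mul', smul_algebraMap, hu g, mul_smul, ← mul_assoc, ← map_mul] at h1
  have h2 := (algebraMap k R).injective (mul_right_cancel₀ (hprime _).ne_zero h1)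
  exact Units.ext (by rw [← h2, Units.val_mul, mul_comm])

end Primes
theorem sgn_val {k : Type*} [Monoid k] (x : kˣ) : sgn (x : k) = sgn x := by
  unfold sgn
  congr 1
  exact propext Units.val_eq_one

theorem sgn_map {k l : Type*} [Monoid k] [Monoid l] {f : k →* l} (hf : Function.Injective f)
    (x : k) : sgn (f x) = sgn x := by
  unfold sgn
  congr 1
  rw [← map_one f, hf.eq_iff]

theorem sgn_mul₀ {k : Type*} [Field k] {x y : k} (hx : x ^ 2 = 1) (hy : y ^ 2 = 1) :
    sgn (x * y) = sgn x + sgn y := by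
  have hx0 : x ≠ 0 := by rintro rfl; simp at hx
  have hy0 : y ≠ 0 := by rintro rfl; simp at hy
  have := sgn_mul (x := Units.mk0 x hx0) (y := Units.mk0 y hy0) (Units.ext (by simpa using hx))
    (Units.ext (by simpa using hy))
  rwa [← sgn_val, ← sgn_val, ← sgn_val] at this

/-- A group `Γ` acting on a field `Ω` through `φ : Γ → G` on a factorial subring whose units are
constants, such that the fixed field of the kernel of `φ` is the field of fractions of this ring, up
to roots of odd order. -/
structure IsKummerSetting (k : Type*) {G R Ω Γ : Type*} [Group G] [Field k] [CommRing R]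
    [Algebra k R] [MulSemiringAction G R] [Field Ω] [Group Γ] [MulSemiringAction Γ Ω]
    (i : R →+* Ω) (φ : Γ →* G) : Prop where
  injective : Function.Injective i
  smul_map : ∀ γ r, γ • i r = i (φ γ • r)
  exists_algebraMap : ∀ r : R, IsUnit r → ∃ x : k, algebraMap k R x = r
  exists_pow : ∀ x : Ω, (∀ w, φ w = 1 → w • x = x) →
    ∃ (q : ℕ) (r s : R), Odd q ∧ s ≠ 0 ∧ i s * x ^ q = i r

namespace IsKummerSetting

variable {k G R Ω Γ : Type*} [Group G] [Field k] [CommRing R]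
  [Algebra k R] [MulSemiringAction G R] [Field Ω] [Group Γ] [MulSemiringAction Γ Ω]
  {i : R →+* Ω} {φ : Γ →* G} (hS : IsKummerSetting k i φ)
include hS

theorem map_ne_zero {r : R} (hr : r ≠ 0) : i r ≠ 0 := (map_ne_zero_iff i hS.injective).2 hr

theorem smul_map_of_ker {w : Γ} (hw : φ w = 1) (r : R) : w • i r = i r := by
  rw [hS.smul_map, hw, one_smul]

theorem smul_algebraMap [SMulCommClass G k R] (γ : Γ) (x : k) :
    γ • i (algebraMap k R x) = i (algebraMap k R x) := by
  rw [hS.smul_map, _root_.smul_algebraMap]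

theorem sq_smul_div {w : Γ} (hw : φ w = 1) {y : Ω} {d : R} (hy : y ^ 2 = i d) (hd : d ≠ 0) :
    (w • y / y) ^ 2 = 1 := by
  rw [div_pow, ← smul_pow', hy, hS.smul_map_of_ker hw, div_self (hS.map_ne_zero hd)]

theorem ne_zero_of_sq {y : Ω} {d : R} (hy : y ^ 2 = i d) (hd : d ≠ 0) : y ≠ 0 := by
  rintro rfl
  exact hS.map_ne_zero hd (by rw [← hy, zero_pow two_ne_zero])

theorem even_multiplicity [IsDomain R] [UniqueFactorizationMonoid R] {y : Ω} {d : R}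
    (hy : y ^ 2 = i d) (hd : d ≠ 0) (h : ∀ w, φ w = 1 → w • y = y) {p : R} (hp : Prime p) :
    Even (multiplicity p d) := by
  obtain ⟨q, r, s, hq, hs, hr⟩ := hS.exists_pow y h
  have h1 : s ^ 2 * d ^ q = r ^ 2 := hS.injective (by
    rw [map_mul, map_pow, map_pow, map_pow, ← hy, ← hr]
    ring)
  have hr0 : r ≠ 0 := by
    rintro rfl
    have : s ^ 2 * d ^ q ≠ 0 := by positivity
    exact this (by rw [h1, zero_pow two_ne_zero])
  have hf : ∀ {x : R}, x ≠ 0 → FiniteMultiplicity p x := FiniteMultiplicity.of_prime_left hp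
  have h2 := congrArg (multiplicity p) h1
  rw [multiplicity_mul hp (hf (by positivity)), (hf hs).multiplicity_pow hp,
    (hf hd).multiplicity_pow hp, (hf hr0).multiplicity_pow hp] at h2
  obtain ⟨t, rfl⟩ := hq
  rw [even_iff_two_dvd]
  have h3 : multiplicity p d =
      2 * (multiplicity p r - multiplicity p s - t * multiplicity p d) := by
    have : (2 * t + 1) * multiplicity p d = 2 * (t * multiplicity p d) + multiplicity p d := by ring
    omega
  exact ⟨_, h3⟩

omit hS in
theorem sgn_smul_mul_div {w : Γ} {x y : Ω} (hx : (w • x / x) ^ 2 = 1) (hy : (w • y / y) ^ 2 = 1) :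
    sgn (w • (x * y) / (x * y)) = sgn (w • x / x) + sgn (w • y / y) := by
  rw [smul_mul', mul_div_mul_comm, sgn_mul₀ hx hy]

omit hS in
theorem sgn_smul_div_congr {w : Γ} {x y : Ω} (h : x ^ 2 = y ^ 2) :
    sgn (w • x / x) = sgn (w • y / y) := by
  rcases sq_eq_sq_iff_eq_or_eq_neg.1 h with rfl | rfl
  · rfl
  · rw [smul_neg, neg_div_neg_eq]

theorem sgn_smul_div_eq_sum [IsAlgClosed k] [IsAlgClosed Ω] [IsDomain R]
    [UniqueFactorizationMonoid R] [SMulCommClass G k R] {P : Type*}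
    [Fintype P] {π : P → R} (hπ : ∀ p, Prime (π p)) (hinj : ∀ p q, π p ∣ π q → p = q) {s : P → Ω}
    (hs : ∀ p, s p ^ 2 = i (π p)) {w : Γ} (hw : φ w = 1) (d : R) :
    d ≠ 0 → (∀ r, Prime r → r ∣ d → ∃ p, Associated r (π p)) → ∀ y : Ω, y ^ 2 = i d →
      sgn (w • y / y) = ∑ p, (multiplicity (π p) d : ZMod 2) * sgn (w • s p / s p) := by
  classical
  have hunit : ∀ d : R, IsUnit d → ∀ y : Ω, y ^ 2 = i d → sgn (w • y / y) = 0 := by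
    intro d hd y hy
    obtain ⟨x, rfl⟩ := hS.exists_algebraMap d hd
    obtain ⟨z, rfl⟩ := IsAlgClosed.exists_pow_nat_eq x two_pos
    have hz : i (algebraMap k R z) ≠ 0 := by
      have := (hd.map i).ne_zero
      rw [map_pow, map_pow] at this
      exact fun h => this (by rw [h, zero_pow two_ne_zero])
    rw [sgn_smul_div_congr (y := i (algebraMap k R z)) (by rw [hy, map_pow, map_pow]),
      hS.smul_algebraMap, div_self hz, sgn_one]
  induction d using UniqueFactorizationMonoid.induction_on_prime with
  | h₁ => exact fun h => absurd rfl h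
  | h₂ d hd =>
    intro _ _ y hy
    rw [hunit d hd y hy]
    refine (Finset.sum_eq_zero fun p _ => ?_).symm
    rw [multiplicity_of_isUnit_right (hπ p).not_isUnit hd, Nat.cast_zero, zero_mul]
  | h₃ a r ha hr ih =>
    intro _ hdvd y hy
    obtain ⟨p₀, hp₀⟩ := hdvd r hr (dvd_mul_right _ _)
    obtain ⟨v, hv⟩ := hp₀.symm
    obtain ⟨x, hx⟩ := IsAlgClosed.exists_pow_nat_eq (i a) two_pos
    obtain ⟨z, hz⟩ := IsAlgClosed.exists_pow_nat_eq (i v) two_pos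
    have e : y ^ 2 = (s p₀ * (z * x)) ^ 2 := by
      rw [hy, mul_pow, mul_pow, hx, hz, hs, ← hv, map_mul, map_mul, mul_assoc]
    have h1 := hS.sq_smul_div hw (hs p₀) (hπ p₀).ne_zero
    have h2 := hS.sq_smul_div hw hz v.ne_zero
    have h3 := hS.sq_smul_div hw hx ha
    rw [sgn_smul_div_congr e, sgn_smul_mul_div h1 (by
        rw [smul_mul', mul_div_mul_comm, mul_pow, h2, h3, mul_one]), sgn_smul_mul_div h2 h3,
      hunit v v.isUnit z hz, zero_add, ih ha (fun r' h h' => hdvd r' h (h'.mul_left _)) x hx]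
    have hm : ∀ p, (multiplicity (π p) (r * a) : ZMod 2) * sgn (w • s p / s p) =
        (if p = p₀ then sgn (w • s p / s p) else 0) +
          (multiplicity (π p) a : ZMod 2) * sgn (w • s p / s p) := by
      intro p
      rw [multiplicity_mul (hπ p) (FiniteMultiplicity.of_prime_left (hπ p)
        (mul_ne_zero hr.ne_zero ha)), Nat.cast_add, add_mul]
      congr 1
      rw [multiplicity_eq_of_associated_right hp₀]
      split_ifs with h
      · rw [h, multiplicity_self, Nat.cast_one, one_mul]
      · rw [multiplicity_eq_zero.2 fun h' => h (hinj _ _ h'), Nat.cast_zero, zero_mul]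
    simp only [hm, Finset.sum_add_distrib, Finset.sum_ite_eq', Finset.mem_univ, if_true]

end IsKummerSetting
theorem multiplicity_prod {R ι : Type*} [CommRing R] [IsDomain R] [WfDvdMonoid R] {p : R}
    (hp : Prime p) (S : Finset ι) {d : ι → R} (hd : ∀ a ∈ S, d a ≠ 0) :
    multiplicity p (∏ a ∈ S, d a) = ∑ a ∈ S, multiplicity p (d a) := by
  classical
  induction S using Finset.induction_on with
  | empty => rw [Finset.prod_empty, Finset.sum_empty,
      multiplicity_of_isUnit_right hp.not_isUnit isUnit_one]
  | insert a S ha ih =>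
    have h : ∀ b ∈ S, d b ≠ 0 := fun b hb => hd b (Finset.mem_insert_of_mem hb)
    rw [Finset.prod_insert ha, Finset.sum_insert ha, multiplicity_mul hp, ih h]
    exact FiniteMultiplicity.of_prime_left hp (mul_ne_zero (hd a (Finset.mem_insert_self a S))
      (Finset.prod_ne_zero_iff.2 h))

theorem sgn_neg_one_pow {k : Type*} [Field k] (h2 : (2 : k) ≠ 0) (t : ZMod 2) :
    sgn ((-1 : k) ^ t.val) = t := by
  have h : (-1 : k) ≠ 1 := fun h => h2 (by rw [← one_add_one_eq_two]; nth_rw 1 [← h]; simp)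
  rcases (by decide : ∀ t : ZMod 2, t = 0 ∨ t = 1) t with rfl | rfl
  · rw [ZMod.val_zero, pow_zero, sgn_one]
  · rw [ZMod.val_one, pow_one]
    exact if_neg h

namespace IsKummerSetting

section
variable {k G R Ω Γ : Type*} [Group G] [Field k] [CommRing R]
  [Algebra k R] [MulSemiringAction G R] [Field Ω] [Group Γ] [MulSemiringAction Γ Ω]
  {i : R →+* Ω} {φ : Γ →* G} (hS : IsKummerSetting k i φ)
include hS

/-- A quadratic character of the kernel of `φ` which comes from a nonzero eigenvector also comes
from a square root of an element of `R`. -/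
theorem exists_sq_eq [IsDomain R] {χ : Γ → ZMod 2} {y : Ω} (hy : y ≠ 0)
    (hχ : ∀ w, φ w = 1 → w • y = (-1) ^ (χ w).val * y) :
    ∃ (x : Ω) (d : R), d ≠ 0 ∧ x ^ 2 = i d ∧ ∀ w, φ w = 1 → w • x = (-1) ^ (χ w).val * x := by
  obtain ⟨q, r, s, hq, hs, hr⟩ := hS.exists_pow (y ^ 2) fun w hw => by
    rw [smul_pow', hχ w hw, mul_pow, ← pow_mul, mul_comm _ 2, pow_mul, neg_one_sq, one_pow, one_mul]
  have hr0 : r ≠ 0 := by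
    rintro rfl
    rw [map_zero] at hr
    exact mul_ne_zero (hS.map_ne_zero hs) (pow_ne_zero _ (pow_ne_zero _ hy)) hr
  refine ⟨i s * y ^ q, s * r, mul_ne_zero hs hr0, ?_, fun w hw => ?_⟩
  · rw [map_mul, ← hr]
    ring
  · rw [smul_mul', hS.smul_map_of_ker hw, smul_pow', hχ w hw, mul_pow, ← pow_mul, mul_comm _ q,
      pow_mul, hq.neg_one_pow]
    ring

end

variable {k R Ω Γ : Type*} [Field k] [CommRing R] [Algebra k R]
  [MulSemiringAction (GL (Fin 5) (ZMod 2)) R] [Field Ω] [Group Γ] [MulSemiringAction Γ Ω]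
  {i : R →+* Ω} {φ : Γ →* GL (Fin 5) (ZMod 2)} (hS : IsKummerSetting k i φ)
include hS

theorem multiplicity_conj [IsDomain R] [UniqueFactorizationMonoid R]
    (hφ : Function.Surjective φ) {τ : Γ → M5}
    (hτ : ∀ γ w, φ w = 1 → τ (γ * w * γ⁻¹) = (φ γ : M5) * τ w * ((φ γ)⁻¹ : GL (Fin 5) (ZMod 2)))
    {y : Fin 5 → Fin 5 → Ω} {d : Fin 5 → Fin 5 → R} (hd : ∀ a a', d a a' ≠ 0)
    (hyd : ∀ a a', y a a' ^ 2 = i (d a a'))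
    (hy : ∀ a a' w, φ w = 1 → w • y a a' = (-1) ^ (τ w a a').val * y a a')
    (g : GL (Fin 5) (ZMod 2)) {p p' : R} (hp : Prime p) (hpp : Associated (g • p) p') :
    (Matrix.of fun a a' => (multiplicity p' (d a a') : ZMod 2)) =
      (g : M5) * (Matrix.of fun a a' => (multiplicity p (d a a') : ZMod 2)) *
        (g⁻¹ : GL (Fin 5) (ZMod 2)) := by
  obtain ⟨γ, rfl⟩ := hφ g
  ext a a'
  have hconj : ∀ X : M5, ((φ γ : M5) * X * ((φ γ)⁻¹ : GL (Fin 5) (ZMod 2))) a a' =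
      ∑ q : Fin 5 × Fin 5,
        (φ γ : M5) a q.1 * ((φ γ)⁻¹ : GL (Fin 5) (ZMod 2)) q.2 a' * X q.1 q.2 := by
    intro X
    simp only [Matrix.mul_apply, Finset.sum_mul, Fintype.sum_prod_type]
    rw [Finset.sum_comm]
    exact Finset.sum_congr rfl fun _ _ => Finset.sum_congr rfl fun _ _ => by ring
  set n : Fin 5 × Fin 5 → ℕ := fun q =>
    ((φ γ : M5) a q.1 * ((φ γ)⁻¹ : GL (Fin 5) (ZMod 2)) q.2 a').val with hn
  have hcast : ∀ q, (n q : ZMod 2) =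
    (φ γ : M5) a q.1 * ((φ γ)⁻¹ : GL (Fin 5) (ZMod 2)) q.2 a' := fun q => ZMod.natCast_zmod_val _
  have hsq : (γ⁻¹ • y a a' * ∏ q, y q.1 q.2 ^ n q) ^ 2 =
      i ((φ γ)⁻¹ • d a a' * ∏ q, d q.1 q.2 ^ n q) := by
    rw [mul_pow, ← smul_pow', hyd, hS.smul_map, map_mul, map_inv, map_prod, ← Finset.prod_pow]
    congr 1
    exact Finset.prod_congr rfl fun q _ => by rw [map_pow, ← hyd, pow_right_comm]
  have hgd : (φ γ)⁻¹ • d a a' ≠ 0 := (smul_ne_zero_iff_ne _).2 (hd a a')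
  have hdn : ∀ q ∈ (Finset.univ : Finset (Fin 5 × Fin 5)), d q.1 q.2 ^ n q ≠ 0 :=
    fun q _ => pow_ne_zero _ (hd _ _)
  have hprod := Finset.prod_ne_zero_iff.2 hdn
  have heven := hS.even_multiplicity hsq (mul_ne_zero hgd hprod) (fun w hw => ?_) hp
  · have h0 := (ZMod.natCast_eq_zero_iff_even).2 heven
    have hf : ∀ {x : R}, x ≠ 0 → FiniteMultiplicity p x := FiniteMultiplicity.of_prime_left hp
    rw [multiplicity_mul hp (hf (mul_ne_zero hgd hprod)), multiplicity_prod hp _ hdn,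
      ← multiplicity_smul (φ γ), smul_inv_smul, ← multiplicity_eq_of_associated_left hpp,
      Nat.cast_add, Nat.cast_sum] at h0
    rw [Matrix.of_apply, hconj, CharTwo.add_eq_zero.1 h0]
    refine Finset.sum_congr rfl fun q _ => ?_
    rw [(hf (hd _ _)).multiplicity_pow hp, Nat.cast_mul, hcast, Matrix.of_apply]
  · have h1 : w • γ⁻¹ • y a a' =
        (-1) ^ (τ (γ * w * γ⁻¹) a a').val * γ⁻¹ • y a a' := by
      have := hy a a' (γ * w * γ⁻¹) (by rw [map_mul, map_mul, hw, mul_one, map_inv, mul_inv_cancel])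
      rw [show w • γ⁻¹ • y a a' = γ⁻¹ • (γ * w * γ⁻¹) • y a a' by
        rw [mul_smul, mul_smul, inv_smul_smul], this, smul_mul', smul_pow', smul_neg, smul_one]
    rw [smul_mul', h1, Finset.smul_prod']
    simp only [smul_pow', hy _ _ w hw, mul_pow, Finset.prod_mul_distrib, ← pow_mul]
    rw [mul_mul_mul_comm, Finset.prod_pow_eq_pow_sum, ← pow_add, Even.neg_one_pow, one_mul]
    rw [← ZMod.natCast_eq_zero_iff_even, Nat.cast_add, Nat.cast_sum, ZMod.natCast_zmod_val,
      hτ γ w hw, hconj, CharTwo.add_eq_zero]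
    exact Finset.sum_congr rfl fun q _ => by
      rw [Nat.cast_mul, hcast, ZMod.natCast_zmod_val, mul_comm]

theorem z_add_z_add_z_eq_zero [IsAlgClosed k] [IsAlgClosed Ω] [IsDomain R]
    [UniqueFactorizationMonoid R] [SMulCommClass (GL (Fin 5) (ZMod 2)) k R] (h2 : (2 : Ω) ≠ 0)
    (hφ : Function.Surjective φ) {τ : Γ → M5}
    (hτ : ∀ γ w, φ w = 1 → τ (γ * w * γ⁻¹) = (φ γ : M5) * τ w * ((φ γ)⁻¹ : GL (Fin 5) (ZMod 2)))
    (hτy : ∀ a a', ∃ y : Ω, y ≠ 0 ∧ ∀ w, φ w = 1 → w • y = (-1) ^ (τ w a a').val * y)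
    {γb γc : Γ} (hb : φ γb = b) (hc : φ γc = c) :
    z₁ (τ (γb * γb)) + z₂ (τ (γc * γc)) + z₃ (τ ((γc * γb)⁻¹ * (γb * γc))) = 0 := by
  have _ := Fintype.ofFinite (GL (Fin 5) (ZMod 2))
  choose y₀ hy₀ hyτ using hτy
  choose y d hd hyd hy using fun a a' => hS.exists_sq_eq (hy₀ a a') (hyτ a a')
  set Δ : R := ∏ g : GL (Fin 5) (ZMod 2), ∏ q : Fin 5 × Fin 5, g • d q.1 q.2 with hΔ
  have hΔ0 : Δ ≠ 0 := Finset.prod_ne_zero_iff.2 fun g _ => Finset.prod_ne_zero_iff.2 fun q _ =>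
    (smul_ne_zero_iff_ne g).2 (hd _ _)
  have hΔG : ∀ g : GL (Fin 5) (ZMod 2), g • Δ = Δ := fun g => by
    simp only [hΔ, Finset.smul_prod', smul_smul]
    exact Equiv.prod_comp (Equiv.mulLeft g) fun h => ∏ q : Fin 5 × Fin 5, h • d q.1 q.2
  have hdΔ : ∀ a a', d a a' ∣ Δ := fun a a' => by
    refine dvd_trans ?_ (Finset.dvd_prod_of_mem _ (Finset.mem_univ 1))
    simp only [one_smul]
    exact Finset.dvd_prod_of_mem (fun q : Fin 5 × Fin 5 => d q.1 q.2) (Finset.mem_univ (a, a'))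
  obtain ⟨P, _, _, π, u, hπ, hgπ, hu, hinj, hex⟩ :=
    exists_prime_system hS.exists_algebraMap hΔ0 hΔG
  choose s hs using fun p => IsAlgClosed.exists_pow_nat_eq (i (π p)) two_pos
  have hs0 : ∀ p, s p ≠ 0 := fun p => hS.ne_zero_of_sq (hs p) (hπ p).ne_zero
  set e : P → M5 := fun p => Matrix.of fun a a' => (multiplicity (π p) (d a a') : ZMod 2) with he
  have heq : ∀ (g : GL (Fin 5) (ZMod 2)) p,
      e (g • p) = (g : M5) * e p * (g⁻¹ : GL (Fin 5) (ZMod 2)) := fun g p => by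
    refine hS.multiplicity_conj hφ hτ hd hyd hy g (hπ p) ?_
    rw [hgπ]
    exact associated_unit_mul_left _ _ ((u g p).isUnit.map (algebraMap k R))
  have hsum : ∀ w, φ w = 1 → τ w = ∑ p, sgn (w • s p / s p) • e p := fun w hw => by
    ext a a'
    have hy0 := hS.ne_zero_of_sq (hyd a a') (hd a a')
    rw [← sgn_neg_one_pow h2 (τ w a a'), ← mul_div_cancel_right₀ ((-1 : Ω) ^ (τ w a a').val) hy0,
      ← hy a a' w hw, hS.sgn_smul_div_eq_sum hπ hinj hs hw (d a a') (hd a a')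
        (fun r hr h => hex r hr (h.trans (hdΔ a a'))) _ (hyd a a'), Matrix.sum_apply]
    exact Finset.sum_congr rfl fun p _ => mul_comm _ _
  have hroot : ∀ γ, ∃ ζ : P → kˣ, (∀ p, ζ p ^ 2 = u (φ γ) p) ∧
      ∀ p, γ • s p = i (algebraMap k R (ζ p)) * s (φ γ • p) := by
    intro γ
    have : ∀ p, ∃ ζ : kˣ, ζ ^ 2 = u (φ γ) p ∧
        γ • s p = i (algebraMap k R ζ) * s (φ γ • p) := by
      intro p
      obtain ⟨z, hz⟩ := IsAlgClosed.exists_pow_nat_eq (u (φ γ) p : k) two_pos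
      have hz0 : z ≠ 0 := by
        rintro rfl
        exact (u (φ γ) p).ne_zero (by rw [← hz, zero_pow two_ne_zero])
      have h1 : (γ • s p) ^ 2 = (i (algebraMap k R z) * s (φ γ • p)) ^ 2 := by
        rw [← smul_pow', hs, hS.smul_map, hgπ, mul_pow, hs, map_mul, ← hz, map_pow, map_pow]
      rcases sq_eq_sq_iff_eq_or_eq_neg.1 h1 with h | h
      · exact ⟨Units.mk0 z hz0, Units.ext hz, h⟩
      · refine ⟨-Units.mk0 z hz0, by rw [neg_sq]; exact Units.ext hz, ?_⟩
        rw [h, Units.val_neg, map_neg, map_neg, neg_mul, Units.val_mk0]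
    choose ζ hζ hζ' using this
    exact ⟨ζ, hζ, hζ'⟩
  obtain ⟨ζb, hζb, hsb⟩ := hroot γb
  obtain ⟨ζc, hζc, hsc⟩ := hroot γc
  rw [hb] at hζb hsb
  rw [hc] at hζc hsc
  have hinj' : Function.Injective (i.comp (algebraMap k R)) := RingHom.injective _
  have hsgn : ∀ (x : kˣ) p, sgn (i (algebraMap k R x) * s p / s p) = sgn x := fun x p => by
    rw [mul_div_cancel_right₀ _ (hs0 p), ← sgn_val x]
    exact sgn_map (f := (i.comp (algebraMap k R)).toMonoidHom) hinj' _
  have hcomp : ∀ p, γb • γc • s p = i (algebraMap k R (ζc p * ζb (c • p) : kˣ)) * s (b • c • p) :=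
    fun p => by
      rw [hsc, smul_mul', hS.smul_algebraMap, hsb, Units.val_mul, map_mul, map_mul, mul_assoc]
  have hcomp' : ∀ p, γc • γb • s p = i (algebraMap k R (ζb p * ζc (b • p) : kˣ)) * s (c • b • p) :=
    fun p => by
      rw [hsb, smul_mul', hS.smul_algebraMap, hsc, Units.val_mul, map_mul, map_mul, mul_assoc]
  have h₁ : ∀ p, sgn ((γb * γb) • s p / s p) = sgn (ζb p * ζb (b • p)) := fun p => by
    rw [← hsgn _ p, mul_smul, hsb, smul_mul', hS.smul_algebraMap, hsb,
      show b • b • p = p from invol_smul_smul _ _ p, Units.val_mul, map_mul, map_mul, mul_assoc]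
  have h₂ : ∀ p, sgn ((γc * γc) • s p / s p) = sgn (ζc p * ζc (c • p)) := fun p => by
    rw [← hsgn _ p, mul_smul, hsc, smul_mul', hS.smul_algebraMap, hsc,
      show c • c • p = p from invol_smul_smul _ _ p, Units.val_mul, map_mul, map_mul, mul_assoc]
  have h₃ : ∀ p, sgn (((γc * γb)⁻¹ * (γb * γc)) • s p / s p) =
      sgn (ζc p * ζb (c • p) / (ζb p * ζc (b • p))) := fun p => by
    rw [← hsgn _ p]
    congr 2
    rw [mul_smul, inv_smul_eq_iff, smul_mul', hS.smul_algebraMap, mul_smul, mul_smul, hcomp,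
      hcomp', smul_smul_comm b_mul_c, ← mul_assoc, ← map_mul, ← map_mul, ← Units.val_mul,
      div_mul_cancel]
  rw [hsum _ (by rw [map_mul, hb]; exact invol_mul_self _ _),
    hsum _ (by rw [map_mul, hc]; exact invol_mul_self _ _),
    hsum _ (by rw [map_mul, map_inv, map_mul, map_mul, hb, hc, b_mul_c, inv_mul_cancel])]
  rw [← sum_eq_zero hu heq hζb hζc]
  simp only [h₁, h₂, h₃, z₁, z₂, z₃, Matrix.sum_apply, Matrix.smul_apply, smul_eq_mul,
    ← Finset.sum_add_distrib]
  exact Finset.sum_congr rfl fun p _ => by ring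

end IsKummerSetting
theorem neg_one_pow_val_add {k : Type*} [Ring k] (a b : ZMod 2) :
    (-1 : k) ^ (a + b).val = (-1) ^ a.val * (-1) ^ b.val := by
  have h : ∀ t : ZMod 2, t = 0 ∨ t = 1 := by decide
  rcases h a with rfl | rfl <;> rcases h b with rfl | rfl <;>
    simp [ZMod.val_one, CharTwo.add_self_eq_zero]

section Galois
variable {K Ω : Type*} [Field K] [Field Ω] [Algebra K Ω]

theorem continuous_of_fixingSubgroup_le {M : Type*} [Group M] {ρ : Gal(Ω/K) →* M}
    {N : IntermediateField K Ω} [FiniteDimensional K N] (h : N.fixingSubgroup ≤ ρ.ker) :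
    Continuous[_, ⊥] ⇑ρ := by
  let _ : TopologicalSpace M := ⊥
  have : DiscreteTopology M := ⟨rfl⟩
  refine continuous_of_continuousAt_one ρ (continuousAt_const.congr (f := fun _ => (1 : M)) ?_)
  exact Filter.mem_of_superset (N.fixingSubgroup_isOpen.mem_nhds (one_mem _))
    fun γ hγ => (h hγ).symm

theorem exists_fixingSubgroup_le {M : Type*} [Group M] {ρ : Gal(Ω/K) →* M}
    (h : Continuous[_, ⊥] ⇑ρ) :
    ∃ N : IntermediateField K Ω, FiniteDimensional K N ∧ N.fixingSubgroup ≤ ρ.ker := by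
  let _ : TopologicalSpace M := ⊥
  have : DiscreteTopology M := ⟨rfl⟩
  exact (krullTopology_mem_nhds_one_iff K Ω (ρ.ker : Set Gal(Ω/K))).1
    (((isOpen_discrete {(1 : M)}).preimage h).mem_nhds (map_one ρ))

/-- A continuous quadratic character of a subgroup of the Galois group has an eigenvector. -/
theorem exists_eigenvector (S : Subgroup Gal(Ω/K)) (N : IntermediateField K Ω)
    [FiniteDimensional K N] {χ : Gal(Ω/K) → ZMod 2}
    (hmul : ∀ v ∈ S, ∀ w ∈ S, χ (v * w) = χ v + χ w)
    (hN : ∀ w ∈ S, w ∈ N.fixingSubgroup → χ w = 0) :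
    ∃ y : Ω, y ≠ 0 ∧ ∀ w ∈ S, w • y = (-1) ^ (χ w).val * y := by
  classical
  let res : Gal(Ω/K) → (N →ₐ[K] Ω) := fun w => (w : Ω →ₐ[K] Ω).comp N.val
  let f : (N →ₐ[K] Ω) → Ω := fun δ =>
    if h : ∃ w ∈ S, res w = δ then (-1) ^ (χ h.choose).val else 0
  have hf : ∀ w ∈ S, f (res w) = (-1) ^ (χ w).val := by
    intro w hw
    have h : ∃ w' ∈ S, res w' = res w := ⟨w, hw, rfl⟩
    simp only [f, dif_pos h]
    obtain ⟨hv, hvw⟩ := h.choose_spec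
    generalize h.choose = v at hv hvw
    have h1 : χ (w⁻¹ * v) = 0 := by
      refine hN _ (S.mul_mem (S.inv_mem hw) hv) ((mem_fixingSubgroup_iff _).2 fun x hx => ?_)
      rw [mul_smul, inv_smul_eq_iff]
      exact DFunLike.congr_fun hvw (⟨x, hx⟩ : N)
    rw [← mul_inv_cancel_left w v, hmul _ hw _ (S.mul_mem (S.inv_mem hw) hv), h1, add_zero]
  let act : Gal(Ω/K) → (N →ₐ[K] Ω) → (N →ₐ[K] Ω) := fun w δ => (w : Ω →ₐ[K] Ω).comp δ
  have hact : ∀ v w δ, act v (act w δ) = act (v * w) δ := fun _ _ _ => rfl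
  have hact1 : ∀ δ, act 1 δ = δ := fun _ => rfl
  have hres : ∀ v w, act v (res w) = res (v * w) := fun _ _ => rfl
  have hfact : ∀ w ∈ S, ∀ δ, f (act w δ) = (-1) ^ (χ w).val * f δ := by
    intro w hw δ
    by_cases h : ∃ v ∈ S, res v = δ
    · obtain ⟨v, hv, rfl⟩ := h
      rw [hres, hf _ (S.mul_mem hw hv), hf _ hv, hmul _ hw _ hv, neg_one_pow_val_add]
    · have h' : ¬ ∃ v ∈ S, res v = act w δ := by
        rintro ⟨v, hv, h'⟩
        exact h ⟨w⁻¹ * v, S.mul_mem (S.inv_mem hw) hv, by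
          rw [← hres, h', hact, inv_mul_cancel, hact1]⟩
      simp only [f, dif_neg h, dif_neg h', mul_zero]
  have hne : ∃ x : N, ∑ δ, f δ * δ x ≠ 0 := by
    by_contra! h
    have := Fintype.linearIndependent_iff.1 (linearIndependent_toLinearMap K N Ω) f
      (LinearMap.ext fun x => by simpa using h x) (res 1)
    rw [hf 1 S.one_mem] at this
    exact pow_ne_zero _ (neg_ne_zero.2 one_ne_zero) this
  obtain ⟨x, hx⟩ := hne
  refine ⟨_, hx, fun w hw => ?_⟩
  have hbij : Function.Bijective (act w) :=
    Function.bijective_iff_has_inverse.2 ⟨act w⁻¹, fun δ => by rw [hact, inv_mul_cancel, hact1],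
      fun δ => by rw [hact, mul_inv_cancel, hact1]⟩
  have hsq : ((-1 : Ω) ^ (χ w).val) * (-1) ^ (χ w).val = 1 := by
    rw [← mul_pow, neg_one_mul, neg_neg, one_pow]
  have hwf : ∀ δ, w • f δ = f δ := by
    intro δ
    simp only [f]
    split_ifs
    · rw [smul_pow', smul_neg, smul_one]
    · rw [smul_zero]
  calc w • ∑ δ, f δ * δ x = ∑ δ, f δ * act w δ x := by
        rw [Finset.smul_sum]
        exact Finset.sum_congr rfl fun δ _ => by rw [smul_mul', hwf]; rfl
    _ = ∑ δ, (-1) ^ (χ w).val * (f (act w δ) * act w δ x) :=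
        Finset.sum_congr rfl fun δ _ => by
          rw [hfact w hw, ← mul_assoc, ← mul_assoc, hsq, one_mul]
    _ = (-1) ^ (χ w).val * ∑ δ, f δ * δ x := by
        rw [← Finset.mul_sum, hbij.sum_comp fun δ => f δ * δ x]

variable {L : Type*} [Field L] [Algebra K L] [Algebra L Ω] [IsScalarTower K L Ω]

theorem exists_odd_pow_mem_range [IsAlgClosed Ω] [Algebra.IsAlgebraic L Ω] (h2 : (2 : L) ≠ 0)
    {a : Ω} (ha : ∀ σ : Gal(Ω/L), σ a = a) :
    ∃ q, Odd q ∧ a ^ q ∈ (algebraMap L Ω).range := by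
  classical
  have : IsAlgClosure L Ω := ⟨inferInstance, inferInstance⟩
  have : Normal L Ω := IsAlgClosure.normal L Ω
  obtain ⟨q, hq⟩ := ExpChar.exists L
  have hdeg : (minpoly L a).natSepDegree = 1 := by
    rw [Polynomial.natSepDegree_eq_of_isAlgClosed Ω, Finset.card_eq_one]
    refine ⟨a, Finset.ext fun x => ?_⟩
    have h_int : IsIntegral L a := Algebra.IsIntegral.isIntegral a
    rw [Multiset.mem_toFinset, Finset.mem_singleton, ← isConjRoot_iff_mem_minpoly_aroots h_int,
      isConjRoot_iff_exists_algEquiv]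
    constructor
    · rintro ⟨σ, hσ⟩
      rw [← ha σ⁻¹, ← hσ, ← AlgEquiv.mul_apply, inv_mul_cancel, AlgEquiv.one_apply]
    · rintro rfl
      exact ⟨1, rfl⟩
  obtain ⟨m, hm⟩ := (minpoly.natSepDegree_eq_one_iff_pow_mem q).1 hdeg
  refine ⟨q ^ m, Odd.pow ?_, hm⟩
  rcases hq with _ | hp
  · exact odd_one
  · refine hp.odd_of_ne_two ?_
    rintro rfl
    exact h2 (CharP.cast_eq_zero L 2)

variable {G : Type*} [Group G] [Normal K L]

/-- The action of the Galois group on a normal extension with group `G`. -/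
noncomputable def galHom (Ω : Type*) [Field Ω] [Algebra K Ω] [Algebra L Ω] [IsScalarTower K L Ω]
    (e : G ≃* Gal(L/K)) : Gal(Ω/K) →* G :=
  e.symm.toMonoidHom.comp (AlgEquiv.restrictNormalHom L)

theorem galHom_surjective [Normal K Ω] (e : G ≃* Gal(L/K)) :
    Function.Surjective (galHom Ω e) :=
  e.symm.surjective.comp (AlgEquiv.restrictNormalHom_surjective Ω)

variable [MulSemiringAction G L]

theorem apply_algebraMap {e : G ≃* Gal(L/K)} (he : ∀ g x, e g x = g • x) (γ : Gal(Ω/K)) (x : L) :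
    γ (algebraMap L Ω x) = algebraMap L Ω (galHom Ω e γ • x) := by
  rw [← he, galHom, MonoidHom.comp_apply]
  erw [MulEquiv.apply_symm_apply]
  exact (AlgEquiv.restrictNormal_commutes γ L x).symm

theorem galHom_eq_one_iff {e : G ≃* Gal(L/K)} (he : ∀ g x, e g x = g • x) (γ : Gal(Ω/K)) :
    galHom Ω e γ = 1 ↔ ∀ x, γ (algebraMap L Ω x) = algebraMap L Ω x := by
  refine ⟨fun h x => by rw [apply_algebraMap he, h, one_smul], fun h => e.injective ?_⟩
  refine AlgEquiv.ext fun x => (algebraMap L Ω).injective ?_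
  rw [he, ← apply_algebraMap he, h, map_one, AlgEquiv.one_apply]

theorem isKummerSetting {k R : Type*} [Field k] [CommRing R] [IsDomain R] [Algebra k R]
    [MulSemiringAction G R] [Algebra R L] [IsFractionRing R L] [SMulDistribClass G R L]
    [IsAlgClosed Ω] [Algebra.IsAlgebraic L Ω] (h2 : (2 : L) ≠ 0)
    (hunit : ∀ r : R, IsUnit r → ∃ x : k, algebraMap k R x = r)
    {e : G ≃* Gal(L/K)} (he : ∀ g x, e g x = g • x) :
    IsKummerSetting k ((algebraMap L Ω).comp (algebraMap R L)) (galHom Ω e) where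
  injective := (algebraMap L Ω).injective.comp (IsFractionRing.injective R L)
  smul_map γ r := by
    rw [RingHom.comp_apply, AlgEquiv.smul_def, apply_algebraMap he, ← algebraMap.coe_smul']
    rfl
  exists_algebraMap := hunit
  exists_pow a ha := by
    obtain ⟨q, hq, x, hx⟩ := exists_odd_pow_mem_range (a := a) h2 fun σ =>
      ha (σ.restrictScalars K) ((galHom_eq_one_iff he _).2 fun x => σ.commutes x)
    obtain ⟨r, s, hs, rfl⟩ := IsFractionRing.div_surjective R x
    have hs0 := nonZeroDivisors.ne_zero hs
    refine ⟨q, r, s, hq, hs0, ?_⟩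
    rw [← hx, RingHom.comp_apply, RingHom.comp_apply, ← map_mul, mul_div_cancel₀]
    exact (map_ne_zero_iff _ (IsFractionRing.injective R L)).2 hs0

theorem continuous_galHom [FiniteDimensional K L] {M : Type*} [Group M] {e : G ≃* Gal(L/K)}
    (he : ∀ g x, e g x = g • x) (ψ : G →* M) :
    Continuous[_, ⊥] ⇑(ψ.comp (galHom Ω e)) := by
  have : FiniteDimensional K (IsScalarTower.toAlgHom K L Ω).fieldRange :=
    LinearMap.finiteDimensional_range (IsScalarTower.toAlgHom K L Ω).toLinearMap
  refine continuous_of_fixingSubgroup_le (N := (IsScalarTower.toAlgHom K L Ω).fieldRange) ?_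
  intro γ hγ
  rw [MonoidHom.mem_ker, MonoidHom.comp_apply, (galHom_eq_one_iff he γ).2 fun x => ?_, map_one]
  exact (mem_fixingSubgroup_iff _).1 hγ _ ⟨x, rfl⟩

end Galois
theorem not_exists_lift {k R L K Ω : Type*} [Field k] [IsAlgClosed k] [CommRing R] [IsDomain R]
    [UniqueFactorizationMonoid R] [Algebra k R] [MulSemiringAction (GL (Fin 5) (ZMod 2)) R]
    [SMulCommClass (GL (Fin 5) (ZMod 2)) k R] [Field L] [Algebra R L] [IsFractionRing R L]
    [MulSemiringAction (GL (Fin 5) (ZMod 2)) L] [SMulDistribClass (GL (Fin 5) (ZMod 2)) R L]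
    [Field K] [Algebra K L] [Normal K L] [Field Ω] [Algebra K Ω] [Algebra L Ω]
    [IsScalarTower K L Ω] [IsAlgClosed Ω] [Normal K Ω] [Algebra.IsAlgebraic L Ω]
    (h2 : (2 : L) ≠ 0) (hunit : ∀ r : R, IsUnit r → ∃ x : k, algebraMap k R x = r)
    {e : GL (Fin 5) (ZMod 2) ≃* Gal(L/K)} (he : ∀ g x, e g x = g • x)
    {n : Type*} [Fintype n] [DecidableEq n] (f : Fin 5 ↪ n) :
    ¬ ∃ ρ' : Gal(Ω/K) →* GL n (ZMod 4), Continuous[_, ⊥] ⇑ρ' ∧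
      (GeneralLinearGroup.map red).comp ρ' = (ext1Hom f).comp (galHom Ω e) := by
  rintro ⟨ρ', hcont, hρ⟩
  have hred : ∀ γ, GeneralLinearGroup.map red (ρ' γ) = ext1Hom f (galHom Ω e γ) :=
    DFunLike.congr_fun hρ
  have hred1 : ∀ w, galHom Ω e w = 1 → (ρ' w : Matrix n n (ZMod 4)).map red = 1 := by
    intro w hw
    have h := hred w
    rw [hw, map_one] at h
    exact congrArg Units.val h
  obtain ⟨N, _, hN⟩ := exists_fixingSubgroup_le hcont
  have h2Ω : (2 : Ω) ≠ 0 := by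
    rw [← map_ofNat (algebraMap L Ω) 2]
    exact (map_ne_zero _).2 h2
  have hsurj : Function.Surjective (galHom Ω e) := galHom_surjective e
  obtain ⟨γb, hb⟩ := hsurj b
  obtain ⟨γc, hc⟩ := hsurj c
  have hzero := (isKummerSetting (Ω := Ω) h2 hunit he).z_add_z_add_z_eq_zero h2Ω hsurj
    (τ := fun w => tau f (ρ' w : Matrix n n (ZMod 4)))
    (fun γ w hw => by
      rw [map_mul, map_mul, map_inv, Units.val_mul, Units.val_mul]
      exact tau_conj f (hred γ) (hred1 w hw))
    (fun a a' => exists_eigenvector (galHom Ω e).ker N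
      (χ := fun w => tau f (ρ' w : Matrix n n (ZMod 4)) a a')
      (fun v hv w hw => by
        rw [map_mul, Units.val_mul, tau_mul f (hred1 v hv) (hred1 w hw), Matrix.add_apply])
      (fun w _ hw => by
        rw [hN hw, Units.val_one, tau_one, Matrix.zero_apply]))
    hb hc
  have hone := tau_relation f ((hred γb).trans (by rw [hb])) ((hred γc).trans (by rw [hc]))
  simp only [map_mul, map_inv] at hzero
  exact zero_ne_one (hzero.symm.trans hone)

/-- A group acts on the polynomial ring in variables indexed by its elements. -/
noncomputable abbrev regularAction (G k : Type*) [Group G] [CommRing k] :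
    MulSemiringAction G (MvPolynomial G k) where
  smul g p := MvPolynomial.rename (g * ·) p
  one_smul p := by
    change MvPolynomial.rename (1 * ·) p = p
    simp only [one_mul]
    exact MvPolynomial.rename_id_apply p
  mul_smul g h p := by
    change MvPolynomial.rename (g * h * ·) p =
      MvPolynomial.rename (g * ·) (MvPolynomial.rename (h * ·) p)
    rw [MvPolynomial.rename_rename]
    simp only [Function.comp_def, mul_assoc]
  smul_zero g := map_zero (MvPolynomial.rename (g * ·))
  smul_add g := map_add (MvPolynomial.rename (g * ·))
  smul_one g := map_one (MvPolynomial.rename (g * ·))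
  smul_mul g := map_mul (MvPolynomial.rename (g * ·))

section
attribute [local instance] regularAction

theorem regularAction_smulCommClass (G k : Type*) [Group G] [CommRing k] :
    SMulCommClass G k (MvPolynomial G k) :=
  ⟨fun g x p => map_smul (MvPolynomial.rename (g * ·)) x p⟩

theorem regularAction_faithfulSMul (G k : Type*) [Group G] [CommRing k] [Nontrivial k] :
    FaithfulSMul G (MvPolynomial G k) := by
  refine ⟨fun {g h} hgh => ?_⟩
  have h1 : MvPolynomial.rename (R := k) (g * ·) (MvPolynomial.X 1) =
    MvPolynomial.rename (h * ·) (MvPolynomial.X 1) := hgh (MvPolynomial.X 1)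
  simpa using h1

end

theorem exists_continuous_not_exists_lift {k R L K : Type*} [Field k] [IsAlgClosed k] [CommRing R]
    [IsDomain R] [UniqueFactorizationMonoid R] [Algebra k R]
    [MulSemiringAction (GL (Fin 5) (ZMod 2)) R] [SMulCommClass (GL (Fin 5) (ZMod 2)) k R] [Field L]
    [Algebra R L] [IsFractionRing R L] [MulSemiringAction (GL (Fin 5) (ZMod 2)) L]
    [SMulDistribClass (GL (Fin 5) (ZMod 2)) R L] [Field K] [Algebra K L] [Normal K L]
    [FiniteDimensional K L] (h2 : (2 : L) ≠ 0)
    (hunit : ∀ r : R, IsUnit r → ∃ x : k, algebraMap k R x = r)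
    {e : GL (Fin 5) (ZMod 2) ≃* Gal(L/K)} (he : ∀ g x, e g x = g • x)
    {n : Type*} [Fintype n] [DecidableEq n] (f : Fin 5 ↪ n) :
    ∃ ρ : Gal(AlgebraicClosure K/K) →* GL n (ZMod 2), Continuous[_, ⊥] ⇑ρ ∧
      ¬ ∃ ρ' : Gal(AlgebraicClosure K/K) →* GL n (ZMod 4), Continuous[_, ⊥] ⇑ρ' ∧
        (GeneralLinearGroup.map red).comp ρ' = ρ := by
  let j : L →ₐ[K] AlgebraicClosure K := IsAlgClosed.lift
  let _ : Algebra L (AlgebraicClosure K) := j.toRingHom.toAlgebra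
  have : IsScalarTower K L (AlgebraicClosure K) :=
    IsScalarTower.of_algebraMap_eq fun x => (j.commutes x).symm
  have : Algebra.IsAlgebraic L (AlgebraicClosure K) := Algebra.IsAlgebraic.tower_top (K := K) L
  have : Normal K (AlgebraicClosure K) := IsAlgClosure.normal K (AlgebraicClosure K)
  exact ⟨(ext1Hom f).comp (galHom (AlgebraicClosure K) e), continuous_galHom he (ext1Hom f),
    not_exists_lift h2 hunit he f⟩

/-- Over a field of characteristic other than `2` there are an extension `K` and
a continuous homomorphism from its Galois group to `GL n (ZMod 2)` that does not lift modulo `4`. -/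
theorem exists_not_exists_lift {F : Type} [Field F] (h2 : (2 : F) ≠ 0) {n : Type*} [Fintype n]
    [DecidableEq n] (f : Fin 5 ↪ n) :
    ∃ (K : Type) (_ : Field K) (_ : Algebra F K)
      (ρ : Gal(AlgebraicClosure K/K) →* GL n (ZMod 2)), Continuous[_, ⊥] ⇑ρ ∧
        ¬ ∃ ρ' : Gal(AlgebraicClosure K/K) →* GL n (ZMod 4), Continuous[_, ⊥] ⇑ρ' ∧
          (GeneralLinearGroup.map red).comp ρ' = ρ := by
  let G := GL (Fin 5) (ZMod 2)
  let k := AlgebraicClosure F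
  let R := MvPolynomial G k
  let L := FractionRing R
  let _ : MulSemiringAction G R := regularAction G k
  have : SMulCommClass G k R := regularAction_smulCommClass G k
  have : FaithfulSMul G R := regularAction_faithfulSMul G k
  let _ : MulSemiringAction G L := IsFractionRing.mulSemiringAction G R L
  have : SMulDistribClass G R L := IsFractionRing.smulDistribClass G R L
  have : FaithfulSMul G L := IsFractionRing.faithfulSMul G R L
  let K := FixedPoints.subfield G L
  let j : F →+* L := (algebraMap R L).comp ((algebraMap k R).comp (algebraMap F k))
  have hj : ∀ x, j x ∈ K := fun x g => by
    change g • algebraMap R L (algebraMap k R (algebraMap F k x)) = _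
    rw [← algebraMap.coe_smul', smul_algebraMap]
    rfl
  have h2L : (2 : L) ≠ 0 := by
    rw [← map_ofNat j 2]
    exact (map_ne_zero j).2 h2
  have hunit : ∀ r : R, IsUnit r → ∃ x : k, algebraMap k R x = r := fun r hr => by
    obtain ⟨x, -, rfl⟩ := MvPolynomial.isUnit_iff_eq_C_of_isReduced.1 hr
    exact ⟨x, rfl⟩
  have he : ∀ g x, FixedPoints.toAlgAutMulEquiv G L g x = g • x := fun _ _ => rfl
  exact ⟨K, inferInstance, (j.codRestrict K hj).toAlgebra,
    exists_continuous_not_exists_lift h2L hunit he f⟩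

end Nonliftable

/-- If `char F ≠ 2` and `n ≥ 5`, then there exist a field extension `K/F`
and a continuous homomorphism `Γ_K → GL_n(F2)` admitting no continuous lift to
`GL_n(ℤ/4ℤ)`. -/
theorem exists_nonliftable_f2 (F : Type) [Field F] (hF : ringChar F ≠ 2)
    (n : ℕ) (hn : 5 ≤ n) :
    ∃ (K : Type) (instK : Field K),
      letI := instK
      ∃ (_ : Algebra F K) (ρ : Field.absoluteGaloisGroup K →* GL (Fin n) (ZMod 2)),
        Continuous[_, ⊥] ⇑ρ ∧
          ¬ ∃ ρ' : Field.absoluteGaloisGroup K →* GL (Fin n) (ZMod 4),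
              Continuous[_, ⊥] ⇑ρ' ∧
                (Matrix.GeneralLinearGroup.map
                  (ZMod.castHom (show (2 : ℕ) ∣ 4 by norm_num) (ZMod 2))).comp ρ' = ρ := by
  exact Nonliftable.exists_not_exists_lift (Ring.two_ne_zero hF) (Fin.castLEEmb hn)
end
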